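/- arXiv:2304.05598 — 2 statements merged into one kernel-verified Lean document; each statement's English description precedes it below -/
import Mathlib

section
/- There are absolute constants M₀ and C₀ such that the following holds. Let n ≥ s + t + 110 and let f : F_q^n → F_q with 0 < rej_{s+t}(f) < q^{−M₀}. Then there exist a point b ∈ F_q^n and a function f' : F_q^n → F_q that agrees with f at every point except possibly b, such that rej_{s+t}(f') ≤ rej_{s+t}(f) − |supp(H)|/(C₀·q·q^n). -/
noncomputable section

open Finset

/-- Affine maps `F^ℓ → F^n`, given as a pair (linear part matrix, translation). -/
abbrev Aff (F : Type) (n ℓ : ℕ) := Matrix (Fin n) (Fin ℓ) F × (Fin n → F)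

/-- Application of an affine map `T = (M, c)`: `x ↦ Mx + c`. -/
def affApp {F : Type} [Field F] {n ℓ : ℕ} (T : Aff F n ℓ) (x : Fin ℓ → F) : Fin n → F :=
  T.1.mulVec x + T.2

/-- Inner product of two functions `F^m → F`. -/
def ip {F : Type} [Field F] [Fintype F] {m : ℕ} (u v : (Fin m → F) → F) : F :=
  ∑ z : Fin m → F, u z * v z

/-- `g` has degree at most `d` as a function. -/
def fDegLE {F : Type} [Field F] {m : ℕ} (g : (Fin m → F) → F) (d : ℕ) : Prop :=
  ∃ Q : MvPolynomial (Fin m) F, Q.totalDegree ≤ d ∧ ∀ x, MvPolynomial.eval x Q = g x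

/-- The defining equation of the polynomial `P`:
`x_1 ⋯ x_{p-1} · P = ∑_{I ⊆ [p-1]} (-1)^{|I|+1} (x_I + x_p)^{q-1}`. -/
def Pdef {F : Type} [Field F] (p q : ℕ) (hp : 0 < p) (P : MvPolynomial (Fin p) F) : Prop :=
  (∏ i : Fin (p - 1), MvPolynomial.X (Fin.castLE (Nat.sub_le p 1) i)) * P =
    ∑ I : Finset (Fin (p - 1)),
      MvPolynomial.C ((-1 : F) ^ (I.card + 1)) *
        ((∑ i ∈ I, MvPolynomial.X (Fin.castLE (Nat.sub_le p 1) i)) +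
          MvPolynomial.X (⟨p - 1, Nat.sub_lt hp one_pos⟩ : Fin p)) ^ (q - 1)

/-- The test polynomial `H_e` as a function on `F^{s+t}`. -/
def Hfun {F : Type} [Field F] {p : ℕ} (P : MvPolynomial (Fin p) F)
    (s t : ℕ) (e : Fin t → ℕ) (x : Fin (s + t) → F) : F :=
  (∏ i ∈ Finset.range (s / p),
    MvPolynomial.eval (fun l : Fin p =>
      if h : p * i + (l : ℕ) < s + t then x ⟨p * i + (l : ℕ), h⟩ else 0) P) *
  ∏ j : Fin t, x (Fin.natAdd s j) ^ e j

/-- A degree sequence `e ∈ {0, …, q-1}^t` is valid if `∑ e_j ≤ t(q-1) - r`. -/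
def validE (q r t : ℕ) (e : Fin t → ℕ) : Prop :=
  (∀ j, e j ≤ q - 1) ∧ ∑ j, e j ≤ t * (q - 1) - r

/-- `T` rejects `f` in the sparse `(s+t)`-flat test. -/
def rejects {F : Type} [Field F] [Fintype F] {p : ℕ} (P : MvPolynomial (Fin p) F)
    (q s r t n : ℕ) (f : (Fin n → F) → F) (T : Aff F n (s + t)) : Prop :=
  ∃ e : Fin t → ℕ, validE q r t e ∧ ip (fun x => f (affApp T x)) (Hfun P s t e) ≠ 0

/-- Density of `A` inside `C`. -/
def dens {α : Type} (A C : Set α) : ℝ :=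
  (Nat.card ↥(A ∩ C) : ℝ) / (Nat.card ↥C : ℝ)

/-- Fractional measure of a set in a (finite) type. -/
def mu {α : Type} (A : Set α) : ℝ :=
  (Nat.card ↥A : ℝ) / (Nat.card α : ℝ)

/-- The union of the supports of the test polynomials `H_e`. -/
def suppH {F : Type} [Field F] [Fintype F] {p : ℕ} (P : MvPolynomial (Fin p) F)
    (q s t : ℕ) : Set (Fin (s + t) → F) :=
  {x | ∃ e : Fin t → ℕ, (∀ j, e j ≤ q - 1) ∧ Hfun P s t e x ≠ 0}

/-- Edge expansion of a set `S` in the (regular) graph with adjacency `adj`: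
the probability that a uniformly random step started in `S` escapes `S`. -/
def expans {α : Type} (adj : α → α → Prop) (S : Set α) : ℝ :=
  (Nat.card {x : α × α // x.1 ∈ S ∧ adj x.1 x.2 ∧ x.2 ∉ S} : ℝ) /
  (Nat.card {x : α × α // x.1 ∈ S ∧ adj x.1 x.2} : ℝ)

/-- Adjacency in the affine bi-linear scheme graph: two distinct affine maps are adjacent
iff their agreement set is an affine subspace of dimension `ℓ - 1`. -/
def adjBilin {F : Type} [Field F] {n ℓ : ℕ} (T₁ T₂ : Aff F n ℓ) : Prop :=
  T₁ ≠ T₂ ∧ ∃ W : AffineSubspace F (Fin ℓ → F),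
    (W : Set (Fin ℓ → F)).Nonempty ∧
    (W : Set (Fin ℓ → F)) = {x | affApp T₁ x = affApp T₂ x} ∧
    Module.finrank F W.direction = ℓ - 1

/-- `W` is an `ℓ`-flat: a nonempty affine subspace of dimension `ℓ`. -/
def IsFlat {F : Type} [Field F] {N : ℕ} (ℓ : ℕ) (W : AffineSubspace F (Fin N → F)) : Prop :=
  (W : Set (Fin N → F)).Nonempty ∧ Module.finrank F W.direction = ℓ

/-- Adjacency in the affine Grassmann graph `AffGras(N, ℓ)`: two distinct `ℓ`-flats are
adjacent iff their intersection is an `(ℓ-1)`-flat. -/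
def adjGras {F : Type} [Field F] {N : ℕ} (ℓ : ℕ) (U V : AffineSubspace F (Fin N → F)) : Prop :=
  U ≠ V ∧ IsFlat ℓ U ∧ IsFlat ℓ V ∧ IsFlat (ℓ - 1) (U ⊓ V)

/-- The minimal fractional Hamming distance from `f` to a function of degree at most `d`. -/
def deltaDist {F : Type} [Field F] [Fintype F] {n : ℕ} (f : (Fin n → F) → F) (d : ℕ) : ℝ :=
  sInf {x : ℝ | ∃ g : (Fin n → F) → F, fDegLE g d ∧
    x = (Nat.card {y : Fin n → F // f y ≠ g y} : ℝ) / (Fintype.card (Fin n → F) : ℝ)}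

set_option linter.unusedSectionVars false

section FourierBasics

variable {F : Type*} [Field F] [Fintype F] [DecidableEq F]
  {κ ι : Type*} [Fintype κ] [Fintype ι] [DecidableEq κ] [DecidableEq ι]

/-- The entrywise bilinear pairing of two matrices. -/
def matDot (B T : Matrix κ ι F) : F := ∑ k, ∑ i, B k i * T k i

/-- The additive character of matrices attached to `B`. -/
def matChar (ψ : AddChar F ℂ) (B T : Matrix κ ι F) : ℂ := ψ (matDot B T)

/-- The Fourier transform of the indicator function of `S`. -/
def matFourier (ψ : AddChar F ℂ) (S : Finset (Matrix κ ι F)) (B : Matrix κ ι F) : ℂ :=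
  ∑ T ∈ S, matChar ψ B T

lemma matDot_comm (B T : Matrix κ ι F) : matDot B T = matDot T B := by
  simp [matDot, mul_comm]

lemma matDot_add (B T T' : Matrix κ ι F) : matDot B (T + T') = matDot B T + matDot B T' := by
  simp [matDot, mul_add, sum_add_distrib]

lemma matDot_sub (B T T' : Matrix κ ι F) : matDot B (T - T') = matDot B T - matDot B T' := by
  simp [matDot, mul_sub, sum_sub_distrib]

lemma matDot_vecMulVec (B : Matrix κ ι F) (w : κ → F) (a : ι → F) :
    matDot B (Matrix.vecMulVec w a) = w ⬝ᵥ B.mulVec a := by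
  simp only [matDot, Matrix.vecMulVec_apply, dotProduct, Matrix.mulVec, mul_sum]
  exact sum_congr rfl fun k _ => sum_congr rfl fun i _ => by ring

lemma matChar_comm (ψ : AddChar F ℂ) (B T : Matrix κ ι F) :
    matChar ψ B T = matChar ψ T B := by
  rw [matChar, matDot_comm, matChar]

lemma matChar_add (ψ : AddChar F ℂ) (B T T' : Matrix κ ι F) :
    matChar ψ B (T + T') = matChar ψ B T * matChar ψ B T' := by
  rw [matChar, matDot_add, AddChar.map_add_eq_mul, matChar, matChar]

lemma matChar_mul_conj (ψ : AddChar F ℂ) (B T T' : Matrix κ ι F) :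
    matChar ψ B T * (starRingEnd ℂ) (matChar ψ B T') = matChar ψ B (T - T') := by
  rw [matChar, matChar, matChar, matDot_sub, sub_eq_add_neg, AddChar.map_add_eq_mul,
    AddChar.map_neg_eq_conj]

lemma matChar_zero (ψ : AddChar F ℂ) (B : Matrix κ ι F) : matChar ψ B 0 = 1 := by
  simp [matChar, matDot]

lemma sum_matChar {ψ : AddChar F ℂ} (hψ : ψ.IsPrimitive) (B : Matrix κ ι F) :
    ∑ T, matChar ψ B T = if B = 0 then (Fintype.card (Matrix κ ι F) : ℂ) else 0 := by
  split_ifs with h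
  · subst h
    simp [matChar, matDot]
  · let φ : AddChar (Matrix κ ι F) ℂ :=
      { toFun := matChar ψ B
        map_zero_eq_one' := matChar_zero ψ B
        map_add_eq_mul' := matChar_add ψ B }
    have hφ : φ ≠ 1 := by
      obtain ⟨k, i, hki⟩ : ∃ k i, B k i ≠ 0 := by
        by_contra! hc
        exact h (Matrix.ext hc)
      obtain ⟨x, hx⟩ := (AddChar.ne_one_iff).1 (hψ hki)
      refine (AddChar.ne_one_iff).2 ⟨Matrix.single k i x, ?_⟩
      have : matDot B (Matrix.single k i x) = B k i * x := by
        rw [matDot, Fintype.sum_eq_single k, Fintype.sum_eq_single i]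
        · simp
        · intro j hj; simp [Matrix.single, hj.symm]
        · intro j hj; simp [Matrix.single, hj.symm]
      change ψ (matDot B _) ≠ 1
      rw [this]
      exact hx
    exact AddChar.sum_eq_zero_of_ne_one hφ

/-- Plancherel for sums of characters indexed by matrices. -/
lemma sum_norm_sq_matChar {ψ : AddChar F ℂ} (hψ : ψ.IsPrimitive) {J : Type*} [Fintype J]
    [DecidableEq J] {β : J → Matrix κ ι F} (hβ : Function.Injective β) (g : J → ℂ) :
    ∑ T, ‖∑ j, g j * (starRingEnd ℂ) (matChar ψ (β j) T)‖ ^ 2 =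
      Fintype.card (Matrix κ ι F) * ∑ j, ‖g j‖ ^ 2 := by
  have key : ∀ T, ((‖∑ j, g j * (starRingEnd ℂ) (matChar ψ (β j) T)‖ ^ 2 : ℝ) : ℂ) =
      ∑ j, ∑ j', g j * (starRingEnd ℂ) (g j') * matChar ψ (β j' - β j) T := by
    intro T
    push_cast
    rw [← Complex.mul_conj', map_sum, sum_mul_sum]
    refine sum_congr rfl fun j _ => sum_congr rfl fun j' _ => ?_
    rw [matChar_comm ψ (β j' - β j), ← matChar_mul_conj, map_mul, Complex.conj_conj,
      matChar_comm ψ T, matChar_comm ψ T]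
    ring
  have : ((∑ T, ‖∑ j, g j * (starRingEnd ℂ) (matChar ψ (β j) T)‖ ^ 2 : ℝ) : ℂ) =
      ((Fintype.card (Matrix κ ι F) * ∑ j, ‖g j‖ ^ 2 : ℝ) : ℂ) := by
    rw [Complex.ofReal_sum, sum_congr rfl fun T _ => key T, sum_comm]
    push_cast
    rw [mul_sum]
    refine sum_congr rfl fun j _ => ?_
    rw [sum_comm, Fintype.sum_eq_single j]
    · rw [← mul_sum, sum_matChar hψ, sub_self, if_pos rfl, Complex.mul_conj']
      ring
    · intro j' hj'
      rw [← mul_sum, sum_matChar hψ, if_neg, mul_zero]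
      exact fun h => hj' (hβ (sub_eq_zero.1 h))
  exact_mod_cast this

/-- The autocorrelation of a set of matrices. -/
lemma sum_norm_sq_matFourier_mul {ψ : AddChar F ℂ} (hψ : ψ.IsPrimitive)
    (S : Finset (Matrix κ ι F)) (D : Matrix κ ι F) :
    ∑ B, ((‖matFourier ψ S B‖ ^ 2 : ℝ) : ℂ) * matChar ψ B D =
      Fintype.card (Matrix κ ι F) * #{T ∈ S | T + D ∈ S} := by
  have key : ∀ B, ((‖matFourier ψ S B‖ ^ 2 : ℝ) : ℂ) * matChar ψ B D =
      ∑ T ∈ S, ∑ T' ∈ S, matChar ψ (T - T' + D) B := by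
    intro B
    push_cast
    rw [← Complex.mul_conj', matFourier, map_sum, sum_mul_sum, sum_mul]
    refine sum_congr rfl fun T _ => ?_
    rw [sum_mul]
    refine sum_congr rfl fun T' _ => ?_
    rw [matChar_mul_conj, ← matChar_add, matChar_comm]
  rw [sum_congr rfl fun B _ => key B, sum_comm, card_filter]
  push_cast
  rw [mul_sum]
  refine sum_congr rfl fun T _ => ?_
  rw [sum_comm]
  simp_rw [sum_matChar hψ]
  have : ∀ T', (T - T' + D = 0) ↔ T' = T + D := fun T' =>
    ⟨fun h => by rw [← sub_eq_zero, ← neg_eq_zero, ← h]; abel, fun h => by rw [h]; abel⟩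
  simp_rw [this]
  simp

lemma sum_norm_sq_matFourier {ψ : AddChar F ℂ} (hψ : ψ.IsPrimitive)
    (S : Finset (Matrix κ ι F)) :
    ∑ B, ‖matFourier ψ S B‖ ^ 2 = (Fintype.card (Matrix κ ι F) * #S : ℝ) := by
  have := sum_norm_sq_matFourier_mul hψ S 0
  simp only [matChar_zero, mul_one, add_zero, filter_mem_eq_inter, inter_self] at this
  exact_mod_cast this

lemma matFourier_zero (ψ : AddChar F ℂ) (S : Finset (Matrix κ ι F)) :
    matFourier ψ S 0 = #S := by
  simp [matFourier, matChar, matDot]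

lemma sum_addChar_dotProduct {ψ : AddChar F ℂ} (hψ : ψ.IsPrimitive) (v : κ → F) :
    ∑ w : κ → F, ψ (w ⬝ᵥ v) = if v = 0 then (Fintype.card F : ℂ) ^ Fintype.card κ else 0 := by
  split_ifs with h
  · simp [h]
  · let φ : AddChar (κ → F) ℂ :=
      { toFun := fun w => ψ (w ⬝ᵥ v)
        map_zero_eq_one' := by simp
        map_add_eq_mul' := fun a b => by rw [add_dotProduct, AddChar.map_add_eq_mul] }
    have hφ : φ ≠ 1 := by
      obtain ⟨k, hk⟩ := Function.ne_iff.1 h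
      obtain ⟨x, hx⟩ := (AddChar.ne_one_iff).1 (hψ hk)
      refine (AddChar.ne_one_iff).2 ⟨Pi.single k x, ?_⟩
      change ψ (Pi.single k x ⬝ᵥ v) ≠ 1
      rwa [single_dotProduct, mul_comm]
    exact AddChar.sum_eq_zero_of_ne_one hφ

/-- The number of rank-one moves `(T, w, a)` staying inside `S`. -/
def rankOneMoves (S : Finset (Matrix κ ι F)) : ℕ :=
  ∑ w : κ → F, ∑ a : ι → F, #{T ∈ S | T + Matrix.vecMulVec w a ∈ S}

/-- The size of the kernel of a matrix. -/
def kerCard (B : Matrix κ ι F) : ℕ := #{a : ι → F | B.mulVec a = 0}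

lemma sum_norm_sq_mul_kerCard {ψ : AddChar F ℂ} (hψ : ψ.IsPrimitive)
    (S : Finset (Matrix κ ι F)) :
    ∑ B, ‖matFourier ψ S B‖ ^ 2 * ((Fintype.card F : ℝ) ^ Fintype.card κ * kerCard B) =
      (Fintype.card (Matrix κ ι F) * rankOneMoves S : ℝ) := by
  have h1 : ∀ B : Matrix κ ι F, ∑ w : κ → F, ∑ a : ι → F, matChar ψ B (Matrix.vecMulVec w a) =
      (Fintype.card F : ℂ) ^ Fintype.card κ * kerCard B := by
    intro B
    rw [sum_comm]
    simp only [matChar, matDot_vecMulVec, sum_addChar_dotProduct hψ, kerCard, card_filter]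
    push_cast
    rw [mul_sum]
    exact sum_congr rfl fun a _ => by split_ifs <;> simp
  have h2 : ∑ B, ((‖matFourier ψ S B‖ ^ 2 : ℝ) : ℂ) *
      ((Fintype.card F : ℂ) ^ Fintype.card κ * kerCard B) =
      (Fintype.card (Matrix κ ι F) * rankOneMoves S : ℂ) := by
    simp_rw [← h1, mul_sum]
    rw [sum_comm, rankOneMoves]
    push_cast
    rw [mul_sum]
    refine sum_congr rfl fun w _ => ?_
    rw [sum_comm, mul_sum]
    refine sum_congr rfl fun a _ => ?_
    rw [← sum_norm_sq_matFourier_mul hψ S]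
    push_cast
    rfl
  exact_mod_cast h2

lemma kerCard_zero : kerCard (0 : Matrix κ ι F) = Fintype.card F ^ Fintype.card ι := by
  simp [kerCard]

/-- A matrix of rank at most one, in factored form. -/
def RankLEOne (B : Matrix κ ι F) : Prop := ∃ y x, B = Matrix.vecMulVec y x

lemma rankLEOne_of_minors {B : Matrix κ ι F}
    (h : ∀ k k' i i', B k i * B k' i' = B k i' * B k' i) : RankLEOne B := by
  by_cases hB : B = 0
  · exact ⟨0, 0, by simp [hB]⟩
  obtain ⟨k, i, hki⟩ : ∃ k i, B k i ≠ 0 := by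
    by_contra! hc
    exact hB (Matrix.ext hc)
  refine ⟨fun k' => B k' i / B k i, fun i' => B k i', Matrix.ext fun k' i' => ?_⟩
  rw [Matrix.vecMulVec_apply, div_mul_eq_mul_div, eq_div_iff hki, mul_comm (B k' i'), h]
  ring

lemma card_mul_kerCard_le {B : Matrix κ ι F} (hB : B ≠ 0) :
    Fintype.card F * kerCard B ≤ Fintype.card F ^ Fintype.card ι := by
  obtain ⟨k, i, hki⟩ : ∃ k i, B k i ≠ 0 := by
    by_contra! hc
    exact hB (Matrix.ext hc)
  rw [← Fintype.card_fun, kerCard, ← card_univ, ← card_univ, ← card_product]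
  refine card_le_card_of_injOn (fun c => c.2 + Pi.single i c.1) (fun _ _ => by simp) ?_
  rintro ⟨c, a⟩ ha ⟨c', a'⟩ ha' h
  simp only [coe_product, Set.mem_prod, mem_coe, mem_univ, true_and, mem_filter] at ha ha'
  have h2 := congrFun (congrArg B.mulVec h) k
  simp only [Matrix.mulVec_add, ha, ha', zero_add, Matrix.mulVec_single, Pi.smul_apply,
    Matrix.col_apply, MulOpposite.smul_eq_mul_unop, MulOpposite.unop_op] at h2
  have hc : c = c' := mul_left_cancel₀ hki h2
  subst hc
  simpa using h

lemma card_sq_mul_kerCard_le {B : Matrix κ ι F} (hB : ¬ RankLEOne B) :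
    Fintype.card F ^ 2 * kerCard B ≤ Fintype.card F ^ Fintype.card ι := by
  obtain ⟨k, k', i, i', hm⟩ : ∃ k k' i i', B k i * B k' i' ≠ B k i' * B k' i := by
    by_contra! hc
    exact hB (rankLEOne_of_minors hc)
  rw [← Fintype.card_fun, kerCard, sq, ← card_univ, ← card_univ, ← card_product, ← card_product]
  refine card_le_card_of_injOn (fun c => c.2 + (Pi.single i c.1.1 + Pi.single i' c.1.2))
    (fun _ _ => by simp) ?_
  rintro ⟨⟨c, d⟩, a⟩ ha ⟨⟨c', d'⟩, a'⟩ ha' h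
  simp only [coe_product, Set.mem_prod, mem_coe, mem_univ, true_and, mem_filter] at ha ha'
  have h2 := fun k => congrFun (congrArg B.mulVec h) k
  simp only [Matrix.mulVec_add, ha, ha', Matrix.mulVec_single, Pi.smul_apply,
    Matrix.col_apply, MulOpposite.smul_eq_mul_unop, MulOpposite.unop_op, Pi.add_apply] at h2
  have hm' : B k i * B k' i' - B k i' * B k' i ≠ 0 := sub_ne_zero.2 hm
  have hc : c = c' := by
    apply mul_left_cancel₀ hm'
    linear_combination B k' i' * h2 k - B k i' * h2 k'
  have hd : d = d' := by
    apply mul_left_cancel₀ hm'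
    linear_combination B k i * h2 k' - B k' i * h2 k
  subst hc hd
  simpa using h

lemma rankOneMoves_le (S : Finset (Matrix κ ι F)) :
    (Fintype.card (Matrix κ ι F) * rankOneMoves S : ℝ) ≤
      (Fintype.card F : ℝ) ^ Fintype.card κ * (Fintype.card F : ℝ) ^ Fintype.card ι *
      ((#S : ℝ) ^ 2 + ((Fintype.card (Matrix κ ι F) : ℝ) * #S - (#S : ℝ) ^ 2) / Fintype.card F) := by
  obtain ⟨ψ, hψ⟩ := (AddChar.exists_apply_ne_zero (a := (1 : F))).2 one_ne_zero
  have hψ : ψ.IsPrimitive := .of_ne_one fun h => hψ (by simp [h])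
  have hq : (0 : ℝ) < Fintype.card F := by exact_mod_cast Fintype.card_pos
  rw [← sum_norm_sq_mul_kerCard hψ, ← sum_norm_sq_matFourier hψ, Fintype.sum_eq_add_sum_compl 0,
    Fintype.sum_eq_add_sum_compl (0 : Matrix κ ι F) (fun B => ‖matFourier ψ S B‖ ^ 2),
    matFourier_zero, kerCard_zero, RCLike.norm_natCast, add_sub_cancel_left, mul_add]
  push_cast
  refine add_le_add (le_of_eq (by ring)) ?_
  rw [mul_div_assoc', mul_sum, sum_div]
  refine sum_le_sum fun B hB => ?_
  have h1 : ((Fintype.card F : ℝ) * kerCard B) ≤ (Fintype.card F : ℝ) ^ Fintype.card ι := by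
    exact_mod_cast card_mul_kerCard_le (by simpa using hB)
  rw [le_div_iff₀ hq]
  calc _ = ((Fintype.card F : ℝ) ^ Fintype.card κ * ‖matFourier ψ S B‖ ^ 2) *
        ((Fintype.card F : ℝ) * kerCard B) := by ring
    _ ≤ _ := by
        refine (mul_le_mul_of_nonneg_left h1 (by positivity)).trans (le_of_eq ?_)
        ring

end FourierBasics

section HeavyZoom

lemma norm_sq_sum_sum_eq {A B : Type*} [Fintype A] [Fintype B] [DecidableEq A] [DecidableEq B]
    (θ : A → B → ℂ) :
    ((‖∑ a, ∑ b, θ a b‖ ^ 2 : ℝ) : ℂ) + ∑ a, ∑ b, ((‖θ a b‖ ^ 2 : ℝ) : ℂ) =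
      ∑ a, ((‖∑ b, θ a b‖ ^ 2 : ℝ) : ℂ) + ∑ b, ((‖∑ a, θ a b‖ ^ 2 : ℝ) : ℂ) +
      ∑ a, ∑ b, ∑ a', ∑ b',
        if a ≠ a' ∧ b ≠ b' then θ a b * (starRingEnd ℂ) (θ a' b') else 0 := by
  have h0 : ((‖∑ a, ∑ b, θ a b‖ ^ 2 : ℝ) : ℂ) =
      ∑ a, ∑ b, ∑ a', ∑ b', θ a b * (starRingEnd ℂ) (θ a' b') := by
    push_cast
    rw [← Complex.mul_conj', map_sum, sum_mul]
    refine sum_congr rfl fun a _ => ?_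
    rw [sum_mul]
    refine sum_congr rfl fun b _ => ?_
    rw [mul_sum]
    refine sum_congr rfl fun a' _ => ?_
    rw [map_sum, mul_sum]
  have h1 : ∑ a, ∑ b, ((‖θ a b‖ ^ 2 : ℝ) : ℂ) = ∑ a, ∑ b, ∑ a', ∑ b',
      if a = a' ∧ b = b' then θ a b * (starRingEnd ℂ) (θ a' b') else 0 := by
    refine sum_congr rfl fun a _ => sum_congr rfl fun b _ => ?_
    simp [ite_and, Complex.mul_conj']
  have h2 : ∑ a, ((‖∑ b, θ a b‖ ^ 2 : ℝ) : ℂ) = ∑ a, ∑ b, ∑ a', ∑ b',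
      if a = a' then θ a b * (starRingEnd ℂ) (θ a' b') else 0 := by
    refine sum_congr rfl fun a _ => ?_
    push_cast
    rw [← Complex.mul_conj', map_sum, sum_mul]
    refine sum_congr rfl fun b _ => ?_
    rw [sum_comm]
    simp [mul_sum]
  have h3 : ∑ b, ((‖∑ a, θ a b‖ ^ 2 : ℝ) : ℂ) = ∑ a, ∑ b, ∑ a', ∑ b',
      if b = b' then θ a b * (starRingEnd ℂ) (θ a' b') else 0 := by
    rw [sum_comm (s := (univ : Finset A)) (t := (univ : Finset B))]
    refine sum_congr rfl fun b _ => ?_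
    push_cast
    rw [← Complex.mul_conj', map_sum, sum_mul]
    refine sum_congr rfl fun a _ => ?_
    simp [mul_sum]
  rw [h0, h1, h2, h3]
  simp only [← sum_add_distrib]
  refine sum_congr rfl fun a _ => sum_congr rfl fun b _ => sum_congr rfl fun a' _ =>
    sum_congr rfl fun b' _ => ?_
  by_cases ha : a = a' <;> by_cases hb : b = b' <;> simp [ha, hb]

lemma sum_comp_le_of_fiber_le {V Z : Type*} [Fintype V] [Fintype Z] [DecidableEq Z]
    (S : Finset V) (π : V → Z) {c : ℝ} (h : Z → ℝ) (hh : ∀ z, 0 ≤ h z)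
    (hfib : ∀ z, c * #{T ∈ S | π T = z} ≤ #{T | π T = z}) :
    c * ∑ T ∈ S, h (π T) ≤ ∑ T, h (π T) := by
  rw [← sum_fiberwise S π, ← sum_fiberwise univ π, mul_sum]
  refine sum_le_sum fun z _ => ?_
  have e : ∀ U : Finset V, ∑ T ∈ U with π T = z, h (π T) = #{T ∈ U | π T = z} * h z := by
    intro U
    rw [sum_congr rfl (g := fun _ => h z) fun T hT => by rw [(mem_filter.1 hT).2], sum_const,
      nsmul_eq_mul]
  rw [e, e, ← mul_assoc]
  exact mul_le_mul_of_nonneg_right (hfib z) (hh z)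

variable {F : Type*} [Field F] [Fintype F] [DecidableEq F]
  {κ ι : Type*} [Fintype κ] [Fintype ι] [DecidableEq κ] [DecidableEq ι]

lemma card_mulVec_eq {x : ι → F} (hx : x ≠ 0) (z : κ → F) :
    #{T : Matrix κ ι F | T.mulVec x = z} * Fintype.card F ^ Fintype.card κ =
      Fintype.card (Matrix κ ι F) := by
  obtain ⟨i, hi⟩ := Function.ne_iff.1 hx
  have hsurj : ∀ z : κ → F, ∃ T : Matrix κ ι F, T.mulVec x = z := fun z =>
    ⟨Matrix.vecMulVec z (Pi.single i (x i)⁻¹), by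
      rw [Matrix.vecMulVec_mulVec, single_dotProduct, inv_mul_cancel₀ hi]; simp⟩
  let φ : Matrix κ ι F →+ (κ → F) := ⟨⟨fun T => T.mulVec x, by simp⟩, fun a b => by
    simp [Matrix.add_mulVec]⟩
  have h : ∀ z', #{T : Matrix κ ι F | T.mulVec x = z'} = #{T : Matrix κ ι F | T.mulVec x = z} :=
    fun z' => AddMonoidHom.card_fiber_eq_of_mem_range φ (hsurj z') (hsurj z)
  have h2 : Fintype.card (Matrix κ ι F) = ∑ z', #{T : Matrix κ ι F | T.mulVec x = z'} := by
    rw [← card_univ]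
    exact card_eq_sum_card_fiberwise (by simp)
  rw [h2, sum_congr rfl fun z' _ => h z', sum_const, card_univ, smul_eq_mul, mul_comm,
    Fintype.card_fun]

lemma card_vecMul_eq {y : κ → F} (hy : y ≠ 0) (z : ι → F) :
    #{T : Matrix κ ι F | Matrix.vecMul y T = z} * Fintype.card F ^ Fintype.card ι =
      Fintype.card (Matrix κ ι F) := by
  have h1 := card_mulVec_eq (κ := ι) hy z
  have h2 : Fintype.card (Matrix ι κ F) = Fintype.card (Matrix κ ι F) :=
    Fintype.card_congr ⟨Matrix.transpose, Matrix.transpose, fun _ => rfl, fun _ => rfl⟩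
  rw [← h2, ← h1]
  congr 1
  refine card_nbij' Matrix.transpose Matrix.transpose ?_ ?_ (fun _ _ => rfl) (fun _ _ => rfl)
  · intro T hT; simpa [Matrix.mulVec_transpose] using hT
  · intro T hT; simpa [Matrix.vecMul_transpose] using hT

/-- If every element of `S` has many rank-one moves in every direction inside `S`, then
`S` has small density on every hyperplane-type condition `y T = z`. -/
lemma card_vecMul_le {S : Finset (Matrix κ ι F)}
    (hmove : ∀ T ∈ S, ∀ w : κ → F, Fintype.card F ^ Fintype.card ι ≤
      Fintype.card F * #{a : ι → F | T + Matrix.vecMulVec w a ∈ S})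
    {y : κ → F} (hy : y ≠ 0) (z : ι → F) :
    #{T ∈ S | Matrix.vecMul y T = z} * Fintype.card F ^ Fintype.card ι ≤ Fintype.card F * #S := by
  obtain ⟨k, hk⟩ := Function.ne_iff.1 hy
  set w : κ → F := Pi.single k (y k)⁻¹ with hw
  have hyw : y ⬝ᵥ w = 1 := by rw [hw, dotProduct_single, mul_inv_cancel₀ hk]
  set Z := {T ∈ S | Matrix.vecMul y T = z} with hZ
  have h1 : #(Z.sigma fun T => ({a : ι → F | T + Matrix.vecMulVec w a ∈ S} : Finset _)) ≤ #S := by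
    refine card_le_card_of_injOn (fun c => c.1 + Matrix.vecMulVec w c.2) ?_ ?_
    · intro c hc
      simp only [coe_sigma, Set.mem_sigma_iff, mem_coe, mem_filter, mem_univ, true_and] at hc
      exact hc.2
    · rintro ⟨T, a⟩ hc ⟨T', a'⟩ hc' h
      simp only [coe_sigma, Set.mem_sigma_iff, mem_coe, mem_filter, hZ] at hc hc'
      have h2 := congrArg (Matrix.vecMul y) h
      simp only [Matrix.vecMul_add, Matrix.vecMul_vecMulVec, hyw, hc.1.2, hc'.1.2,
        add_right_inj, one_smul] at h2
      subst h2
      simpa using h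
  rw [card_sigma] at h1
  calc #Z * Fintype.card F ^ Fintype.card ι
      = ∑ T ∈ Z, Fintype.card F ^ Fintype.card ι := by simp
    _ ≤ ∑ T ∈ Z, Fintype.card F * #{a : ι → F | T + Matrix.vecMulVec w a ∈ S} :=
        sum_le_sum fun T hT => hmove T (mem_filter.1 hT).1 w
    _ = Fintype.card F * ∑ T ∈ Z, #{a : ι → F | T + Matrix.vecMulVec w a ∈ S} := by
        rw [mul_sum]
    _ ≤ _ := Nat.mul_le_mul_left _ h1

lemma exists_dual_of_not_proportional {x x' : ι → F} (hx' : x' ≠ 0) (h : ∀ c : F, x ≠ c • x') :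
    ∃ v : ι → F, x ⬝ᵥ v = 1 ∧ x' ⬝ᵥ v = 0 := by
  obtain ⟨l, hl⟩ := Function.ne_iff.1 hx'
  simp only [Pi.zero_apply] at hl
  obtain ⟨k, hk⟩ : ∃ k, x k * x' l - x l * x' k ≠ 0 := by
    by_contra! hc
    refine h (x l / x' l) (funext fun k => ?_)
    rw [Pi.smul_apply, smul_eq_mul, div_mul_eq_mul_div, eq_div_iff hl]
    linear_combination hc k
  refine ⟨Pi.single k (x' l / (x k * x' l - x l * x' k)) -
    Pi.single l (x' k / (x k * x' l - x l * x' k)), ?_, ?_⟩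
  · rw [dotProduct_sub, dotProduct_single, dotProduct_single]
    field_simp
  · rw [dotProduct_sub, dotProduct_single, dotProduct_single]
    ring

end HeavyZoom

section RankOneFamily

variable {F : Type*} [Field F] [Fintype F] [DecidableEq F]
  {κ ι : Type*} [Fintype κ] [Fintype ι] [DecidableEq κ] [DecidableEq ι]
  {A B : Type*} [Fintype A] [Fintype B] [DecidableEq A] [DecidableEq B]

/-- A system of representatives of the lines of a space of vectors. -/
def LineReps (X : A → ι → F) : Prop :=
  (∀ a, X a ≠ 0) ∧ (∀ a a', a ≠ a' → ∀ c : F, X a ≠ c • X a') ∧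
    ∀ x : ι → F, x ≠ 0 → ∃ a, ∃ c : F, x = c • X a

lemma exists_lineReps (F ι : Type) [Field F] [Fintype F] [Fintype ι] :
    ∃ (A : Type) (_ : Fintype A) (X : A → ι → F), LineReps X := by
  refine ⟨Projectivization F (ι → F), Fintype.ofFinite _, Projectivization.rep,
    Projectivization.rep_nonzero, ?_, ?_⟩
  · intro a a' h c hc
    apply h
    rw [← a.mk_rep, ← a'.mk_rep, Projectivization.mk_eq_mk_iff']
    exact ⟨c, hc.symm⟩
  · intro x hx
    obtain ⟨c, hc⟩ := Projectivization.exists_smul_eq_mk_rep F x hx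
    refine ⟨Projectivization.mk F x hx, (c⁻¹ : Fˣ), ?_⟩
    rw [← hc, ← Units.smul_def, inv_smul_smul]

/-- The rank-one matrix with the given row line, column line and scalar. -/
def rankOneMat (X : A → ι → F) (Y : B → κ → F) (i : A × B × Fˣ) : Matrix κ ι F :=
  Matrix.vecMulVec ((i.2.2 : F) • Y i.2.1) (X i.1)

/-- Two indices of rank-one matrices in general position. -/
abbrev GenericPair (i j : A × B × Fˣ) : Prop := i.1 ≠ j.1 ∧ i.2.1 ≠ j.2.1

variable {X : A → ι → F} {Y : B → κ → F}

lemma exists_dotProduct_eq_one {x : ι → F} (hx : x ≠ 0) : ∃ v : ι → F, x ⬝ᵥ v = 1 := by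
  obtain ⟨k, hk⟩ := Function.ne_iff.1 hx
  exact ⟨Pi.single k (x k)⁻¹, by rw [dotProduct_single, mul_inv_cancel₀ hk]⟩

lemma rankOneMat_mulVec (i : A × B × Fˣ) (v : ι → F) :
    (rankOneMat X Y i).mulVec v = ((X i.1 ⬝ᵥ v) * i.2.2) • Y i.2.1 := by
  rw [rankOneMat, Matrix.vecMulVec_mulVec, op_smul_eq_smul, smul_smul]

lemma vecMul_rankOneMat (i : A × B × Fˣ) (u : κ → F) :
    Matrix.vecMul u (rankOneMat X Y i) = ((i.2.2 : F) * (u ⬝ᵥ Y i.2.1)) • X i.1 := by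
  rw [rankOneMat, Matrix.vecMul_vecMulVec, dotProduct_smul, smul_eq_mul]

lemma rankOneMat_ne_zero (hX : LineReps X) (hY : LineReps Y) (i : A × B × Fˣ) :
    rankOneMat X Y i ≠ 0 := by
  intro h
  obtain ⟨v, hv⟩ := exists_dotProduct_eq_one (hX.1 i.1)
  have := rankOneMat_mulVec (X := X) (Y := Y) i v
  rw [h, hv, Matrix.zero_mulVec, one_mul] at this
  exact hY.1 i.2.1 ((smul_eq_zero.1 this.symm).resolve_left i.2.2.ne_zero)

lemma rankLEOne_rankOneMat (i : A × B × Fˣ) : RankLEOne (rankOneMat X Y i) := ⟨_, _, rfl⟩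

lemma rankOneMat_injective (hX : LineReps X) (hY : LineReps Y) :
    Function.Injective (rankOneMat X Y) := by
  rintro ⟨a, b, c⟩ ⟨a', b', c'⟩ h
  have ha : a = a' := by
    by_contra hne
    obtain ⟨v, hv, hv'⟩ := exists_dual_of_not_proportional (hX.1 a') (hX.2.1 a a' hne)
    have h1 := congrArg (fun M => Matrix.mulVec M v) h
    simp only [rankOneMat_mulVec, hv, hv', one_mul, zero_mul, zero_smul] at h1
    exact hY.1 b ((smul_eq_zero.1 h1).resolve_left c.ne_zero)
  subst ha
  obtain ⟨v, hv⟩ := exists_dotProduct_eq_one (hX.1 a)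
  have h1 := congrArg (fun M => Matrix.mulVec M v) h
  simp only [rankOneMat_mulVec, hv, one_mul] at h1
  have hb : b = b' := by
    by_contra hne
    refine hY.2.1 b b' hne ((c : F)⁻¹ * c') ?_
    rw [mul_smul, ← h1, inv_smul_smul₀ c.ne_zero]
  subst hb
  have hc : c = c' := by
    obtain ⟨u, hu⟩ := exists_dotProduct_eq_one (hY.1 b)
    have h2 := congrArg (fun y => y ⬝ᵥ u) h1
    simp only [smul_dotProduct, hu, smul_eq_mul, mul_one] at h2
    exact Units.ext h2
  rw [hc]

lemma exists_rankOneMat_eq (hX : LineReps X) (hY : LineReps Y) {D : Matrix κ ι F} (hD : D ≠ 0)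
    (h : RankLEOne D) : ∃ i, rankOneMat X Y i = D := by
  obtain ⟨y, x, rfl⟩ := h
  have hy : y ≠ 0 := fun h => hD (by simp [h])
  have hx : x ≠ 0 := fun h => hD (by rw [h]; ext; simp [Matrix.vecMulVec_apply])
  obtain ⟨a, c, rfl⟩ := hX.2.2 x hx
  obtain ⟨b, c', rfl⟩ := hY.2.2 y hy
  have hc : c * c' ≠ 0 := mul_ne_zero (fun h => hx (by simp [h])) (fun h => hy (by simp [h]))
  refine ⟨(a, b, Units.mk0 _ hc), ?_⟩
  ext k i
  simp only [rankOneMat, Matrix.vecMulVec_apply, Pi.smul_apply, smul_eq_mul, Units.val_mk0]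
  ring

lemma not_rankLEOne_sub (hX : LineReps X) (hY : LineReps Y) {i j : A × B × Fˣ}
    (h : GenericPair i j) : ¬ RankLEOne (rankOneMat X Y j - rankOneMat X Y i) := by
  rintro ⟨y, x, hD⟩
  obtain ⟨v, hv, hv'⟩ := exists_dual_of_not_proportional (hX.1 j.1) (hX.2.1 _ _ h.1)
  obtain ⟨v', hw, hw'⟩ := exists_dual_of_not_proportional (hX.1 i.1) (hX.2.1 _ _ h.1.symm)
  have h1 := congrArg (fun M => Matrix.mulVec M v) hD
  have h2 := congrArg (fun M => Matrix.mulVec M v') hD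
  simp only [Matrix.sub_mulVec, rankOneMat_mulVec, hv, hv', hw, hw', Matrix.vecMulVec_mulVec,
    op_smul_eq_smul, one_mul, zero_mul, zero_smul, zero_sub, sub_zero] at h1 h2
  have hx : x ⬝ᵥ v' ≠ 0 := by
    intro h0
    rw [h0, zero_smul] at h2
    exact hY.1 _ ((smul_eq_zero.1 h2).resolve_left j.2.2.ne_zero)
  refine hY.2.1 _ _ h.2 (-((i.2.2 : F)⁻¹ * ((x ⬝ᵥ v) * ((x ⬝ᵥ v')⁻¹ * j.2.2)))) ?_
  rw [neg_smul, mul_smul, mul_smul, mul_smul, h2, inv_smul_smul₀ hx, ← h1, smul_neg,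
    inv_smul_smul₀ i.2.2.ne_zero, neg_neg]

lemma card_genericPair_le (hX : LineReps X) (hY : LineReps Y) (D : Matrix κ ι F) :
    #{ij : (A × B × Fˣ) × (A × B × Fˣ) | GenericPair ij.1 ij.2 ∧
      rankOneMat X Y ij.2 - rankOneMat X Y ij.1 = D} ≤ Fintype.card F ^ 4 := by
  set G := ({ij : (A × B × Fˣ) × (A × B × Fˣ) | GenericPair ij.1 ij.2 ∧
      rankOneMat X Y ij.2 - rankOneMat X Y ij.1 = D} : Finset _) with hG
  rcases G.eq_empty_or_nonempty with h0 | ⟨⟨i₀, j₀⟩, h0⟩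
  · simp [h0]
  simp only [hG, mem_filter, mem_univ, true_and] at h0
  set R₁ : Finset (κ → F) := univ.image D.mulVec
  set R₂ : Finset (ι → F) := univ.image fun u => Matrix.vecMul u D
  have hR₁ : #R₁ ≤ Fintype.card F ^ 2 := by
    have : R₁ ⊆ univ.image fun st : F × F => st.1 • Y j₀.2.1 - st.2 • Y i₀.2.1 := by
      intro y hy
      obtain ⟨v, -, rfl⟩ := mem_image.1 hy
      rw [← h0.2, Matrix.sub_mulVec, rankOneMat_mulVec, rankOneMat_mulVec]
      exact mem_image.2 ⟨(_, _), mem_univ _, rfl⟩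
    refine (card_le_card this).trans (card_image_le.trans ?_)
    simp [sq]
  have hR₂ : #R₂ ≤ Fintype.card F ^ 2 := by
    have : R₂ ⊆ univ.image fun st : F × F => st.1 • X j₀.1 - st.2 • X i₀.1 := by
      intro y hy
      obtain ⟨v, -, rfl⟩ := mem_image.1 hy
      rw [← h0.2, Matrix.vecMul_sub, vecMul_rankOneMat, vecMul_rankOneMat]
      exact mem_image.2 ⟨(_, _), mem_univ _, rfl⟩
    refine (card_le_card this).trans (card_image_le.trans ?_)
    simp [sq]
  have hG' : #G ≤ #((R₁ ×ˢ R₂).image fun yx => Matrix.vecMulVec yx.1 yx.2) := by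
    refine card_le_card_of_injOn (fun ij => rankOneMat X Y ij.1) ?_ ?_
    · rintro ⟨i, j⟩ hij
      simp only [hG, coe_filter, mem_univ, true_and, Set.mem_ofPred_eq] at hij
      obtain ⟨v, hv, hv'⟩ := exists_dual_of_not_proportional (hX.1 j.1) (hX.2.1 _ _ hij.1.1)
      obtain ⟨u, hu, hu'⟩ :=
        exists_dual_of_not_proportional (hY.1 j.2.1) (hY.2.1 _ _ hij.1.2)
      refine mem_coe.2 (mem_image.2 ⟨((i.2.2 : F) • Y i.2.1, X i.1), mem_product.2 ⟨?_, ?_⟩, rfl⟩)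
      · refine mem_image.2 ⟨-v, mem_univ _, ?_⟩
        rw [← hij.2, Matrix.mulVec_neg, Matrix.sub_mulVec, rankOneMat_mulVec, rankOneMat_mulVec,
          hv, hv']
        simp
      · refine mem_image.2 ⟨-((i.2.2 : F)⁻¹ • u), mem_univ _, ?_⟩
        rw [← hij.2, Matrix.neg_vecMul, Matrix.vecMul_sub, vecMul_rankOneMat, vecMul_rankOneMat,
          smul_dotProduct, smul_dotProduct, dotProduct_comm u, hu', dotProduct_comm u, hu]
        simp
    · rintro ⟨i, j⟩ hij ⟨i', j'⟩ hij' h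
      simp only [hG, coe_filter, mem_univ, true_and, Set.mem_ofPred_eq] at hij hij' h
      have hj : rankOneMat X Y j = rankOneMat X Y j' := by
        rw [← sub_add_cancel (rankOneMat X Y j) (rankOneMat X Y i), hij.2, h, ← hij'.2,
          sub_add_cancel]
      rw [rankOneMat_injective hX hY h, rankOneMat_injective hX hY hj]
  calc #G ≤ #(R₁ ×ˢ R₂) := hG'.trans card_image_le
    _ = #R₁ * #R₂ := card_product _ _
    _ ≤ Fintype.card F ^ 2 * Fintype.card F ^ 2 := Nat.mul_le_mul hR₁ hR₂
    _ = Fintype.card F ^ 4 := by ring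

lemma matChar_rankOneMat (ψ : AddChar F ℂ) (i : A × B × Fˣ) (T : Matrix κ ι F) :
    matChar ψ (rankOneMat X Y i) T = ψ (((i.2.2 : F) • Y i.2.1) ⬝ᵥ T.mulVec (X i.1)) := by
  rw [matChar, matDot_comm, rankOneMat, matDot_vecMulVec]

lemma matChar_rankOneMat' (ψ : AddChar F ℂ) (i : A × B × Fˣ) (T : Matrix κ ι F) :
    matChar ψ (rankOneMat X Y i) T = ψ ((i.2.2 : F) * (Matrix.vecMul (Y i.2.1) T ⬝ᵥ X i.1)) := by
  rw [matChar_rankOneMat, smul_dotProduct, Matrix.dotProduct_mulVec, smul_eq_mul]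

end RankOneFamily

section HeavyZoomMain

variable {F : Type*} [Field F] [Fintype F] [DecidableEq F]
  {κ ι : Type*} [Fintype κ] [Fintype ι] [DecidableEq κ] [DecidableEq ι]
  {A B : Type*} [Fintype A] [Fintype B] [DecidableEq A] [DecidableEq B]
  {X : A → ι → F} {Y : B → κ → F}

instance decidableRankLEOne (D : Matrix κ ι F) : Decidable (RankLEOne D) :=
  Classical.propDecidable _

/-- The part of the squared Fourier mass of `S` on matrices of rank at least two. -/
def highRankMass (ψ : AddChar F ℂ) (S : Finset (Matrix κ ι F)) : ℝ :=
  ∑ B with ¬ RankLEOne B, ‖matFourier ψ S B‖ ^ 2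

lemma highRankMass_nonneg (ψ : AddChar F ℂ) (S : Finset (Matrix κ ι F)) :
    0 ≤ highRankMass ψ S := sum_nonneg fun _ _ => by positivity

/-- The part of the squared Fourier mass of `S` on matrices of rank one. -/
def rankOneMass (X : A → ι → F) (Y : B → κ → F) (ψ : AddChar F ℂ)
    (S : Finset (Matrix κ ι F)) : ℝ :=
  ∑ i, ‖matFourier ψ S (rankOneMat X Y i)‖ ^ 2

lemma sum_split_rank (hX : LineReps X) (hY : LineReps Y) (g : Matrix κ ι F → ℝ) :
    ∑ D, g D = g 0 + ∑ i, g (rankOneMat X Y i) +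
      ∑ D with ¬ RankLEOne D, g D := by
  classical
  have h1 : ∑ i, g (rankOneMat X Y i) = ∑ D with D ≠ 0 ∧ RankLEOne D, g D := by
    rw [← sum_image (f := g) (s := univ) (g := rankOneMat X Y)
      fun i _ j _ h => rankOneMat_injective hX hY h]
    refine sum_congr (Finset.ext fun D => ?_) fun _ _ => rfl
    simp only [mem_image, mem_univ, true_and, mem_filter]
    constructor
    · rintro ⟨i, rfl⟩
      exact ⟨rankOneMat_ne_zero hX hY i, rankLEOne_rankOneMat i⟩
    · rintro ⟨h, h'⟩
      exact exists_rankOneMat_eq hX hY h h'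
  have h2 : g 0 + ∑ D with D ≠ 0 ∧ RankLEOne D, g D = ∑ D with RankLEOne D, g D := by
    have h0 : (0 : Matrix κ ι F) ∈ ({D | RankLEOne D} : Finset _) := by
      simp only [mem_filter, mem_univ, true_and]
      exact ⟨0, 0, by simp⟩
    rw [← add_sum_erase _ _ h0]
    congr 1
    refine sum_congr (Finset.ext fun D => ?_) fun _ _ => rfl
    simp
  rw [h1, h2]
  exact (sum_filter_add_sum_filter_not _ _ _).symm

lemma mass_split {ψ : AddChar F ℂ} (hψ : ψ.IsPrimitive) (hX : LineReps X) (hY : LineReps Y)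
    (S : Finset (Matrix κ ι F)) :
    (Fintype.card (Matrix κ ι F) * #S : ℝ) =
      (#S : ℝ) ^ 2 + rankOneMass X Y ψ S + highRankMass ψ S := by
  rw [← sum_norm_sq_matFourier hψ, sum_split_rank hX hY, matFourier_zero, RCLike.norm_natCast]
  rfl

lemma moves_le {ψ : AddChar F ℂ} (hψ : ψ.IsPrimitive) (hX : LineReps X) (hY : LineReps Y)
    (S : Finset (Matrix κ ι F)) :
    (Fintype.card (Matrix κ ι F) * rankOneMoves S : ℝ) * (Fintype.card F : ℝ) ^ 2 ≤
      (Fintype.card F : ℝ) ^ Fintype.card κ * (Fintype.card F : ℝ) ^ Fintype.card ι *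
      ((#S : ℝ) ^ 2 * (Fintype.card F : ℝ) ^ 2 + rankOneMass X Y ψ S * Fintype.card F +
        highRankMass ψ S) := by
  rw [← sum_norm_sq_mul_kerCard hψ, sum_split_rank hX hY, matFourier_zero, RCLike.norm_natCast,
    kerCard_zero, add_mul, add_mul, mul_add, mul_add]
  refine add_le_add (add_le_add ?_ ?_) ?_
  · push_cast
    exact le_of_eq (by ring)
  · rw [rankOneMass, sum_mul, sum_mul, mul_sum]
    refine sum_le_sum fun i _ => ?_
    have h1 : ((Fintype.card F : ℝ) * kerCard (rankOneMat X Y i)) ≤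
        (Fintype.card F : ℝ) ^ Fintype.card ι := by
      exact_mod_cast card_mul_kerCard_le (rankOneMat_ne_zero hX hY i)
    calc _ = ((Fintype.card F : ℝ) ^ Fintype.card κ *
          ‖matFourier ψ S (rankOneMat X Y i)‖ ^ 2 * Fintype.card F) *
          ((Fintype.card F : ℝ) * kerCard (rankOneMat X Y i)) := by ring
      _ ≤ _ := (mul_le_mul_of_nonneg_left h1 (by positivity)).trans (le_of_eq (by ring))
  · rw [highRankMass, sum_mul, mul_sum]
    refine sum_le_sum fun D hD => ?_
    have h1 : ((Fintype.card F : ℝ) ^ 2 * kerCard D) ≤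
        (Fintype.card F : ℝ) ^ Fintype.card ι := by
      exact_mod_cast card_sq_mul_kerCard_le (mem_filter.1 hD).2
    calc _ = ((Fintype.card F : ℝ) ^ Fintype.card κ * ‖matFourier ψ S D‖ ^ 2) *
          ((Fintype.card F : ℝ) ^ 2 * kerCard D) := by ring
      _ ≤ _ := (mul_le_mul_of_nonneg_left h1 (by positivity)).trans (le_of_eq (by ring))

lemma sum_genericPair_le (hX : LineReps X) (hY : LineReps Y) (ψ : AddChar F ℂ)
    (S : Finset (Matrix κ ι F)) :
    ∑ ij : (A × B × Fˣ) × (A × B × Fˣ) with GenericPair ij.1 ij.2,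
      ‖matFourier ψ S (rankOneMat X Y ij.2 - rankOneMat X Y ij.1)‖ ^ 2 ≤
      (Fintype.card F : ℝ) ^ 4 * highRankMass ψ S := by
  classical
  rw [highRankMass, mul_sum, ← sum_fiberwise_of_maps_to
    (s := ({ij | GenericPair ij.1 ij.2} : Finset ((A × B × Fˣ) × (A × B × Fˣ))))
    (t := ({D | ¬ RankLEOne D} : Finset (Matrix κ ι F)))
    (g := fun ij => rankOneMat X Y ij.2 - rankOneMat X Y ij.1)
    (fun ij hij => mem_filter.2 ⟨mem_univ _, not_rankLEOne_sub hX hY (mem_filter.1 hij).2⟩)]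
  refine sum_le_sum fun D _ => ?_
  rw [sum_congr rfl (g := fun _ => ‖matFourier ψ S D‖ ^ 2)
    fun T hT => by rw [(mem_filter.1 hT).2], sum_const, nsmul_eq_mul, filter_filter]
  refine mul_le_mul_of_nonneg_right ?_ (by positivity)
  exact_mod_cast card_genericPair_le hX hY D

/-- The projection of the indicator function of `S` to the rank-one characters, split
according to the lines of rows and columns. -/
def rankOnePart (X : A → ι → F) (Y : B → κ → F) (ψ : AddChar F ℂ)
    (S : Finset (Matrix κ ι F)) (T : Matrix κ ι F) (a : A) (b : B) : ℂ :=
  ∑ c : Fˣ, matFourier ψ S (rankOneMat X Y (a, b, c)) *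
    (starRingEnd ℂ) (matChar ψ (rankOneMat X Y (a, b, c)) T)

lemma sum_rankOnePart (ψ : AddChar F ℂ) (S : Finset (Matrix κ ι F)) (T : Matrix κ ι F) :
    ∑ a, ∑ b, rankOnePart X Y ψ S T a b = ∑ i, matFourier ψ S (rankOneMat X Y i) *
      (starRingEnd ℂ) (matChar ψ (rankOneMat X Y i) T) := by
  simp only [Fintype.sum_prod_type, rankOnePart]

lemma sum_sum_rankOnePart (ψ : AddChar F ℂ) (S : Finset (Matrix κ ι F)) :
    ∑ T ∈ S, ∑ a, ∑ b, rankOnePart X Y ψ S T a b = (rankOneMass X Y ψ S : ℂ) := by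
  simp only [sum_rankOnePart]
  rw [sum_comm, rankOneMass]
  push_cast
  refine sum_congr rfl fun i _ => ?_
  rw [← mul_sum, ← Complex.mul_conj', ← map_sum]
  rfl

lemma generic_part_eq (ψ : AddChar F ℂ) (S : Finset (Matrix κ ι F)) :
    ∑ T ∈ S, ∑ a, ∑ b, ∑ a', ∑ b',
      (if a ≠ a' ∧ b ≠ b' then rankOnePart X Y ψ S T a b *
        (starRingEnd ℂ) (rankOnePart X Y ψ S T a' b') else 0) =
    ∑ ij : (A × B × Fˣ) × (A × B × Fˣ) with GenericPair ij.1 ij.2,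
      matFourier ψ S (rankOneMat X Y ij.1) *
      (starRingEnd ℂ) (matFourier ψ S (rankOneMat X Y ij.2)) *
      matFourier ψ S (rankOneMat X Y ij.2 - rankOneMat X Y ij.1) := by
  have h : ∀ T, ∑ a, ∑ b, ∑ a', ∑ b',
      (if a ≠ a' ∧ b ≠ b' then rankOnePart X Y ψ S T a b *
        (starRingEnd ℂ) (rankOnePart X Y ψ S T a' b') else 0) =
      ∑ ij : (A × B × Fˣ) × (A × B × Fˣ) with GenericPair ij.1 ij.2,
      matFourier ψ S (rankOneMat X Y ij.1) *
      (starRingEnd ℂ) (matFourier ψ S (rankOneMat X Y ij.2)) *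
      matChar ψ (rankOneMat X Y ij.2 - rankOneMat X Y ij.1) T := by
    intro T
    rw [sum_filter]
    simp only [Fintype.sum_prod_type, GenericPair]
    refine sum_congr rfl fun a _ => sum_congr rfl fun b _ => ?_
    symm
    rw [sum_comm]
    refine sum_congr rfl fun a' _ => ?_
    rw [sum_comm]
    refine sum_congr rfl fun b' _ => ?_
    by_cases hg : a ≠ a' ∧ b ≠ b'
    · simp only [if_pos hg]
      rw [rankOnePart, rankOnePart, map_sum, sum_mul_sum]
      refine sum_congr rfl fun c _ => sum_congr rfl fun c' _ => ?_
      rw [matChar_comm ψ (_ - _), ← matChar_mul_conj, map_mul, Complex.conj_conj,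
        matChar_comm ψ T, matChar_comm ψ T]
      ring
    · simp only [if_neg hg, sum_const_zero]
  rw [sum_congr rfl fun T _ => h T, sum_comm]
  refine sum_congr rfl fun ij _ => ?_
  rw [← mul_sum]
  rfl

lemma norm_generic_part_le (hX : LineReps X) (hY : LineReps Y) (ψ : AddChar F ℂ)
    (S : Finset (Matrix κ ι F)) {R : ℝ} (hR : 0 ≤ R)
    (h : (Fintype.card F : ℝ) ^ 4 * highRankMass ψ S ≤ R ^ 2) :
    ‖∑ ij : (A × B × Fˣ) × (A × B × Fˣ) with GenericPair ij.1 ij.2,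
      matFourier ψ S (rankOneMat X Y ij.1) *
      (starRingEnd ℂ) (matFourier ψ S (rankOneMat X Y ij.2)) *
      matFourier ψ S (rankOneMat X Y ij.2 - rankOneMat X Y ij.1)‖ ≤ rankOneMass X Y ψ S * R := by
  have hW : 0 ≤ rankOneMass X Y ψ S := sum_nonneg fun _ _ => by positivity
  refine (norm_sum_le _ _).trans ?_
  simp only [norm_mul, RCLike.norm_conj]
  refine le_of_sq_le_sq ?_ (mul_nonneg hW hR)
  refine (sum_mul_sq_le_sq_mul_sq _ _ _).trans ?_
  rw [mul_pow]
  refine mul_le_mul ?_ ((sum_genericPair_le hX hY ψ S).trans h)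
    (sum_nonneg fun _ _ => by positivity) (by positivity)
  refine (sum_le_sum_of_subset_of_nonneg (filter_subset _ _) fun _ _ _ => by positivity).trans ?_
  rw [rankOneMass, sq, sum_mul_sum, Fintype.sum_prod_type]
  exact le_of_eq (sum_congr rfl fun i _ => sum_congr rfl fun j _ => by ring)

lemma sum_norm_sq_rankOnePart_le {ψ : AddChar F ℂ} (hψ : ψ.IsPrimitive) (hX : LineReps X)
    (hY : LineReps Y) (S : Finset (Matrix κ ι F)) {R : ℝ} (hR : 0 ≤ R)
    (h : (Fintype.card F : ℝ) ^ 4 * highRankMass ψ S ≤ R ^ 2)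
    (hin : ∀ x : ι → F, x ≠ 0 → ∀ z : κ → F,
      (8 : ℝ) * #{T ∈ S | T.mulVec x = z} ≤ #{T : Matrix κ ι F | T.mulVec x = z})
    (hout : ∀ y : κ → F, y ≠ 0 → ∀ z : ι → F,
      (8 : ℝ) * #{T ∈ S | Matrix.vecMul y T = z} ≤ #{T : Matrix κ ι F | Matrix.vecMul y T = z}) :
    ∑ T ∈ S, ‖∑ a, ∑ b, rankOnePart X Y ψ S T a b‖ ^ 2 ≤
      Fintype.card (Matrix κ ι F) * rankOneMass X Y ψ S / 4 + rankOneMass X Y ψ S * R := by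
  have hrow : ∀ a, (8 : ℝ) * ∑ T ∈ S, ‖∑ b, rankOnePart X Y ψ S T a b‖ ^ 2 ≤
      Fintype.card (Matrix κ ι F) * ∑ b, ∑ c, ‖matFourier ψ S (rankOneMat X Y (a, b, c))‖ ^ 2 := by
    intro a
    have h1 := sum_norm_sq_matChar hψ (β := fun bc : B × Fˣ => rankOneMat X Y (a, bc.1, bc.2))
      (fun bc bc' h => by
        have := rankOneMat_injective hX hY h
        simp only [Prod.mk.injEq, true_and] at this
        exact Prod.ext this.1 this.2)
      (fun bc => matFourier ψ S (rankOneMat X Y (a, bc.1, bc.2)))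
    simp only [Fintype.sum_prod_type] at h1
    rw [← h1]
    have h2 := sum_comp_le_of_fiber_le S (fun T => T.mulVec (X a))
      (fun z => ‖∑ b, ∑ c : Fˣ, matFourier ψ S (rankOneMat X Y (a, b, c)) *
        (starRingEnd ℂ) (ψ (((c : F) • Y b) ⬝ᵥ z))‖ ^ 2) (fun _ => by positivity)
      (hin (X a) (hX.1 a))
    simpa only [rankOnePart, matChar_rankOneMat] using h2
  have hcol : ∀ b, (8 : ℝ) * ∑ T ∈ S, ‖∑ a, rankOnePart X Y ψ S T a b‖ ^ 2 ≤
      Fintype.card (Matrix κ ι F) * ∑ a, ∑ c, ‖matFourier ψ S (rankOneMat X Y (a, b, c))‖ ^ 2 := by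
    intro b
    have h1 := sum_norm_sq_matChar hψ (β := fun ac : A × Fˣ => rankOneMat X Y (ac.1, b, ac.2))
      (fun ac ac' h => by
        have := rankOneMat_injective hX hY h
        simp only [Prod.mk.injEq, true_and] at this
        exact Prod.ext this.1 this.2)
      (fun ac => matFourier ψ S (rankOneMat X Y (ac.1, b, ac.2)))
    simp only [Fintype.sum_prod_type] at h1
    rw [← h1]
    have h2 := sum_comp_le_of_fiber_le S (fun T => Matrix.vecMul (Y b) T)
      (fun z => ‖∑ a, ∑ c : Fˣ, matFourier ψ S (rankOneMat X Y (a, b, c)) *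
        (starRingEnd ℂ) (ψ ((c : F) * (z ⬝ᵥ X a)))‖ ^ 2) (fun _ => by positivity)
      (hout (Y b) (hY.1 b))
    simpa only [rankOnePart, matChar_rankOneMat'] using h2
  have hW : rankOneMass X Y ψ S =
      ∑ a, ∑ b, ∑ c, ‖matFourier ψ S (rankOneMat X Y (a, b, c))‖ ^ 2 := by
    simp only [rankOneMass, Fintype.sum_prod_type]
  have hrow' := sum_le_sum (s := univ) fun a (_ : a ∈ univ) => hrow a
  have hcol' := sum_le_sum (s := univ) fun b (_ : b ∈ univ) => hcol b
  rw [← mul_sum, ← mul_sum, ← hW] at hrow'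
  rw [← mul_sum, ← mul_sum, sum_comm (s := (univ : Finset B)) (t := (univ : Finset A)),
    ← hW] at hcol'
  rw [sum_comm] at hrow' hcol'
  have hgen := norm_generic_part_le hX hY ψ S hR h
  rw [← generic_part_eq] at hgen
  set G := ∑ T ∈ S, ∑ a, ∑ b, ∑ a', ∑ b',
      (if a ≠ a' ∧ b ≠ b' then rankOnePart X Y ψ S T a b *
        (starRingEnd ℂ) (rankOnePart X Y ψ S T a' b') else 0) with hG
  have hid := sum_congr (rfl : S = S) fun T _ => norm_sq_sum_sum_eq (rankOnePart X Y ψ S T)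
  simp only [sum_add_distrib] at hid
  rw [← hG] at hid
  have hre := congrArg Complex.re hid
  simp only [Complex.add_re, ← Complex.ofReal_sum, Complex.ofReal_re] at hre
  have h3 : G.re ≤ rankOneMass X Y ψ S * R := (Complex.re_le_norm G).trans hgen
  have h4 : 0 ≤ ∑ T ∈ S, ∑ a, ∑ b, ‖rankOnePart X Y ψ S T a b‖ ^ 2 :=
    sum_nonneg fun _ _ => sum_nonneg fun _ _ => sum_nonneg fun _ _ => by positivity
  linarith

/-- A sparse set of matrices which is rich in rank-one moves in every column direction has
large density on the set of matrices taking a prescribed value at some nonzero vector. -/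
theorem exists_heavy_mulVec {F : Type} [Field F] [Fintype F] [DecidableEq F]
    {κ ι : Type} [Fintype κ] [Fintype ι] [DecidableEq κ] [DecidableEq ι]
    {S : Finset (Matrix κ ι F)} (hS : S.Nonempty)
    (hsmall : #S * Fintype.card F ^ 20 ≤ Fintype.card (Matrix κ ι F))
    (hmove : ∀ T ∈ S, ∀ w : κ → F, Fintype.card F ^ Fintype.card ι ≤
      Fintype.card F * #{a : ι → F | T + Matrix.vecMulVec w a ∈ S}) :
    ∃ x : ι → F, x ≠ 0 ∧ ∃ z : κ → F,
      #{T : Matrix κ ι F | T.mulVec x = z} < 8 * #{T ∈ S | T.mulVec x = z} := by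
  by_contra! hcon
  obtain ⟨A, _, X, hX⟩ := exists_lineReps F ι
  obtain ⟨B, _, Y, hY⟩ := exists_lineReps F κ
  classical
  obtain ⟨ψ, hψ⟩ := (AddChar.exists_apply_ne_zero (a := (1 : F))).2 one_ne_zero
  have hψ : ψ.IsPrimitive := .of_ne_one fun h => hψ (by simp [h])
  have hq2 : 2 ≤ Fintype.card F := Fintype.one_lt_card
  have hsplit := mass_split hψ hX hY S
  have hmoves := moves_le hψ hX hY S
  have hR0 := highRankMass_nonneg ψ S
  have hW0 : 0 ≤ rankOneMass X Y ψ S := sum_nonneg fun _ _ => by positivity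
  have hE : #S * (Fintype.card F ^ Fintype.card κ * Fintype.card F ^ Fintype.card ι) ≤
      Fintype.card F * rankOneMoves S := by
    have h1 : ∀ w : κ → F, #S * Fintype.card F ^ Fintype.card ι ≤
        Fintype.card F * ∑ a : ι → F, #{T ∈ S | T + Matrix.vecMulVec w a ∈ S} := by
      intro w
      simp only [card_filter]
      rw [sum_comm, mul_sum, ← smul_eq_mul, ← sum_const]
      refine sum_le_sum fun T hT => ?_
      rw [← card_filter]
      exact hmove T hT w
    calc _ = ∑ w : κ → F, #S * Fintype.card F ^ Fintype.card ι := by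
          rw [sum_const, card_univ, Fintype.card_fun, smul_eq_mul]; ring
      _ ≤ _ := sum_le_sum fun w _ => h1 w
      _ = _ := by rw [rankOneMoves, mul_sum]
  set N : ℝ := (Fintype.card (Matrix κ ι F) : ℝ) with hN
  set q : ℝ := (Fintype.card F : ℝ) with hq
  set σ : ℝ := (#S : ℝ) with hσ
  set W := rankOneMass X Y ψ S with hW
  set Q := highRankMass ψ S with hQ
  have hq2' : (2 : ℝ) ≤ q := by rw [hq]; exact_mod_cast hq2
  have hσ1 : 1 ≤ σ := by rw [hσ]; exact_mod_cast hS.card_pos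
  have hsmall' : σ * q ^ 20 ≤ N := by rw [hσ, hq, hN]; exact_mod_cast hsmall
  have hE' : σ * (q ^ Fintype.card κ * q ^ Fintype.card ι) ≤ q * rankOneMoves S := by
    rw [hσ, hq]; exact_mod_cast hE
  have hN0 : 0 < N := by rw [hN]; exact_mod_cast Fintype.card_pos
  have hpos : 0 < q ^ Fintype.card κ * q ^ Fintype.card ι := by positivity
  have hmass : N * σ * q ≤ σ ^ 2 * q ^ 2 + W * q + Q := by
    refine le_of_mul_le_mul_left ?_ hpos
    refine le_trans ?_ hmoves
    calc _ = N * q * (σ * (q ^ Fintype.card κ * q ^ Fintype.card ι)) := by ring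
      _ ≤ N * q * (q * rankOneMoves S) := mul_le_mul_of_nonneg_left hE' (by positivity)
      _ = _ := by ring
  have hQle : Q ≤ q * σ ^ 2 := by
    rw [hsplit] at hmass
    have h1 : Q * (q - 1) ≤ (q * σ ^ 2) * (q - 1) := by linarith
    exact le_of_mul_le_mul_right h1 (by linarith)
  have hWge : N * σ - (q + 1) * σ ^ 2 ≤ W := by rw [hsplit]; linarith
  have hR : q ^ 4 * Q ≤ (q ^ 3 * σ) ^ 2 := by
    calc q ^ 4 * Q ≤ q ^ 4 * (q * σ ^ 2) := by gcongr
      _ ≤ q * (q ^ 4 * (q * σ ^ 2)) := le_mul_of_one_le_left (by positivity) (by linarith)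
      _ = _ := by ring
  have hin : ∀ x : ι → F, x ≠ 0 → ∀ z : κ → F,
      (8 : ℝ) * #{T ∈ S | T.mulVec x = z} ≤ #{T : Matrix κ ι F | T.mulVec x = z} :=
    fun x hx z => by exact_mod_cast hcon x hx z
  have hqσ : 8 * q * σ ≤ N := by
    have : 8 * q ≤ q ^ 20 := by
      have h3 : (2 : ℝ) ^ 3 ≤ q ^ 3 := by gcongr
      have h4 : (1 : ℝ) ≤ q ^ 16 := one_le_pow₀ (by linarith)
      calc 8 * q ≤ q ^ 3 * q := by nlinarith
        _ ≤ q ^ 3 * q * q ^ 16 := le_mul_of_one_le_right (by positivity) h4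
        _ = _ := by ring
    nlinarith
  have hout : ∀ y : κ → F, y ≠ 0 → ∀ z : ι → F,
      (8 : ℝ) * #{T ∈ S | Matrix.vecMul y T = z} ≤
        #{T : Matrix κ ι F | Matrix.vecMul y T = z} := by
    intro y hy z
    have h1 : (#{T ∈ S | Matrix.vecMul y T = z} : ℝ) * q ^ Fintype.card ι ≤ q * σ := by
      rw [hq, hσ]; exact_mod_cast card_vecMul_le hmove hy z
    have h2 : (#{T : Matrix κ ι F | Matrix.vecMul y T = z} : ℝ) * q ^ Fintype.card ι = N := by
      rw [hq, hN]; exact_mod_cast card_vecMul_eq hy z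
    have hp : 0 < q ^ Fintype.card ι := by positivity
    refine le_of_mul_le_mul_right ?_ hp
    rw [h2]
    linarith
  have hub := sum_norm_sq_rankOnePart_le hψ hX hY S (R := q ^ 3 * σ) (by positivity) hR hin hout
  have hCS : W ^ 2 ≤ σ * ∑ T ∈ S, ‖∑ a, ∑ b, rankOnePart X Y ψ S T a b‖ ^ 2 := by
    have h1 : W ≤ ∑ T ∈ S, ‖∑ a, ∑ b, rankOnePart X Y ψ S T a b‖ := by
      refine le_trans ?_ (norm_sum_le _ _)
      rw [sum_sum_rankOnePart, Complex.norm_real]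
      exact le_abs_self _
    calc W ^ 2 ≤ (∑ T ∈ S, ‖∑ a, ∑ b, rankOnePart X Y ψ S T a b‖) ^ 2 := by gcongr
      _ ≤ _ := sq_sum_le_card_mul_sum_sq
  have h20 : 1000 * q ^ 3 * σ ≤ N := by
    have : 1000 * q ^ 3 ≤ q ^ 20 := by
      have h3 : (2 : ℝ) ^ 10 ≤ q ^ 10 := by gcongr
      have h4 : (1 : ℝ) ≤ q ^ 7 := one_le_pow₀ (by linarith)
      calc 1000 * q ^ 3 ≤ q ^ 10 * q ^ 3 := by
            refine mul_le_mul_of_nonneg_right (le_trans (by norm_num) h3) (by positivity)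
        _ ≤ q ^ 10 * q ^ 3 * q ^ 7 := le_mul_of_one_le_right (by positivity) h4
        _ = _ := by ring
    nlinarith
  have hq3 : q + 1 ≤ q ^ 3 := by nlinarith
  have hWpos : 0 < W := by
    refine lt_of_lt_of_le ?_ hWge
    nlinarith
  have hfin : W ≤ σ * (N / 4 + q ^ 3 * σ) := by
    refine le_of_mul_le_mul_right ?_ hWpos
    calc W * W = W ^ 2 := by ring
      _ ≤ _ := hCS
      _ ≤ σ * (N * W / 4 + W * (q ^ 3 * σ)) := mul_le_mul_of_nonneg_left hub (by positivity)
      _ = _ := by ring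
  have : N - (q + 1) * σ ≤ N / 4 + q ^ 3 * σ := by
    refine le_of_mul_le_mul_left (a := σ) ?_ (by linarith)
    linarith
  nlinarith

end HeavyZoomMain

section PolynomialMethod

variable {F : Type} [Field F] [Fintype F] [DecidableEq F]

/-- A nonzero polynomial of degree less than `#S` is nonzero on at least a `1 / #S` fraction of
the grid with side `S`. -/
lemma card_pow_le_mul_card_eval_ne_zero {m : ℕ} {Q : MvPolynomial (Fin m) F} (hQ : Q ≠ 0)
    {S : Finset F} (hS : Q.totalDegree < #S) :
    #S ^ m ≤ #S * #{x ∈ Fintype.piFinset fun _ : Fin m => S | MvPolynomial.eval x Q ≠ 0} := by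
  have h1 := MvPolynomial.schwartz_zippel_totalDegree hQ S
  have hS0 : (0 : ℚ≥0) < #S := by exact_mod_cast (Nat.zero_le _).trans_lt hS
  rw [div_le_div_iff₀ (by positivity) hS0] at h1
  have h2 : #{x ∈ Fintype.piFinset fun _ : Fin m => S | MvPolynomial.eval x Q = 0} * #S ≤
    Q.totalDegree * #S ^ m := by exact_mod_cast h1
  have h3 := card_filter_add_card_filter_not (s := Fintype.piFinset fun _ : Fin m => S)
    (fun x => MvPolynomial.eval x Q = 0)
  rw [Fintype.card_piFinset_const] at h3
  have h4 : (Q.totalDegree + 1) * #S ^ m ≤ #S * #S ^ m := Nat.mul_le_mul_right _ hS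
  simp only [ne_eq]
  nlinarith

lemma exists_sum_pow_eq (g : F → F) :
    ∃ c : ℕ → F, ∀ z, g z = ∑ i ∈ range (Fintype.card F), c i * z ^ i := by
  set Q := Lagrange.interpolate univ id g with hQ
  have hdeg : Q.degree < (Fintype.card F : ℕ) :=
    Lagrange.degree_interpolate_lt (s := univ) (v := id) g Function.injective_id.injOn
  refine ⟨Q.coeff, fun z => ?_⟩
  have h := Lagrange.eval_interpolate_at_node (v := id) g
    Function.injective_id.injOn (mem_univ z)
  rw [← hQ, id] at h
  rw [← h]
  refine Polynomial.eval_eq_sum_range' ?_ z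
  by_cases h0 : Q = 0
  · rw [h0, Polynomial.natDegree_zero]; exact Fintype.card_pos
  · exact (Polynomial.natDegree_lt_iff_degree_lt h0).2 hdeg

/-- Rank-one change of an affine map in direction `w`. -/
def affMove {n ℓ : ℕ} (T : Aff F n ℓ) (w : Fin n → F) (a : Fin (ℓ + 1) → F) : Aff F n ℓ :=
  (T.1 + Matrix.vecMulVec w (Fin.tail a), T.2 + a 0 • w)

lemma affApp_affMove {n ℓ : ℕ} (T : Aff F n ℓ) (w : Fin n → F) (a : Fin (ℓ + 1) → F)
    (p : Fin ℓ → F) :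
    affApp (affMove T w a) p = affApp T p + (a 0 + Fin.tail a ⬝ᵥ p) • w := by
  simp only [affApp, affMove, Matrix.add_mulVec, Matrix.vecMulVec_mulVec, op_smul_eq_smul,
    add_smul]
  abel

/-- The matrix of an affine map with the translation as an additional column. -/
def augMat {n ℓ : ℕ} (T : Aff F n ℓ) : Matrix (Fin n) (Fin (ℓ + 1)) F :=
  Matrix.of fun k => Fin.cons (T.2 k) (T.1 k)

lemma augMat_bijective {n ℓ : ℕ} : Function.Bijective (augMat (F := F) (n := n) (ℓ := ℓ)) := by
  refine Function.bijective_iff_has_inverse.2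
    ⟨fun A => (Matrix.of fun k i => A k (Fin.succ i), fun k => A k 0), fun T => ?_, fun A => ?_⟩
  · ext <;> simp [augMat]
  · ext k i
    refine Fin.cases ?_ (fun j => ?_) i <;> simp [augMat]

lemma augMat_affMove {n ℓ : ℕ} (T : Aff F n ℓ) (w : Fin n → F) (a : Fin (ℓ + 1) → F) :
    augMat (affMove T w a) = augMat T + Matrix.vecMulVec w a := by
  ext k i
  refine Fin.cases ?_ (fun j => ?_) i <;>
  simp [augMat, affMove, Matrix.vecMulVec_apply, Fin.tail, mul_comm]

lemma augMat_mulVec {n ℓ : ℕ} (T : Aff F n ℓ) (x : Fin (ℓ + 1) → F) :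
    (augMat T).mulVec x = T.1.mulVec (Fin.tail x) + x 0 • T.2 := by
  ext k
  simp [augMat, Matrix.mulVec, dotProduct, Fin.sum_univ_succ, Fin.tail]
  ring

/-- Restricting to random rank-one changes in a fixed direction keeps a nonzero test value
nonzero with probability at least `1 / |F|`. -/
lemma card_pow_le_card_affMove {n ℓ : ℕ} (f : (Fin n → F) → F) (T : Aff F n ℓ)
    (h : (Fin ℓ → F) → F) (hT : ip (fun x => f (affApp T x)) h ≠ 0) (w : Fin n → F) :
    Fintype.card F ^ (ℓ + 1) ≤ Fintype.card F *
      #{a : Fin (ℓ + 1) → F | ip (fun x => f (affApp (affMove T w a) x)) h ≠ 0} := by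
  choose c hc using fun p : Fin ℓ → F => exists_sum_pow_eq fun z => f (affApp T p + z • w)
  let L : (Fin ℓ → F) → MvPolynomial (Fin (ℓ + 1)) F := fun p =>
    MvPolynomial.X 0 + ∑ i, MvPolynomial.C (p i) * MvPolynomial.X (Fin.succ i)
  have hL : ∀ p, (L p).totalDegree ≤ 1 := fun p => by
    refine (MvPolynomial.totalDegree_add _ _).trans (max_le (MvPolynomial.totalDegree_X _).le ?_)
    refine MvPolynomial.totalDegree_finsetSum_le fun i _ => ?_
    refine (MvPolynomial.totalDegree_mul _ _).trans ?_
    rw [MvPolynomial.totalDegree_C, MvPolynomial.totalDegree_X]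
  let Q : MvPolynomial (Fin (ℓ + 1)) F :=
    ∑ p, ∑ i ∈ range (Fintype.card F), MvPolynomial.C (c p i * h p) * L p ^ i
  have heval : ∀ a, MvPolynomial.eval a Q = ip (fun x => f (affApp (affMove T w a) x)) h := by
    intro a
    simp only [Q, ip, map_sum]
    refine sum_congr rfl fun p _ => ?_
    rw [affApp_affMove, hc, sum_mul]
    refine sum_congr rfl fun i _ => ?_
    have : MvPolynomial.eval a (L p) = a 0 + Fin.tail a ⬝ᵥ p := by
      simp [L, dotProduct, Fin.tail, mul_comm]
    rw [map_mul, map_pow, MvPolynomial.eval_C, this]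
    ring
  have hQ0 : Q ≠ 0 := by
    intro h0
    have h1 := heval 0
    rw [h0, map_zero] at h1
    apply hT
    rw [h1]
    have : affMove T w 0 = T := by
      ext <;> simp [affMove, Fin.tail, Matrix.vecMulVec_apply]
    rw [this]
  have hdeg : Q.totalDegree < #(univ : Finset F) := by
    rw [card_univ, ← Nat.le_sub_one_iff_lt Fintype.card_pos]
    refine MvPolynomial.totalDegree_finsetSum_le fun p _ =>
      MvPolynomial.totalDegree_finsetSum_le fun i hi => ?_
    refine (MvPolynomial.totalDegree_mul _ _).trans ?_
    rw [MvPolynomial.totalDegree_C, zero_add]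
    refine (MvPolynomial.totalDegree_pow _ _).trans ?_
    have := mem_range.1 hi
    calc i * (L p).totalDegree ≤ i * 1 := Nat.mul_le_mul_left _ (hL p)
      _ ≤ _ := by omega
  have := card_pow_le_mul_card_eval_ne_zero hQ0 hdeg
  simp only [heval, Fintype.piFinset_univ] at this
  exact this

/-- Coordinatewise affine substitution on the coordinates in `J`. The first half of `z` holds
the scaling factors and the second half the shifts. -/
def blockSubst {ℓ : ℕ} (J : Finset (Fin ℓ)) (z : Fin (ℓ + ℓ) → F) (p : Fin ℓ → F) : Fin ℓ → F :=
  fun i => if i ∈ J then z (Fin.castAdd ℓ i) * p i + z (Fin.natAdd ℓ i) else p i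

/-- A test function whose correlations with substituted copies of itself are spread out. -/
def SpreadOn {ℓ : ℕ} (J : Finset (Fin ℓ)) (h : (Fin ℓ → F) → F) : Prop :=
  ∀ g : (Fin ℓ → F) → F, (∃ z, ip g (fun p => h (blockSubst J z p)) ≠ 0) →
    #(Fintype.piFinset fun _ : Fin (ℓ + ℓ) => (univ.erase 0 : Finset F)) ≤ Fintype.card F *
      #{z ∈ Fintype.piFinset fun _ : Fin (ℓ + ℓ) => (univ.erase 0 : Finset F) |
        ip g (fun p => h (blockSubst J z p)) ≠ 0}

lemma spreadOn_empty {ℓ : ℕ} (h : (Fin ℓ → F) → F) : SpreadOn ∅ h := by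
  rintro g ⟨z, hz⟩
  have e : ∀ (z : Fin (ℓ + ℓ) → F) p, blockSubst ∅ z p = p := fun z p => by
    funext i
    simp [blockSubst]
  have h1 : ∀ z' : Fin (ℓ + ℓ) → F, ip g (fun p => h (blockSubst ∅ z' p)) ≠ 0 := fun z' => by
    simpa only [e] using hz
  rw [filter_true_of_mem fun z' _ => h1 z']
  exact Nat.le_mul_of_pos_left _ Fintype.card_pos

lemma totalDegree_aeval_le {σ τ : Type*} (P : MvPolynomial σ F) (L : σ → MvPolynomial τ F)
    (hL : ∀ i, (L i).totalDegree ≤ 1) : (MvPolynomial.aeval L P).totalDegree ≤ P.totalDegree := by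
  rw [MvPolynomial.aeval_def, MvPolynomial.eval₂_eq]
  refine MvPolynomial.totalDegree_finsetSum_le fun d hd => ?_
  refine (MvPolynomial.totalDegree_mul _ _).trans ?_
  rw [MvPolynomial.algebraMap_eq, MvPolynomial.totalDegree_C, zero_add]
  refine (MvPolynomial.totalDegree_finsetProd _ _).trans ?_
  refine le_trans (sum_le_sum fun i _ => ?_) (MvPolynomial.le_totalDegree hd)
  refine (MvPolynomial.totalDegree_pow _ _).trans ?_
  exact (Nat.mul_le_mul_left _ (hL i)).trans (mul_one _).le

/-- If `h` is a low-degree polynomial in the coordinates from `J` times a function of the other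
coordinates, then its substituted copies are spread out. -/
lemma spreadOn_of_factor {ℓ m : ℕ} {P : MvPolynomial (Fin m) F}
    (hP : P.totalDegree + 1 < Fintype.card F) (u : Fin m → Fin ℓ) {J : Finset (Fin ℓ)}
    (hu : ∀ l, u l ∈ J) {h ρ : (Fin ℓ → F) → F}
    (hh : ∀ z p, h (blockSubst J z p) =
      MvPolynomial.eval (fun l => blockSubst J z p (u l)) P * ρ p) : SpreadOn J h := by
  rintro g ⟨z₀, hz₀⟩
  let Q : MvPolynomial (Fin (ℓ + ℓ)) F := ∑ p : Fin ℓ → F, MvPolynomial.C (g p * ρ p) *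
    MvPolynomial.aeval (fun l => MvPolynomial.C (p (u l)) * MvPolynomial.X (Fin.castAdd ℓ (u l)) +
      MvPolynomial.X (Fin.natAdd ℓ (u l))) P
  have heval : ∀ z, MvPolynomial.eval z Q = ip g (fun p => h (blockSubst J z p)) := by
    intro z
    simp only [Q, ip, map_sum]
    refine sum_congr rfl fun p _ => ?_
    rw [hh, map_mul, MvPolynomial.eval_C, ← MvPolynomial.coe_aeval_eq_eval, RingHom.coe_coe,
      ← AlgHom.comp_apply, MvPolynomial.comp_aeval]
    have : (fun l => MvPolynomial.aeval z (MvPolynomial.C (p (u l)) *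
        MvPolynomial.X (Fin.castAdd ℓ (u l)) + MvPolynomial.X (Fin.natAdd ℓ (u l)))) =
        fun l => blockSubst J z p (u l) := by
      funext l
      simp [blockSubst, hu l, mul_comm]
    rw [this]
    rw [MvPolynomial.aeval_eq_eval]
    ring
  have hQ0 : Q ≠ 0 := fun h0 => hz₀ (by rw [← heval, h0, map_zero])
  have hcard : #(univ.erase (0 : F)) = Fintype.card F - 1 := by
    rw [card_erase_of_mem (mem_univ _), card_univ]
  have hdeg : Q.totalDegree < #(univ.erase (0 : F)) := by
    rw [hcard]
    refine lt_of_le_of_lt ?_ (Nat.lt_sub_of_add_lt hP)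
    refine MvPolynomial.totalDegree_finsetSum_le fun p _ => ?_
    refine (MvPolynomial.totalDegree_mul _ _).trans ?_
    rw [MvPolynomial.totalDegree_C, zero_add]
    refine totalDegree_aeval_le P _ fun l => ?_
    refine (MvPolynomial.totalDegree_add _ _).trans (max_le ?_ (MvPolynomial.totalDegree_X _).le)
    refine (MvPolynomial.totalDegree_mul _ _).trans ?_
    rw [MvPolynomial.totalDegree_C, MvPolynomial.totalDegree_X]
  have := card_pow_le_mul_card_eval_ne_zero hQ0 hdeg
  simp only [heval] at this
  rw [Fintype.card_piFinset_const]
  refine this.trans (Nat.mul_le_mul_right _ ?_)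
  rw [hcard]
  exact Nat.sub_le _ _

lemma totalDegree_of_Pdef {p q : ℕ} (hp : p.Prime) (hpq : p ≤ q) {P : MvPolynomial (Fin p) F}
    (hP : Pdef p q hp.pos P) : P.totalDegree + 1 < q := by
  have hp2 := hp.two_le
  by_cases h0 : P = 0
  · rw [h0, MvPolynomial.totalDegree_zero]; omega
  have h1 := congrArg MvPolynomial.totalDegree hP
  have hX : (∏ i : Fin (p - 1), (MvPolynomial.X (Fin.castLE (Nat.sub_le p 1) i) :
      MvPolynomial (Fin p) F)) =
      MvPolynomial.monomial (∑ i : Fin (p - 1), Finsupp.single (Fin.castLE (Nat.sub_le p 1) i) 1)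
        1 := by
    rw [MvPolynomial.monomial_sum_one]
    rfl
  have hne : (∏ i : Fin (p - 1), (MvPolynomial.X (Fin.castLE (Nat.sub_le p 1) i) :
      MvPolynomial (Fin p) F)) ≠ 0 := prod_ne_zero_iff.2 fun i _ => MvPolynomial.X_ne_zero _
  have hXdeg : (∏ i : Fin (p - 1), (MvPolynomial.X (Fin.castLE (Nat.sub_le p 1) i) :
      MvPolynomial (Fin p) F)).totalDegree = p - 1 := by
    rw [hX, MvPolynomial.totalDegree_monomial _ one_ne_zero]
    simp only [Finsupp.sum_fintype, implies_true]
    simp [Finsupp.finsetSum_apply, sum_comm (s := univ) (t := univ)]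
  rw [MvPolynomial.totalDegree_mul_of_isDomain hne h0, hXdeg] at h1
  have h2 : P.totalDegree + (p - 1) ≤ q - 1 := by
    rw [add_comm, h1]
    refine MvPolynomial.totalDegree_finsetSum_le fun I _ => ?_
    refine (MvPolynomial.totalDegree_mul _ _).trans ?_
    rw [MvPolynomial.totalDegree_C, zero_add]
    refine (MvPolynomial.totalDegree_pow _ _).trans ?_
    refine (Nat.mul_le_mul_left _ ?_).trans (mul_one _).le
    refine (MvPolynomial.totalDegree_add _ _).trans (max_le ?_ (MvPolynomial.totalDegree_X _).le)
    exact MvPolynomial.totalDegree_finsetSum_le fun i _ => (MvPolynomial.totalDegree_X _).le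
  omega

end PolynomialMethod

section HeavyPoint

variable {F : Type} [Field F] [Fintype F] [DecidableEq F] {n ℓ : ℕ}

open Classical in
/-- The affine maps along which `f` correlates with one of the test functions in `𝓗`. -/
def rejSet (𝓗 : Set ((Fin ℓ → F) → F)) (f : (Fin n → F) → F) : Finset (Aff F n ℓ) :=
  {T | ∃ h ∈ 𝓗, ip (fun p => f (affApp T p)) h ≠ 0}

lemma mem_rejSet {𝓗 : Set ((Fin ℓ → F) → F)} {f : (Fin n → F) → F} {T : Aff F n ℓ} :
    T ∈ rejSet 𝓗 f ↔ ∃ h ∈ 𝓗, ip (fun p => f (affApp T p)) h ≠ 0 := by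
  simp [rejSet]

lemma notMem_rejSet {𝓗 : Set ((Fin ℓ → F) → F)} {f : (Fin n → F) → F} {T : Aff F n ℓ} :
    T ∉ rejSet 𝓗 f ↔ ∀ h ∈ 𝓗, ip (fun p => f (affApp T p)) h = 0 := by
  simp [rejSet]

lemma sum_smul_line (g : (Fin n → F) → F) (y w : Fin n → F) (c : F) :
    ∑ z : F, g (y + (z * c) • w) = if c = 0 then 0 else ∑ z : F, g (y + z • w) := by
  split_ifs with hc
  · simp [hc]
  · exact Fintype.sum_equiv (Equiv.mulRight₀ c hc) _ _ fun z => by simp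

lemma exists_pair_move (f : (Fin n → F) → F) (T : Aff F n ℓ) (h : (Fin ℓ → F) → F)
    (hT : ip (fun p => f (affApp T p)) h ≠ 0) (k : Fin ℓ) (w w' : Fin n → F) :
    ∃ l m v : F, (l ≠ 0 ∨ m ≠ 0) ∧
      ip (fun p => f (affApp T p + (l * p k) • w + (m * (p k - v)) • w')) h ≠ 0 := by
  by_contra! hcon
  apply hT
  set c := ip (fun p => f (affApp T p)) h with hc
  let G : (Fin ℓ → F) → F := fun p => ∑ l : F, ∑ m : F, f (affApp T p + l • w + m • w')
  have key : ∀ v : F, c = ∑ p, (if p k = 0 ∨ p k = v then 0 else G p * h p) := by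
    intro v
    have h1 : ∑ l : F, ∑ m : F,
        ip (fun p => f (affApp T p + (l * p k) • w + (m * (p k - v)) • w')) h = c := by
      rw [sum_eq_single 0, sum_eq_single 0]
      · simp [hc]
      · intro m _ hm
        exact hcon 0 m v (Or.inr hm)
      · simp
      · intro l _ hl
        exact sum_eq_zero fun m _ => hcon l m v (Or.inl hl)
      · simp
    rw [← h1]
    simp only [ip]
    rw [sum_congr rfl fun l _ => sum_comm, sum_comm]
    refine sum_congr rfl fun p _ => ?_
    simp only [← sum_mul]
    simp only [sum_smul_line f _ w' (p k - v)]
    by_cases hv : p k = v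
    · simp [hv]
    · simp only [if_neg (sub_ne_zero.2 hv)]
      by_cases h0 : p k = 0
      · simp [h0]
      · rw [if_neg (by tauto)]
        congr 1
        have := sum_smul_line (fun y => ∑ m : F, f (y + m • w')) (affApp T p) w (p k)
        rwa [if_neg h0] at this
  have hv0 : ∀ v : F, v ≠ 0 → ∑ p : Fin ℓ → F, (if p k = v then G p * h p else 0) = 0 := by
    intro v hv
    have h2 : ∑ p : Fin ℓ → F, (if p k = 0 ∨ p k = 0 then 0 else G p * h p) =
        ∑ p : Fin ℓ → F, (if p k = 0 ∨ p k = v then 0 else G p * h p) +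
        ∑ p : Fin ℓ → F, (if p k = v then G p * h p else 0) := by
      rw [← sum_add_distrib]
      refine sum_congr rfl fun p _ => ?_
      by_cases h0 : p k = 0
      · simp [h0, hv.symm]
      · by_cases h3 : p k = v <;> simp [h0, h3, hv]
    rw [← key, ← key] at h2
    exact left_eq_add.1 h2
  rw [key 0]
  have h3 : ∀ p : Fin ℓ → F, (if p k = 0 ∨ p k = 0 then 0 else G p * h p) =
      ∑ v ∈ univ.erase (0 : F), (if p k = v then G p * h p else 0) := by
    intro p
    rw [sum_ite_eq]
    by_cases h0 : p k = 0 <;> simp [h0]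
  rw [sum_congr rfl fun p _ => h3 p, sum_comm]
  exact sum_eq_zero fun v hv => hv0 v (ne_of_mem_erase hv)

/-- The move of `T` in directions `w`, `w'` by affine functions of the `k`-th coordinate. -/
def pairMove (k : Fin ℓ) (l m v : F) (T : Aff F n ℓ) (w w' : Fin n → F) : Aff F n ℓ :=
  (T.1 + Matrix.vecMulVec (l • w + m • w') (Pi.single k 1), T.2 - (m * v) • w')

lemma affApp_pairMove (k : Fin ℓ) (l m v : F) (T : Aff F n ℓ) (w w' : Fin n → F)
    (p : Fin ℓ → F) : affApp (pairMove k l m v T w w') p =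
      affApp T p + (l * p k) • w + (m * (p k - v)) • w' := by
  simp only [affApp, pairMove, Matrix.add_mulVec, Matrix.vecMulVec_mulVec, op_smul_eq_smul,
    single_dotProduct, one_mul]
  module

lemma card_direction_zoom_le (𝓗 : Set ((Fin ℓ → F) → F)) (f : (Fin n → F) → F)
    {y : Fin ℓ → F} (hy : y ≠ 0) (z : Fin n → F) :
    #{T ∈ rejSet 𝓗 f | T.1.mulVec y = z} * Fintype.card F ^ n ≤
      Fintype.card F ^ 3 * #(rejSet 𝓗 f) := by
  obtain ⟨k, hk⟩ := Function.ne_iff.1 hy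
  set S := rejSet 𝓗 f with hS
  set q := Fintype.card F
  have hq : 0 < q := Fintype.card_pos
  set Z := {T ∈ S | T.1.mulVec y = z} with hZ
  let D := Z ×ˢ (univ : Finset ((Fin n → F) × (Fin n → F)))
  let K : F × F × F → Finset (Aff F n ℓ × ((Fin n → F) × (Fin n → F))) := fun u =>
    {d ∈ D | (u.1 ≠ 0 ∨ u.2.1 ≠ 0) ∧ pairMove k u.1 u.2.1 u.2.2 d.1 d.2.1 d.2.2 ∈ S}
  have hcover : D ⊆ univ.biUnion K := by
    rintro ⟨T, w, w'⟩ hd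
    have hTS : T ∈ S := (mem_filter.1 (mem_product.1 hd).1).1
    obtain ⟨h, hh, hne⟩ := mem_rejSet.1 hTS
    obtain ⟨l, m, v, hlm, hmv⟩ := exists_pair_move f T h hne k w w'
    refine mem_biUnion.2 ⟨(l, m, v), mem_univ _, mem_filter.2 ⟨hd, hlm, ?_⟩⟩
    refine mem_rejSet.2 ⟨h, hh, ?_⟩
    simpa only [affApp_pairMove] using hmv
  have hK : ∀ u, #(K u) ≤ #S * q ^ n := by
    rintro ⟨l, m, v⟩
    have hcard : #(S ×ˢ (univ : Finset (Fin n → F))) = #S * q ^ n := by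
      rw [card_product, card_univ, Fintype.card_fun, Fintype.card_fin]
    rw [← hcard]
    have hback : ∀ (d d' : Aff F n ℓ × ((Fin n → F) × (Fin n → F))), d ∈ K (l, m, v) →
        d' ∈ K (l, m, v) → pairMove k l m v d.1 d.2.1 d.2.2 =
          pairMove k l m v d'.1 d'.2.1 d'.2.2 →
        l • d.2.1 + m • d.2.2 = l • d'.2.1 + m • d'.2.2 := by
      rintro ⟨T, w, w'⟩ ⟨T', u, u'⟩ hd hd' he
      have e1 : T.1.mulVec y = z := (mem_filter.1 (mem_product.1 (mem_filter.1 hd).1).1).2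
      have e2 : T'.1.mulVec y = z := (mem_filter.1 (mem_product.1 (mem_filter.1 hd').1).1).2
      have e3 := congrArg (fun A : Aff F n ℓ => A.1.mulVec y) he
      simp only [pairMove, Matrix.add_mulVec, Matrix.vecMulVec_mulVec, op_smul_eq_smul,
        single_dotProduct, one_mul, e1, e2] at e3
      exact smul_right_injective _ hk (add_left_cancel e3)
    by_cases hl : l = 0
    · by_cases hm : m = 0
      · have : K (l, m, v) = ∅ := filter_false_of_mem fun d _ => by simp [hl, hm]
        rw [this]; simp
      · refine card_le_card_of_injOn (fun d => (pairMove k l m v d.1 d.2.1 d.2.2, d.2.1))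
          (fun d hd => ?_) ?_
        · simp only [coe_product, Set.mem_prod, mem_coe, mem_univ, and_true]
          exact (mem_filter.1 hd).2.2
        · rintro ⟨T, w, w'⟩ hd ⟨T', u, u'⟩ hd' he
          obtain ⟨he1, he2⟩ := Prod.ext_iff.1 he
          have h1 := hback _ _ hd hd' he1
          dsimp only at he1 he2 h1
          subst he2
          have h2 : w' = u' := smul_right_injective _ hm (add_left_cancel h1)
          subst h2
          simp only [pairMove, Prod.mk.injEq, add_left_inj, sub_left_inj] at he1
          simp [Prod.ext_iff, he1]
    · refine card_le_card_of_injOn (fun d => (pairMove k l m v d.1 d.2.1 d.2.2, d.2.2))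
          (fun d hd => ?_) ?_
      · simp only [coe_product, Set.mem_prod, mem_coe, mem_univ, and_true]
        exact (mem_filter.1 hd).2.2
      · rintro ⟨T, w, w'⟩ hd ⟨T', u, u'⟩ hd' he
        obtain ⟨he1, he2⟩ := Prod.ext_iff.1 he
        have h1 := hback _ _ hd hd' he1
        dsimp only at he1 he2 h1
        subst he2
        have h2 : w = u := smul_right_injective _ hl (add_right_cancel h1)
        subst h2
        simp only [pairMove, Prod.mk.injEq, add_left_inj, sub_left_inj] at he1
        simp [Prod.ext_iff, he1]
  have h1 : #D = #Z * (q ^ n * q ^ n) := by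
    rw [card_product, card_univ, Fintype.card_prod, Fintype.card_fun, Fintype.card_fin]
  have h2 : #D ≤ q ^ 3 * (#S * q ^ n) := by
    refine (card_le_card hcover).trans (card_biUnion_le.trans ?_)
    refine (sum_le_card_nsmul _ _ _ fun u _ => hK u).trans ?_
    rw [card_univ, Fintype.card_prod, Fintype.card_prod, smul_eq_mul]
    exact (by ring : q * (q * q) * (#S * q ^ n) = q ^ 3 * (#S * q ^ n)).le
  rw [h1] at h2
  have h3 : 0 < q ^ n := by positivity
  refine Nat.le_of_mul_le_mul_right ?_ h3
  calc _ = #Z * (q ^ n * q ^ n) := by ring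
    _ ≤ _ := h2
    _ = _ := by ring

/-- The affine map with linear part `M` that sends `x` to `b`. -/
def affThrough (x : Fin ℓ → F) (b : Fin n → F) (M : Matrix (Fin n) (Fin ℓ) F) : Aff F n ℓ :=
  (M, b - M.mulVec x)

lemma affApp_affThrough (x : Fin ℓ → F) (b : Fin n → F) (M : Matrix (Fin n) (Fin ℓ) F)
    (p : Fin ℓ → F) : affApp (affThrough x b M) p = b + M.mulVec (p - x) := by
  simp only [affApp, affThrough, Matrix.mulVec_sub]
  abel

lemma card_aff : Fintype.card (Aff F n ℓ) =
    Fintype.card (Matrix (Fin n) (Fin ℓ) F) * Fintype.card F ^ n := by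
  rw [Fintype.card_prod, Fintype.card_fun, Fintype.card_fin]

theorem exists_heavy_point (𝓗 : Set ((Fin ℓ → F) → F)) (f : (Fin n → F) → F)
    (hS : (rejSet 𝓗 f).Nonempty)
    (hsmall : #(rejSet 𝓗 f) * Fintype.card F ^ 20 ≤ Fintype.card (Aff F n ℓ)) :
    ∃ (x : Fin ℓ → F) (b : Fin n → F), Fintype.card (Matrix (Fin n) (Fin ℓ) F) <
      8 * #{M | affThrough x b M ∈ rejSet 𝓗 f} := by
  set S := rejSet 𝓗 f with hSdef
  set q := Fintype.card F
  have hq : 2 ≤ q := Fintype.one_lt_card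
  let A : Aff F n ℓ ≃ Matrix (Fin n) (Fin (ℓ + 1)) F := Equiv.ofBijective augMat augMat_bijective
  have hAcard : Fintype.card (Matrix (Fin n) (Fin (ℓ + 1)) F) = Fintype.card (Aff F n ℓ) :=
    (Fintype.card_congr A).symm
  have hmove : ∀ T ∈ S.map A.toEmbedding, ∀ w : Fin n → F,
      q ^ Fintype.card (Fin (ℓ + 1)) ≤ q *
        #{a : Fin (ℓ + 1) → F | T + Matrix.vecMulVec w a ∈ S.map A.toEmbedding} := by
    intro T hT w
    obtain ⟨T, hTS, rfl⟩ := mem_map.1 hT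
    obtain ⟨h, hh, hne⟩ := mem_rejSet.1 hTS
    rw [Fintype.card_fin]
    refine (card_pow_le_card_affMove f T h hne w).trans (Nat.mul_le_mul_left _ (card_le_card ?_))
    intro a ha
    rw [mem_filter] at ha ⊢
    refine ⟨mem_univ _, mem_map.2 ⟨affMove T w a, mem_rejSet.2 ⟨h, hh, ha.2⟩, ?_⟩⟩
    exact augMat_affMove T w a
  obtain ⟨x, hx, z, hz⟩ := exists_heavy_mulVec (hS.map (f := A.toEmbedding))
    (by rw [card_map, hAcard]; exact hsmall) hmove
  have hz1 : #{T : Matrix (Fin n) (Fin (ℓ + 1)) F | T.mulVec x = z} =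
      #{T : Aff F n ℓ | T.1.mulVec (Fin.tail x) + x 0 • T.2 = z} := by
    refine (card_equiv A fun T => ?_).symm
    simp only [mem_filter, mem_univ, true_and, A, Equiv.ofBijective_apply, augMat_mulVec]
  have hz2 : #{T ∈ S.map A.toEmbedding | T.mulVec x = z} =
      #{T ∈ S | T.1.mulVec (Fin.tail x) + x 0 • T.2 = z} := by
    rw [filter_map, card_map]
    congr 1
    refine filter_congr fun T _ => ?_
    simp only [Function.comp, Equiv.coe_toEmbedding, A, Equiv.ofBijective_apply, augMat_mulVec]
  rw [hz2] at hz
  have hzoom := card_mulVec_eq (κ := Fin n) hx z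
  rw [hAcard, Fintype.card_fin] at hzoom
  by_cases hx0 : x 0 = 0
  · exfalso
    have hy : Fin.tail x ≠ 0 := by
      intro h0
      apply hx
      funext i
      refine Fin.cases hx0 (fun j => ?_) i
      exact congrFun h0 j
    simp only [hx0, zero_smul, add_zero] at hz
    have h1 := card_direction_zoom_le 𝓗 f hy z
    rw [← hSdef] at h1
    set Y := #{T ∈ S | T.1.mulVec (Fin.tail x) = z}
    have hqn : 0 < q ^ n := by positivity
    have h2 : Fintype.card (Aff F n ℓ) < 8 * (q ^ 3 * #S) := by
      rw [← hzoom]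
      calc _ < 8 * Y * q ^ n := Nat.mul_lt_mul_of_pos_right hz hqn
        _ = 8 * (Y * q ^ n) := by ring
        _ ≤ _ := Nat.mul_le_mul_left _ h1
    have h3 : 8 * q ^ 3 ≤ q ^ 20 := by
      calc 8 * q ^ 3 ≤ q ^ 3 * q ^ 3 :=
            Nat.mul_le_mul_right _ (by simpa using Nat.pow_le_pow_left hq 3)
        _ = q ^ 6 := by ring
        _ ≤ q ^ 20 := Nat.pow_le_pow_right (by omega) (by norm_num)
    have h4 := Nat.mul_le_mul_left #S h3
    nlinarith
  · refine ⟨(x 0)⁻¹ • Fin.tail x, (x 0)⁻¹ • z, ?_⟩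
    have e1 : #{T ∈ S | T.1.mulVec (Fin.tail x) + x 0 • T.2 = z} =
        #{M | affThrough ((x 0)⁻¹ • Fin.tail x) ((x 0)⁻¹ • z) M ∈ S} := by
      have hfix : ∀ T : Aff F n ℓ, T.1.mulVec (Fin.tail x) + x 0 • T.2 = z →
          affThrough ((x 0)⁻¹ • Fin.tail x) ((x 0)⁻¹ • z) T.1 = T := by
        intro T hT
        refine Prod.ext rfl ?_
        simp only [affThrough, Matrix.mulVec_smul, ← smul_sub, ← hT]
        rw [add_sub_cancel_left, smul_smul, inv_mul_cancel₀ hx0, one_smul]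
      refine card_nbij' (fun T => T.1)
        (fun M => affThrough ((x 0)⁻¹ • Fin.tail x) ((x 0)⁻¹ • z) M) ?_ ?_ ?_ ?_
      · intro T hT
        simp only [coe_filter, Set.mem_ofPred_eq, mem_univ, true_and] at hT ⊢
        rw [hfix T hT.2]
        exact hT.1
      · intro M hM
        simp only [coe_filter, Set.mem_ofPred_eq, mem_univ, true_and] at hM ⊢
        refine ⟨hM, ?_⟩
        simp only [affThrough, Matrix.mulVec_smul, ← smul_sub]
        rw [smul_smul, mul_inv_cancel₀ hx0, one_smul, add_sub_cancel]
      · intro T hT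
        exact hfix T (mem_filter.1 hT).2
      · intro M _
        rfl
    rw [← e1]
    refine lt_of_le_of_lt ?_ hz
    have hqn : 0 < q ^ n := by positivity
    rw [card_aff] at hzoom
    exact (Nat.eq_of_mul_eq_mul_right hqn hzoom).ge

end HeavyPoint

section BadMoves

variable {F : Type} [Field F] [Fintype F] [DecidableEq F] {n ℓ : ℕ}

lemma affApp_injective : Function.Injective (affApp (F := F) (n := n) (ℓ := ℓ)) := by
  intro T T' h
  have h0 : T.2 = T'.2 := by simpa [affApp] using congrFun h 0
  refine Prod.ext (Matrix.ext_of_mulVec_single fun i => ?_) h0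
  simpa [affApp, h0] using congrFun h (Pi.single i 1)

/-- Precomposition of an affine map with a blockwise substitution. -/
def substAff (J : Finset (Fin ℓ)) (z : Fin (ℓ + ℓ) → F) (T : Aff F n ℓ) : Aff F n ℓ :=
  (T.1 * Matrix.diagonal fun i => if i ∈ J then z (Fin.castAdd ℓ i) else 1,
    T.2 + T.1.mulVec fun i => if i ∈ J then z (Fin.natAdd ℓ i) else 0)

lemma affApp_substAff (J : Finset (Fin ℓ)) (z : Fin (ℓ + ℓ) → F) (T : Aff F n ℓ)
    (p : Fin ℓ → F) : affApp (substAff J z T) p = affApp T (blockSubst J z p) := by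
  have : blockSubst J z p = (Matrix.diagonal fun i => if i ∈ J then z (Fin.castAdd ℓ i) else 1).mulVec p
      + fun i => if i ∈ J then z (Fin.natAdd ℓ i) else 0 := by
    funext i
    by_cases hi : i ∈ J <;> simp [blockSubst, hi, Matrix.mulVec_diagonal]
  simp only [affApp, substAff, this, Matrix.mulVec_add, Matrix.mulVec_mulVec]
  abel

/-- The parameters of the inverse substitution. -/
def invSubst (z : Fin (ℓ + ℓ) → F) : Fin (ℓ + ℓ) → F :=
  Fin.append (fun i => (z (Fin.castAdd ℓ i))⁻¹)
    fun i => -((z (Fin.castAdd ℓ i))⁻¹ * z (Fin.natAdd ℓ i))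

lemma blockSubst_invSubst (J : Finset (Fin ℓ)) {z : Fin (ℓ + ℓ) → F} (hz : ∀ i, z i ≠ 0)
    (p : Fin ℓ → F) : blockSubst J (invSubst z) (blockSubst J z p) = p := by
  funext i
  by_cases hi : i ∈ J
  · have := hz (Fin.castAdd ℓ i)
    simp only [blockSubst, invSubst, hi, if_true, Fin.append_left, Fin.append_right]
    field_simp
    ring
  · simp [blockSubst, hi]

lemma blockSubst_bijective (J : Finset (Fin ℓ)) {z : Fin (ℓ + ℓ) → F} (hz : ∀ i, z i ≠ 0) :
    Function.Bijective (blockSubst J z) :=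
  Finite.injective_iff_bijective.1 (Function.LeftInverse.injective (blockSubst_invSubst J hz))

lemma ip_substAff_inv (f : (Fin n → F) → F) (h : (Fin ℓ → F) → F) (J : Finset (Fin ℓ))
    {z : Fin (ℓ + ℓ) → F} (hz : ∀ i, z i ≠ 0) (T : Aff F n ℓ) :
    ip (fun p => f (affApp (substAff J (invSubst z) T) p)) h =
      ip (fun p => f (affApp T p)) fun p => h (blockSubst J z p) := by
  refine (Function.Bijective.sum_comp (blockSubst_bijective J hz)
    (fun p => f (affApp (substAff J (invSubst z) T) p) * h p)).symm.trans ?_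
  refine sum_congr rfl fun p _ => ?_
  rw [affApp_substAff, blockSubst_invSubst J hz]

lemma substAff_inv_injective (J : Finset (Fin ℓ)) {z : Fin (ℓ + ℓ) → F} (hz : ∀ i, z i ≠ 0) :
    Function.Injective (substAff (n := n) J (invSubst z)) := by
  intro T T' h
  refine affApp_injective (funext fun p => ?_)
  rw [← blockSubst_invSubst J hz p, ← affApp_substAff, h, affApp_substAff]

open Classical in
lemma card_subst_reject_le (𝓗 : Set ((Fin ℓ → F) → F)) (f : (Fin n → F) → F)
    {J : Finset (Fin ℓ)} (hJ : ∀ h ∈ 𝓗, SpreadOn J h) :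
    #{T : Aff F n ℓ | ∃ h ∈ 𝓗, ∃ z, ip (fun p => f (affApp T p))
      (fun p => h (blockSubst J z p)) ≠ 0} ≤ Fintype.card F * #(rejSet 𝓗 f) := by
  set Γ := Fintype.piFinset fun _ : Fin (ℓ + ℓ) => (univ.erase 0 : Finset F) with hΓ
  have hΓ0 : 0 < #Γ := by
    refine card_pos.2 ⟨fun _ => 1, Fintype.mem_piFinset.2 fun _ => by simp⟩
  set B := {T : Aff F n ℓ | ∃ h ∈ 𝓗, ∃ z, ip (fun p => f (affApp T p))
      (fun p => h (blockSubst J z p)) ≠ 0} with hB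
  let R : (Fin (ℓ + ℓ) → F) → Aff F n ℓ → Prop := fun z T =>
    ∃ h ∈ 𝓗, ip (fun p => f (affApp T p)) (fun p => h (blockSubst J z p)) ≠ 0
  have h1 : ∀ T ∈ (univ.filter (· ∈ B)), #Γ ≤ Fintype.card F * #{z ∈ Γ | R z T} := by
    intro T hT
    obtain ⟨h, hh, hz⟩ := (mem_filter.1 hT).2
    refine (hJ h hh _ hz).trans (Nat.mul_le_mul_left _ (card_le_card ?_))
    exact monotone_filter_right _ fun z _ hz => ⟨h, hh, hz⟩
  have h2 : ∀ z ∈ Γ, #{T : Aff F n ℓ | R z T} ≤ #(rejSet 𝓗 f) := by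
    intro z hz
    have hz0 : ∀ i, z i ≠ 0 := fun i => ne_of_mem_erase (Fintype.mem_piFinset.1 hz i)
    refine card_le_card_of_injOn (substAff J (invSubst z)) (fun T hT => ?_)
      (substAff_inv_injective J hz0).injOn
    obtain ⟨h, hh, hne⟩ := (mem_filter.1 hT).2
    exact mem_rejSet.2 ⟨h, hh, by rwa [ip_substAff_inv f h J hz0]⟩
  have h3 : #(univ.filter (· ∈ B)) * #Γ ≤ Fintype.card F * (#Γ * #(rejSet 𝓗 f)) := by
    calc #(univ.filter (· ∈ B)) * #Γ
        ≤ ∑ T ∈ univ.filter (· ∈ B), Fintype.card F * #{z ∈ Γ | R z T} := by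
          rw [← smul_eq_mul]; exact card_nsmul_le_sum _ _ _ h1
      _ ≤ ∑ T : Aff F n ℓ, Fintype.card F * #{z ∈ Γ | R z T} :=
          sum_le_sum_of_subset (filter_subset _ _)
      _ = Fintype.card F * ∑ z ∈ Γ, #{T : Aff F n ℓ | R z T} := by
          rw [← mul_sum]
          congr 1
          exact sum_card_bipartiteAbove_eq_sum_card_bipartiteBelow (fun T z => R z T)
      _ ≤ _ := Nat.mul_le_mul_left _ (by
          rw [← smul_eq_mul]; exact sum_le_card_nsmul _ _ _ h2)
  refine Nat.le_of_mul_le_mul_right (h3.trans_eq (by ring)) hΓ0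

lemma affMove_affThrough_injective (x : Fin ℓ → F) (b : Fin n → F) {a : Fin (ℓ + 1) → F}
    (ha : a 0 + Fin.tail a ⬝ᵥ x ≠ 0) :
    Function.Injective fun u : Matrix (Fin n) (Fin ℓ) F × (Fin n → F) =>
      affMove (affThrough x b u.1) u.2 a := by
  rintro ⟨M, w⟩ ⟨M', w'⟩ h
  dsimp only at h
  have h1 := congrArg (fun T => affApp T x) h
  simp only [affApp_affMove, affApp_affThrough, sub_self, Matrix.mulVec_zero, add_zero,
    add_right_inj] at h1
  have hw := smul_right_injective _ ha h1
  subst hw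
  have h2 := congrArg Prod.fst h
  simp only [affMove, affThrough, add_left_inj] at h2
  rw [h2]

/-- The affine function `a₀ + a₁ pᵢ`, as a coefficient vector. -/
def coordAff (i : Fin ℓ) (a₀ a₁ : F) : Fin (ℓ + 1) → F := Fin.cons a₀ (Pi.single i a₁)

/-- All tests, with arbitrary substitutions in the block `J`, vanish along the moves of
`affThrough x b M` in direction `w` by affine functions of one coordinate from `I` which do not
vanish at `x`. -/
def Quiet (𝓗 : Set ((Fin ℓ → F) → F)) (f : (Fin n → F) → F) (x : Fin ℓ → F) (b : Fin n → F)
    (J I : Finset (Fin ℓ)) (M : Matrix (Fin n) (Fin ℓ) F) (w : Fin n → F) : Prop :=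
  ∀ i ∈ I, ∀ a₀ a₁ : F, a₀ + a₁ * x i ≠ 0 → ∀ h ∈ 𝓗, ∀ z,
    ∑ p : Fin ℓ → F, f (b + M.mulVec (p - x) + (a₀ + a₁ * p i) • w) * h (blockSubst J z p) = 0

open Classical in
lemma card_not_quiet_le (𝓗 : Set ((Fin ℓ → F) → F)) (f : (Fin n → F) → F) (x : Fin ℓ → F)
    (b : Fin n → F) {J : Finset (Fin ℓ)} (hJ : ∀ h ∈ 𝓗, SpreadOn J h) (I : Finset (Fin ℓ)) :
    #{u : Matrix (Fin n) (Fin ℓ) F × (Fin n → F) | ¬ Quiet 𝓗 f x b J I u.1 u.2} ≤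
      #I * Fintype.card F ^ 3 * #(rejSet 𝓗 f) := by
  set q := Fintype.card F
  set B := {T : Aff F n ℓ | ∃ h ∈ 𝓗, ∃ z, ip (fun p => f (affApp T p))
      (fun p => h (blockSubst J z p)) ≠ 0} with hB
  have hBcard := card_subst_reject_le 𝓗 f hJ
  let K : Fin ℓ × F × F → Finset (Matrix (Fin n) (Fin ℓ) F × (Fin n → F)) := fun y =>
    {u | y.2.1 + y.2.2 * x y.1 ≠ 0 ∧
      affMove (affThrough x b u.1) u.2 (coordAff y.1 y.2.1 y.2.2) ∈ B}
  have hdot : ∀ (i : Fin ℓ) (a₀ a₁ : F) (p : Fin ℓ → F),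
      coordAff i a₀ a₁ 0 + Fin.tail (coordAff i a₀ a₁) ⬝ᵥ p = a₀ + a₁ * p i := by
    intro i a₀ a₁ p
    simp [coordAff]
  have hK : ∀ y, #(K y) ≤ q * #(rejSet 𝓗 f) := by
    rintro ⟨i, a₀, a₁⟩
    by_cases ha : a₀ + a₁ * x i = 0
    · have : K (i, a₀, a₁) = ∅ := filter_false_of_mem fun u _ => by simp [ha]
      simp [this]
    · refine le_trans (card_le_card_of_injOn
        (fun u => affMove (affThrough x b u.1) u.2 (coordAff i a₀ a₁)) (fun u hu => ?_) ?_) hBcard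
      · exact mem_filter.2 ⟨mem_univ _, (mem_filter.1 hu).2.2⟩
      · exact (affMove_affThrough_injective x b (by rwa [hdot])).injOn
  have hcover : ({u | ¬ Quiet 𝓗 f x b J I u.1 u.2} : Finset _) ⊆ (I ×ˢ univ).biUnion K := by
    intro u hu
    have hu := (mem_filter.1 hu).2
    simp only [Quiet, not_forall] at hu
    obtain ⟨i, hi, a₀, a₁, ha, h, hh, z, hne⟩ := hu
    refine mem_biUnion.2 ⟨(i, a₀, a₁), mem_product.2 ⟨hi, mem_univ _⟩,
      mem_filter.2 ⟨mem_univ _, ha, h, hh, z, ?_⟩⟩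
    simpa only [ip, affApp_affMove, affApp_affThrough, hdot] using hne
  refine (card_le_card hcover).trans (card_biUnion_le.trans ?_)
  refine (sum_le_card_nsmul _ _ _ fun y _ => hK y).trans ?_
  rw [card_product, card_univ, Fintype.card_prod, smul_eq_mul]
  exact (by ring : #I * (q * q) * (q * #(rejSet 𝓗 f)) = #I * q ^ 3 * #(rejSet 𝓗 f)).le

open Classical in
lemma card_not_mul_le_of_quiet {𝓗 : Set ((Fin ℓ → F) → F)} {f : (Fin n → F) → F}
    {x : Fin ℓ → F} {b : Fin n → F} {J : Finset (Fin ℓ)} (hJ : ∀ h ∈ 𝓗, SpreadOn J h)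
    {I : Finset (Fin ℓ)} {A : Matrix (Fin n) (Fin ℓ) F → Prop}
    (hA : ∀ M w, Quiet 𝓗 f x b J I M w → A M) :
    #{M | ¬ A M} * Fintype.card F ^ n ≤ #I * Fintype.card F ^ 3 * #(rejSet 𝓗 f) := by
  refine le_trans ?_ (card_not_quiet_le 𝓗 f x b hJ I)
  have : #{M | ¬ A M} * Fintype.card F ^ n =
      #(({M | ¬ A M} : Finset _) ×ˢ (univ : Finset (Fin n → F))) := by
    rw [card_product, card_univ, Fintype.card_fun, Fintype.card_fin]
  rw [this]
  refine card_le_card fun u hu => mem_filter.2 ⟨mem_univ _, fun hq => ?_⟩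
  exact (mem_filter.1 (mem_product.1 hu).1).2 (hA _ _ hq)

end BadMoves

section Peeling

variable {F : Type} [Field F] [Fintype F] [DecidableEq F] {n ℓ : ℕ}

/-- The test value of `h` along the affine map with linear part `M` sending `x` to `b`. -/
def throughIp (f : (Fin n → F) → F) (x : Fin ℓ → F) (b : Fin n → F)
    (M : Matrix (Fin n) (Fin ℓ) F) (h : (Fin ℓ → F) → F) : F :=
  ∑ p : Fin ℓ → F, f (b + M.mulVec (p - x)) * h p

lemma ip_affThrough (f : (Fin n → F) → F) (x : Fin ℓ → F) (b : Fin n → F)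
    (M : Matrix (Fin n) (Fin ℓ) F) (h : (Fin ℓ → F) → F) :
    ip (fun p => f (affApp (affThrough x b M) p)) h = throughIp f x b M h := by
  simp only [ip, affApp_affThrough, throughIp]

lemma throughIp_smul (f : (Fin n → F) → F) (x : Fin ℓ → F) (b : Fin n → F)
    (M : Matrix (Fin n) (Fin ℓ) F) (a : F) (h : (Fin ℓ → F) → F) :
    throughIp f x b M (fun p => a * h p) = a * throughIp f x b M h := by
  simp only [throughIp, mul_sum]
  exact sum_congr rfl fun p _ => by ring

/-- The sum of `f` over the line in direction `w` through the image of `p`. -/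
def lineSum (f : (Fin n → F) → F) (x : Fin ℓ → F) (b : Fin n → F)
    (M : Matrix (Fin n) (Fin ℓ) F) (w : Fin n → F) (p : Fin ℓ → F) : F :=
  ∑ z : F, f (b + M.mulVec (p - x) + z • w)

lemma lineSum_add_vecMulVec (f : (Fin n → F) → F) (x : Fin ℓ → F) (b : Fin n → F)
    (M : Matrix (Fin n) (Fin ℓ) F) (w : Fin n → F) (a : Fin ℓ → F) :
    lineSum f x b (M + Matrix.vecMulVec w a) w = lineSum f x b M w := by
  funext p
  refine Fintype.sum_equiv (Equiv.addRight (a ⬝ᵥ (p - x))) _ _ fun z => ?_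
  congr 1
  simp only [Matrix.add_mulVec, Matrix.vecMulVec_mulVec, op_smul_eq_smul, Equiv.coe_addRight]
  module

lemma throughIp_eq_sum_lineSum {f : (Fin n → F) → F} {x : Fin ℓ → F} {b : Fin n → F}
    {M : Matrix (Fin n) (Fin ℓ) F} {w : Fin n → F} {h : (Fin ℓ → F) → F}
    (hq : ∀ a : F, a ≠ 0 → ∑ p : Fin ℓ → F, f (b + M.mulVec (p - x) + a • w) * h p = 0) :
    throughIp f x b M h = ∑ p, lineSum f x b M w p * h p := by
  simp only [lineSum, sum_mul]
  rw [sum_comm, sum_eq_single 0 (fun a _ ha => hq a ha) (by simp)]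
  simp [throughIp]

lemma throughIp_eq_sum_lineSum_coord {f : (Fin n → F) → F} {x : Fin ℓ → F} {b : Fin n → F}
    {M : Matrix (Fin n) (Fin ℓ) F} {w : Fin n → F} {h : (Fin ℓ → F) → F} {i : Fin ℓ}
    (hq : ∀ a₀ a₁ : F, a₀ + a₁ * x i ≠ 0 →
      ∑ p : Fin ℓ → F, f (b + M.mulVec (p - x) + (a₀ + a₁ * p i) • w) * h p = 0) :
    throughIp f x b M h = ∑ p, if p i = x i then lineSum f x b M w p * h p else 0 := by
  have h1 : throughIp f x b M h = ∑ p, lineSum f x b M w p * h p :=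
    throughIp_eq_sum_lineSum fun a ha => by simpa using hq a 0 (by simpa using ha)
  have h2 : ∀ v, v ≠ x i → throughIp f x b M h =
      ∑ p, if p i = v then 0 else lineSum f x b M w p * h p := by
    intro v hv
    have h3 : throughIp f x b M h =
        ∑ a : F, ∑ p : Fin ℓ → F, f (b + M.mulVec (p - x) + (a * (p i - v)) • w) * h p := by
      rw [sum_eq_single 0 (fun a _ ha => ?_) (by simp)]
      · simp [throughIp]
      · have h4 : -(a * v) + a * x i ≠ 0 := by
          rw [neg_add_eq_sub, ← mul_sub]
          exact mul_ne_zero ha (sub_ne_zero.2 hv.symm)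
        rw [← hq _ _ h4]
        exact sum_congr rfl fun p _ => by rw [neg_add_eq_sub, ← mul_sub]
    rw [h3, sum_comm]
    refine sum_congr rfl fun p _ => ?_
    rw [← sum_mul, sum_smul_line]
    by_cases hp : p i = v
    · simp [hp]
    · simp [hp, sub_ne_zero.2 hp, lineSum]
  have h5 : ∀ v, v ≠ x i → ∑ p, (if p i = v then lineSum f x b M w p * h p else 0) = 0 := by
    intro v hv
    have h6 := h2 v hv
    have h7 : ∑ p, lineSum f x b M w p * h p =
        ∑ p, (if p i = v then 0 else lineSum f x b M w p * h p) +
        ∑ p, (if p i = v then lineSum f x b M w p * h p else 0) := by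
      rw [← sum_add_distrib]
      exact sum_congr rfl fun p _ => by split_ifs <;> simp
    rw [← h1, ← h6] at h7
    exact left_eq_add.1 h7
  have h8 : ∀ p : Fin ℓ → F, lineSum f x b M w p * h p =
      ∑ v : F, if p i = v then lineSum f x b M w p * h p else 0 := fun p => by simp
  rw [h1, sum_congr rfl fun p _ => h8 p, sum_comm]
  exact sum_eq_single (x i) (fun v _ hv => h5 v hv) (by simp)

lemma throughIp_congr_coord {f : (Fin n → F) → F} {x : Fin ℓ → F} {b : Fin n → F}
    {M : Matrix (Fin n) (Fin ℓ) F} {w : Fin n → F} {h h' : (Fin ℓ → F) → F} {i : Fin ℓ}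
    (hq : ∀ a₀ a₁ : F, a₀ + a₁ * x i ≠ 0 →
      ∑ p : Fin ℓ → F, f (b + M.mulVec (p - x) + (a₀ + a₁ * p i) • w) * h p = 0)
    (hq' : ∀ a₀ a₁ : F, a₀ + a₁ * x i ≠ 0 →
      ∑ p : Fin ℓ → F, f (b + M.mulVec (p - x) + (a₀ + a₁ * p i) • w) * h' p = 0)
    {a : F} (hh : ∀ p : Fin ℓ → F, p i = x i → h p = a * h' p) :
    throughIp f x b M h = a * throughIp f x b M h' := by
  rw [throughIp_eq_sum_lineSum_coord hq, throughIp_eq_sum_lineSum_coord hq', mul_sum]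
  refine sum_congr rfl fun p _ => ?_
  split_ifs with hp
  · rw [hh p hp]; ring
  · simp

lemma Quiet.throughIp_blockSubst {𝓗 : Set ((Fin ℓ → F) → F)} {f : (Fin n → F) → F}
    {x : Fin ℓ → F} {b : Fin n → F} {J : Finset (Fin ℓ)} {M : Matrix (Fin n) (Fin ℓ) F}
    {w : Fin n → F} (hQ : Quiet 𝓗 f x b J J M w) {h : (Fin ℓ → F) → F} (hh : h ∈ 𝓗)
    (l m : Fin ℓ → F) :
    throughIp f x b M (fun p => h (blockSubst J (Fin.append l m) p)) =
      throughIp f x b M fun p => h (J.piecewise (l * x + m) p) := by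
  have key : ∀ K : Finset (Fin ℓ), K ⊆ J →
      throughIp f x b M (fun p => h (blockSubst J (Fin.append l m) p)) =
      throughIp f x b M fun p =>
        h (blockSubst J (Fin.append (K.piecewise 0 l) (K.piecewise (l * x + m) m)) p) := by
    intro K
    induction K using Finset.induction_on with
    | empty => simp
    | insert i K hi ih =>
      intro hK
      rw [ih ((subset_insert _ _).trans hK)]
      have hiJ := hK (mem_insert_self i K)
      rw [← one_mul (throughIp f x b M fun p => h (blockSubst J (Fin.append
        ((insert i K).piecewise 0 l) _) p))]
      refine throughIp_congr_coord (i := i) (w := w) (fun a₀ a₁ ha => hQ i hiJ a₀ a₁ ha h hh _)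
        (fun a₀ a₁ ha => hQ i hiJ a₀ a₁ ha h hh _) fun p hp => ?_
      rw [one_mul]
      congr 1
      funext j
      by_cases hj : j ∈ J
      · simp only [blockSubst, hj, if_true, Fin.append_left, Fin.append_right]
        by_cases hji : j = i
        · subst hji
          simp [hi, hp]
        · by_cases hjK : j ∈ K <;> simp [hjK, hji, Finset.piecewise]
      · simp [blockSubst, hj]
  rw [key J subset_rfl]
  congr 1
  funext p
  congr 1
  funext j
  by_cases hj : j ∈ J
  · simp only [blockSubst, hj, if_true, Fin.append_left, Fin.append_right]
    simp [hj]
  · simp [blockSubst, hj]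

lemma throughIp_eq_shift (f : (Fin n → F) → F) (x x' : Fin ℓ → F) (b : Fin n → F)
    (M : Matrix (Fin n) (Fin ℓ) F) (h : (Fin ℓ → F) → F) :
    throughIp f x' b M h = throughIp f x b M fun p => h (p + (x' - x)) := by
  refine (Fintype.sum_equiv (Equiv.addRight (x' - x)) _ _ fun p => ?_).symm
  simp only [Equiv.coe_addRight]
  congr 3
  abel_nf

/-- If `h` is a product of a function `φ` of the coordinates in `J` and a function `ρ` of the
others, then quiet moves make the test value at any point a multiple of `φ` at this point. -/
lemma Quiet.throughIp_of_factor {𝓗 : Set ((Fin ℓ → F) → F)} {f : (Fin n → F) → F}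
    {x : Fin ℓ → F} {b : Fin n → F} {J : Finset (Fin ℓ)} {M : Matrix (Fin n) (Fin ℓ) F}
    {w : Fin n → F} (hQ : Quiet 𝓗 f x b J J M w) {h : (Fin ℓ → F) → F} (hh : h ∈ 𝓗)
    {φ ρ : (Fin ℓ → F) → F} (hφ : ∀ p p', (∀ i ∈ J, p i = p' i) → φ p = φ p')
    (hρ : ∀ p p', (∀ i ∉ J, p i = p' i) → ρ p = ρ p') (hprod : ∀ p, h p = φ p * ρ p)
    {x' : Fin ℓ → F} (hx' : ∀ i ∉ J, x' i = x i) :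
    throughIp f x' b M h = φ x' * throughIp f x b M ρ := by
  rw [throughIp_eq_shift f x x']
  have h1 : (fun p => h (p + (x' - x))) = fun p => h (blockSubst J (Fin.append 1 (x' - x)) p) := by
    funext p
    congr 1
    funext i
    by_cases hi : i ∈ J
    · simp only [blockSubst, hi, if_true, Fin.append_left, Fin.append_right]
      simp
    · simp [blockSubst, hi, hx' i hi]
  rw [h1, hQ.throughIp_blockSubst hh, ← throughIp_smul]
  congr 1
  funext p
  rw [hprod]
  congr 1
  · exact hφ _ _ fun i hi => by simp [hi]
  · exact hρ _ _ fun i hi => by simp [hi]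

end Peeling

section BlockTests

variable {F : Type} [Field F] [Fintype F] [DecidableEq F] {n ℓ t : ℕ}

/-- A family of test functions which are products of functions of disjoint blocks of coordinates
and of a monomial in the remaining free coordinates. -/
structure BlockTests (F : Type) [Field F] [Fintype F] [DecidableEq F] (ℓ t : ℕ) where
  blocks : Finset ℕ
  block : ℕ → Finset (Fin ℓ)
  factor : ℕ → (Fin ℓ → F) → F
  free : Fin t → Fin ℓ
  valid : (Fin t → ℕ) → Prop
  factor_congr : ∀ k ∈ blocks, ∀ p p' : Fin ℓ → F, (∀ i ∈ block k, p i = p' i) →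
    factor k p = factor k p'
  block_disjoint : ∀ k ∈ blocks, ∀ k' ∈ blocks, k ≠ k' → Disjoint (block k) (block k')
  free_notMem : ∀ k ∈ blocks, ∀ j, free j ∉ block k
  valid_zero : valid 0
  valid_piecewise : ∀ (e : Fin t → ℕ) (K : Finset (Fin t)), valid e → valid (K.piecewise 0 e)
  spread : ∀ k ∈ blocks, ∀ e, valid e → SpreadOn (block k) fun p : Fin ℓ → F =>
    (∏ k' ∈ blocks, factor k' p) * ∏ j, p (free j) ^ e j
  card_block_le : ∀ k ∈ blocks, #(block k) ≤ Fintype.card F ^ 4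
  pos : 0 < t
  le : t ≤ Fintype.card F ^ 4

namespace BlockTests

variable (A : BlockTests F ℓ t)

/-- The test function with exponents `e`. -/
def test (e : Fin t → ℕ) (p : Fin ℓ → F) : F :=
  (∏ k ∈ A.blocks, A.factor k p) * ∏ j, p (A.free j) ^ e j

/-- The product of the block factors. -/
def core (p : Fin ℓ → F) : F := ∏ k ∈ A.blocks, A.factor k p

/-- The set of all valid test functions. -/
def tests : Set ((Fin ℓ → F) → F) := {h | ∃ e, A.valid e ∧ h = A.test e}

/-- The set of free coordinates. -/
def freeSet : Finset (Fin ℓ) := univ.image A.free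

lemma test_zero (p : Fin ℓ → F) : A.test 0 p = A.core p := by simp [test, core]

lemma test_mem {e : Fin t → ℕ} (he : A.valid e) : A.test e ∈ A.tests := ⟨e, he, rfl⟩

lemma spreadOn_tests {k : ℕ} (hk : k ∈ A.blocks) : ∀ h ∈ A.tests, SpreadOn (A.block k) h := by
  rintro h ⟨e, he, rfl⟩
  exact A.spread k hk e he

lemma core_congr {p p' : Fin ℓ → F} (h : ∀ k ∈ A.blocks, ∀ i ∈ A.block k, p i = p' i) :
    A.core p = A.core p' :=
  prod_congr rfl fun k hk => A.factor_congr k hk _ _ (h k hk)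

lemma card_freeSet_le : #A.freeSet ≤ Fintype.card F ^ 4 :=
  card_image_le.trans ((card_univ.trans (Fintype.card_fin t)).trans_le A.le)

/-- A test function split into a block factor and the remaining factors. -/
lemma test_eq_factor_mul {k : ℕ} (hk : k ∈ A.blocks) (e : Fin t → ℕ) (p : Fin ℓ → F) :
    A.test e p = A.factor k p *
      ((∏ k' ∈ A.blocks.erase k, A.factor k' p) * ∏ j, p (A.free j) ^ e j) := by
  rw [test, ← mul_prod_erase _ _ hk, mul_assoc]

lemma rest_congr {k : ℕ} (hk : k ∈ A.blocks) (e : Fin t → ℕ) (p p' : Fin ℓ → F)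
    (h : ∀ i ∉ A.block k, p i = p' i) :
    (∏ k' ∈ A.blocks.erase k, A.factor k' p) * ∏ j, p (A.free j) ^ e j =
      (∏ k' ∈ A.blocks.erase k, A.factor k' p') * ∏ j, p' (A.free j) ^ e j := by
  congr 1
  · refine prod_congr rfl fun k' hk' => A.factor_congr k' (mem_of_mem_erase hk') _ _ fun i hi => ?_
    exact h i (disjoint_right.1
      (A.block_disjoint k hk k' (mem_of_mem_erase hk') (ne_of_mem_erase hk').symm) hi)
  · exact prod_congr rfl fun j _ => by rw [h _ (A.free_notMem k hk j)]

/-- All valid test values along `M` are those of the point mass `κ` at the image of `x`. -/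
def Aligned (f : (Fin n → F) → F) (b : Fin n → F) (κ : F) (x : Fin ℓ → F)
    (M : Matrix (Fin n) (Fin ℓ) F) : Prop :=
  ∀ e, A.valid e → throughIp f x b M (A.test e) = κ * A.test e x

variable {A} {f : (Fin n → F) → F} {b : Fin n → F} {x x' : Fin ℓ → F}
  {M : Matrix (Fin n) (Fin ℓ) F} {w : Fin n → F}

lemma throughIp_test_of_quiet (hQ : Quiet A.tests f x b ∅ A.freeSet M w) {e : Fin t → ℕ}
    (he : A.valid e) : throughIp f x b M (A.test e) =
      (∏ j, x (A.free j) ^ e j) * throughIp f x b M (A.test 0) := by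
  have hb : ∀ (z : Fin (ℓ + ℓ) → F) p, blockSubst ∅ z p = p := fun z p => by
    funext i
    simp [blockSubst]
  have key : ∀ K : Finset (Fin t), throughIp f x b M (A.test e) =
      (∏ j ∈ K, x (A.free j) ^ e j) * throughIp f x b M (A.test (K.piecewise 0 e)) := by
    intro K
    induction K using Finset.induction_on with
    | empty => simp
    | insert j K hj ih =>
      have hq : ∀ K : Finset (Fin t), ∀ a₀ a₁ : F, a₀ + a₁ * x (A.free j) ≠ 0 →
          ∑ p : Fin ℓ → F, f (b + M.mulVec (p - x) + (a₀ + a₁ * p (A.free j)) • w) *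
            A.test (K.piecewise 0 e) p = 0 := fun K a₀ a₁ ha => by
        simpa only [hb] using hQ (A.free j) (mem_image_of_mem _ (mem_univ j)) a₀ a₁ ha _
          (A.test_mem (A.valid_piecewise e K he)) 0
      rw [ih, prod_insert hj, mul_comm (x (A.free j) ^ e j), mul_assoc]
      congr 1
      refine throughIp_congr_coord (hq K) (hq (insert j K)) fun p hp => ?_
      have h1 : ∏ i, p (A.free i) ^ K.piecewise 0 e i = x (A.free j) ^ e j *
          ∏ i, p (A.free i) ^ (insert j K).piecewise 0 e i := by
        rw [← mul_prod_erase _ _ (mem_univ j), ← mul_prod_erase univ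
          (fun i => p (A.free i) ^ (insert j K).piecewise 0 e i) (mem_univ j)]
        have h2 : (insert j K).piecewise 0 e j = 0 := by simp
        have h3 : K.piecewise 0 e j = e j := by simp [hj]
        rw [h2, h3, hp, pow_zero, one_mul]
        congr 1
        refine prod_congr rfl fun i hi => ?_
        congr 1
        by_cases hiK : i ∈ K <;> simp [Finset.piecewise, hiK, ne_of_mem_erase hi]
      simp only [test, h1]
      ring
  simpa using key univ

lemma aligned_of_quiet (hQ : Quiet A.tests f x b ∅ A.freeSet M w) {κ : F}
    (h0 : throughIp f x b M (A.test 0) = κ * A.core x) : A.Aligned f b κ x M := by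
  intro e he
  rw [throughIp_test_of_quiet hQ he, h0, test, core]
  ring

lemma throughIp_eq_of_quiet (hQ : Quiet A.tests f x b ∅ A.freeSet M w) {a : Fin ℓ → F}
    (hQ' : Quiet A.tests f x b ∅ A.freeSet (M + Matrix.vecMulVec w a) w) :
    throughIp f x b (M + Matrix.vecMulVec w a) (A.test 0) = throughIp f x b M (A.test 0) := by
  have hb : ∀ (z : Fin (ℓ + ℓ) → F) p, blockSubst ∅ z p = p := fun z p => by
    funext i
    simp [blockSubst]
  have hq : ∀ M', Quiet A.tests f x b ∅ A.freeSet M' w → ∀ c : F, c ≠ 0 →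
      ∑ p : Fin ℓ → F, f (b + M'.mulVec (p - x) + c • w) * A.test 0 p = 0 := by
    intro M' hM' c hc
    simpa [hb] using hM' (A.free ⟨0, A.pos⟩) (mem_image_of_mem _ (mem_univ _)) c 0 (by simpa)
      _ (A.test_mem A.valid_zero) 0
  rw [throughIp_eq_sum_lineSum (hq _ hQ), throughIp_eq_sum_lineSum (hq _ hQ'),
    lineSum_add_vecMulVec]

lemma throughIp_block {k : ℕ} (hk : k ∈ A.blocks)
    (hQ : Quiet A.tests f x b (A.block k) (A.block k) M w) (hx' : ∀ i ∉ A.block k, x' i = x i)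
    {e : Fin t → ℕ} (he : A.valid e) :
    throughIp f x' b M (A.test e) = A.factor k x' * throughIp f x b M fun p =>
      (∏ k' ∈ A.blocks.erase k, A.factor k' p) * ∏ j, p (A.free j) ^ e j :=
  hQ.throughIp_of_factor (A.test_mem he) (A.factor_congr k hk) (A.rest_congr hk e)
    (A.test_eq_factor_mul hk e) hx'

lemma Aligned.of_block {k : ℕ} (hk : k ∈ A.blocks)
    (hQ : Quiet A.tests f x b (A.block k) (A.block k) M w) (hx' : ∀ i ∉ A.block k, x' i = x i)
    (hx : A.factor k x ≠ 0) {κ : F} (hA : A.Aligned f b κ x M) : A.Aligned f b κ x' M := by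
  intro e he
  have h1 := hA e he
  rw [throughIp_block hk hQ (fun _ _ => rfl) he, A.test_eq_factor_mul hk] at h1
  have h2 := mul_left_cancel₀ hx (h1.trans (mul_left_comm _ _ _))
  rw [throughIp_block hk hQ hx' he, h2, A.test_eq_factor_mul hk, A.rest_congr hk e x' x hx']
  ring

lemma throughIp_zero_congr (hxx : ∀ k ∈ A.blocks, ∀ i ∈ A.block k, x i = x' i) :
    throughIp f x' b M (A.test 0) = throughIp f x b M (A.test 0) := by
  rw [throughIp_eq_shift f x x']
  congr 1
  funext p
  rw [test_zero, test_zero]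
  exact A.core_congr fun k hk i hi => by simp [hxx k hk i hi]

end BlockTests

end BlockTests

section Boosting

variable {F : Type} [Field F] [Fintype F] [DecidableEq F] {n ℓ t : ℕ}

open Classical in
/-- A set of matrices which is preserved by rank-one moves outside of a small exceptional set of
matrix-direction pairs is very small or very large. -/
lemma card_dichotomy (C : Finset (Matrix (Fin n) (Fin ℓ) F))
    (Q : Matrix (Fin n) (Fin ℓ) F → (Fin n → F) → Prop)
    (hC : ∀ M w a, Q M w → Q (M + Matrix.vecMulVec w a) w → M ∈ C → M + Matrix.vecMulVec w a ∈ C)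
    (hQ : #{u : Matrix (Fin n) (Fin ℓ) F × (Fin n → F) | ¬ Q u.1 u.2} * (256 * Fintype.card F) ≤
      Fintype.card (Matrix (Fin n) (Fin ℓ) F) * Fintype.card F ^ n) :
    #C * (32 * Fintype.card F) ≤ Fintype.card (Matrix (Fin n) (Fin ℓ) F) ∨
      #Cᶜ * 32 ≤ Fintype.card (Matrix (Fin n) (Fin ℓ) F) := by
  set q := Fintype.card F with hq
  set m := Fintype.card (Matrix (Fin n) (Fin ℓ) F) with hm
  set B := #{u : Matrix (Fin n) (Fin ℓ) F × (Fin n → F) | ¬ Q u.1 u.2} with hB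
  have hq2 : 2 ≤ q := Fintype.one_lt_card
  have hB1 : ∑ w : Fin n → F, #{M : Matrix (Fin n) (Fin ℓ) F | ¬ Q M w} = B := by
    rw [hB, ← univ_product_univ, card_filter, sum_product_right]
    exact sum_congr rfl fun w _ => card_filter _ _
  have hstep : ∀ (w : Fin n → F) (a : Fin ℓ → F),
      #C ≤ #{M ∈ C | M + Matrix.vecMulVec w a ∈ C} +
        2 * #{M : Matrix (Fin n) (Fin ℓ) F | ¬ Q M w} := by
    intro w a
    have h1 := card_filter_add_card_filter_not (s := C) fun M => M + Matrix.vecMulVec w a ∈ C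
    have h2 : #{M ∈ C | ¬ M + Matrix.vecMulVec w a ∈ C} ≤
        #((univ.filter fun M => ¬ Q M w) ∪
          univ.filter fun M => ¬ Q (M + Matrix.vecMulVec w a) w) := by
      refine card_le_card fun M hM => ?_
      rw [mem_filter] at hM
      by_contra hcon
      simp only [mem_union, mem_filter, mem_univ, true_and, not_or, not_not] at hcon
      exact hM.2 (hC M w a hcon.1 hcon.2 hM.1)
    have h3 : #{M | ¬ Q (M + Matrix.vecMulVec w a) w} = #{M | ¬ Q M w} :=
      card_equiv (Equiv.addRight (Matrix.vecMulVec w a)) fun M => by simp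
    have h4 := card_union_le (univ.filter fun M => ¬ Q M w)
      (univ.filter fun M => ¬ Q (M + Matrix.vecMulVec w a) w)
    omega
  have hmoves : q ^ n * q ^ ℓ * #C ≤ rankOneMoves C + 2 * B * q ^ ℓ := by
    have h1 : ∑ w : Fin n → F, ∑ _a : Fin ℓ → F, #C ≤ ∑ w : Fin n → F, ∑ a : Fin ℓ → F,
        (#{M ∈ C | M + Matrix.vecMulVec w a ∈ C} +
          2 * #{M : Matrix (Fin n) (Fin ℓ) F | ¬ Q M w}) :=
      sum_le_sum fun w _ => sum_le_sum fun a _ => hstep w a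
    simp only [sum_add_distrib, sum_const, card_univ, Fintype.card_fun, Fintype.card_fin,
      smul_eq_mul, ← mul_sum, hB1] at h1
    unfold rankOneMoves
    calc q ^ n * q ^ ℓ * #C = q ^ n * (q ^ ℓ * #C) := by ring
      _ ≤ _ := h1
      _ = _ := by ring
  have hspec := rankOneMoves_le C
  simp only [Fintype.card_fin] at hspec
  rw [← hq, ← hm] at hspec
  have hC' : #Cᶜ = m - #C := card_compl C
  have hCm : #C ≤ m := card_le_univ C
  have hqR : (2 : ℝ) ≤ q := by exact_mod_cast hq2
  have hmovesR : (q : ℝ) ^ n * q ^ ℓ * #C ≤ rankOneMoves C + 2 * B * q ^ ℓ := by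
    exact_mod_cast hmoves
  have hQR : (B : ℝ) * (256 * q) ≤ m * q ^ n := by exact_mod_cast hQ
  have hmpos : (0 : ℝ) < m := by
    have : 0 < m := Fintype.card_pos
    exact_mod_cast this
  have hCmR : (#C : ℝ) ≤ m := by exact_mod_cast hCm
  have hC0 : (0 : ℝ) ≤ #C := Nat.cast_nonneg _
  have hCR : (#Cᶜ : ℝ) = m - #C := by rw [hC', Nat.cast_sub hCm]
  obtain ⟨c, hc⟩ : ∃ c : ℝ, c = #C := ⟨_, rfl⟩
  rw [← hc] at hmovesR hCmR hC0 hCR hspec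
  have hqn : (0 : ℝ) < (q : ℝ) ^ n := by positivity
  have hql : (0 : ℝ) < (q : ℝ) ^ ℓ := by positivity
  have hq0 : (0 : ℝ) < q := by linarith
  have h1 : (m : ℝ) * (q ^ n * c - 2 * B) ≤ q ^ n * (c ^ 2 + (m * c - c ^ 2) / q) := by
    refine le_of_mul_le_mul_right ?_ hql
    nlinarith
  have h2 : (q : ℝ) ^ n * ((m * c - c ^ 2) * (1 - 1 / q)) ≤ 2 * B * m := by
    have : (m * c - c ^ 2) / q = (m * c - c ^ 2) * (1 / q) := by ring
    rw [this] at h1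
    nlinarith
  have h3 : (1 : ℝ) / 2 ≤ 1 - 1 / q := by
    have : (1 : ℝ) / q ≤ 1 / 2 := one_div_le_one_div_of_le (by norm_num) hqR
    linarith
  have h4 : 0 ≤ m * c - c ^ 2 := by nlinarith
  have h5 : (q : ℝ) ^ n * (m * c - c ^ 2) ≤ 4 * B * m := by
    have := mul_le_mul_of_nonneg_left h3 (mul_nonneg hqn.le h4)
    nlinarith
  have h6 : (m * c - c ^ 2) * (64 * q) ≤ m ^ 2 := by
    refine le_of_mul_le_mul_left ?_ hqn
    calc (q : ℝ) ^ n * ((m * c - c ^ 2) * (64 * q))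
        = (q : ℝ) ^ n * (m * c - c ^ 2) * (64 * q) := by ring
      _ ≤ 4 * (B : ℝ) * m * (64 * q) := mul_le_mul_of_nonneg_right h5 (by positivity)
      _ = ((B : ℝ) * (256 * q)) * m := by ring
      _ ≤ ((m : ℝ) * q ^ n) * m := mul_le_mul_of_nonneg_right hQR hmpos.le
      _ = _ := by ring
  rcases le_total (2 * c) m with hcm | hcm
  · left
    have : c * (32 * q) ≤ m := by
      refine le_of_mul_le_mul_left ?_ hmpos
      have h7 : m * c ≤ 2 * (m * c - c ^ 2) := by nlinarith
      have := mul_le_mul_of_nonneg_right h7 (by positivity : (0 : ℝ) ≤ 32 * q)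
      nlinarith
    rw [hc] at this
    exact_mod_cast this
  · right
    have : (m - c) * 32 ≤ m := by
      refine le_of_mul_le_mul_left ?_ hmpos
      have h7 : m * (m - c) ≤ 2 * (m * c - c ^ 2) := by nlinarith
      have h8 : (m * c - c ^ 2) * (64 * 1) ≤ (m * c - c ^ 2) * (64 * q) := by
        refine mul_le_mul_of_nonneg_left ?_ h4
        linarith
      nlinarith
    rw [← hCR] at this
    exact_mod_cast this

end Boosting

section Transport

variable {F : Type} [Field F] [Fintype F] [DecidableEq F] {n ℓ t : ℕ}

lemma quiet_bound_mul_le {q N I : ℕ} (hq : 2 ≤ q) {S m : ℕ} (hS : S * q ^ 30 ≤ m)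
    (hI : I ≤ q ^ 4) (hN : N ≤ I * q ^ 3 * S) : N * (256 * q) ≤ m := by
  have h1 : 256 ≤ q ^ 8 := by simpa using Nat.pow_le_pow_left hq 8
  calc N * (256 * q) ≤ (q ^ 4 * q ^ 3 * S) * (q ^ 8 * q) :=
        Nat.mul_le_mul (hN.trans (Nat.mul_le_mul_right _ (Nat.mul_le_mul_right _ hI)))
          (Nat.mul_le_mul_right _ h1)
    _ = S * q ^ 16 := by ring
    _ ≤ S * q ^ 30 := Nat.mul_le_mul_left _ (Nat.pow_le_pow_right (by omega) (by norm_num))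
    _ ≤ m := hS

namespace BlockTests

variable {A : BlockTests F ℓ t} {f : (Fin n → F) → F} {b : Fin n → F} {x x' : Fin ℓ → F} {κ : F}

open Classical in
lemma card_not_mul_le {I J : Finset (Fin ℓ)}
    (hS : #(rejSet A.tests f) * Fintype.card F ^ 30 ≤
      Fintype.card (Matrix (Fin n) (Fin ℓ) F) * Fintype.card F ^ n)
    (hJ : ∀ h ∈ A.tests, SpreadOn J h) (hI : #I ≤ Fintype.card F ^ 4)
    {R : Matrix (Fin n) (Fin ℓ) F → Prop} (hR : ∀ M w, Quiet A.tests f x b J I M w → R M) :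
    #{M | ¬ R M} * 512 ≤ Fintype.card (Matrix (Fin n) (Fin ℓ) F) := by
  have hq : 2 ≤ Fintype.card F := Fintype.one_lt_card
  have h1 := quiet_bound_mul_le hq hS hI (card_not_mul_le_of_quiet hJ hR)
  have hqn : 0 < Fintype.card F ^ n := by positivity
  refine Nat.le_of_mul_le_mul_right (le_trans ?_ h1) hqn
  have h2 := Nat.mul_le_mul_left (#{M | ¬ R M} * Fintype.card F ^ n)
    (by omega : 512 ≤ 256 * Fintype.card F)
  exact (le_of_eq (by ring)).trans h2

open Classical in
lemma card_class_dichotomy (hS : #(rejSet A.tests f) * Fintype.card F ^ 30 ≤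
      Fintype.card (Matrix (Fin n) (Fin ℓ) F) * Fintype.card F ^ n) (v : F) :
    #{M | throughIp f x b M (A.test 0) = v} * (32 * Fintype.card F) ≤
        Fintype.card (Matrix (Fin n) (Fin ℓ) F) ∨
      #{M | ¬ throughIp f x b M (A.test 0) = v} * 32 ≤
        Fintype.card (Matrix (Fin n) (Fin ℓ) F) := by
  have h1 := card_dichotomy {M | throughIp f x b M (A.test 0) = v}
    (Quiet A.tests f x b ∅ A.freeSet) (fun M w a h1 h2 hM => ?_) ?_
  · rwa [compl_filter] at h1
  · rw [mem_filter] at hM ⊢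
    exact ⟨mem_univ _, (throughIp_eq_of_quiet h1 h2).trans hM.2⟩
  · exact quiet_bound_mul_le Fintype.one_lt_card hS A.card_freeSet_le
      (card_not_quiet_le A.tests f x b (fun h _ => spreadOn_empty h) A.freeSet)

open Classical in
lemma card_not_aligned_of_class (hS : #(rejSet A.tests f) * Fintype.card F ^ 30 ≤
      Fintype.card (Matrix (Fin n) (Fin ℓ) F) * Fintype.card F ^ n)
    (hM : #{M | ¬ throughIp f x b M (A.test 0) = κ * A.core x} * 2 ≤
      Fintype.card (Matrix (Fin n) (Fin ℓ) F)) :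
    #{M | ¬ A.Aligned f b κ x M} * 16 ≤ Fintype.card (Matrix (Fin n) (Fin ℓ) F) := by
  have hq : 2 ≤ Fintype.card F := Fintype.one_lt_card
  have hm : 0 < Fintype.card (Matrix (Fin n) (Fin ℓ) F) := Fintype.card_pos
  have h1 : #{M | ¬ throughIp f x b M (A.test 0) = κ * A.core x} * 32 ≤
      Fintype.card (Matrix (Fin n) (Fin ℓ) F) := by
    refine (card_class_dichotomy hS (κ * A.core x)).resolve_left fun h => ?_
    have h2 := card_filter_add_card_filter_not (s := univ)
      fun M => throughIp f x b M (A.test 0) = κ * A.core x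
    rw [card_univ] at h2
    nlinarith
  have h3 : #{M | ¬ (throughIp f x b M (A.test 0) = κ * A.core x → A.Aligned f b κ x M)} * 512 ≤
      Fintype.card (Matrix (Fin n) (Fin ℓ) F) := by
    convert card_not_mul_le hS (fun h _ => spreadOn_empty h) A.card_freeSet_le (x := x) (b := b)
      (R := fun M => throughIp f x b M (A.test 0) = κ * A.core x → A.Aligned f b κ x M)
      fun M w hQ h0 => aligned_of_quiet hQ h0
  have h4 : #{M | ¬ A.Aligned f b κ x M} ≤
      #((univ.filter fun M => ¬ throughIp f x b M (A.test 0) = κ * A.core x) ∪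
        univ.filter fun M => ¬ (throughIp f x b M (A.test 0) = κ * A.core x →
          A.Aligned f b κ x M)) := by
    refine card_le_card fun M hM => ?_
    simp only [mem_union, mem_filter, mem_univ, true_and] at hM ⊢
    tauto
  have h5 := h4.trans (card_union_le _ _)
  omega

open Classical in
lemma not_aligned_class_le (κ : F) (x : Fin ℓ → F) :
    #{M | ¬ throughIp f x b M (A.test 0) = κ * A.core x} ≤ #{M | ¬ A.Aligned f b κ x M} := by
  refine card_le_card fun M hM => ?_
  simp only [mem_filter, mem_univ, true_and] at hM ⊢
  exact fun h => hM (by rw [h 0 A.valid_zero, test_zero])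

open Classical in
lemma core_ne_zero_of_heavy (hS : #(rejSet A.tests f) * Fintype.card F ^ 30 ≤
      Fintype.card (Matrix (Fin n) (Fin ℓ) F) * Fintype.card F ^ n)
    (hx : Fintype.card (Matrix (Fin n) (Fin ℓ) F) <
      8 * #{M | affThrough x b M ∈ rejSet A.tests f}) : A.core x ≠ 0 := by
  intro h0
  obtain ⟨k, hk, hk0⟩ := prod_eq_zero_iff.1 h0
  have hq : 2 ≤ Fintype.card F := Fintype.one_lt_card
  have h1 := card_not_mul_le hS (A.spreadOn_tests hk) (A.card_block_le k hk) (x := x) (b := b)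
    (R := fun M => affThrough x b M ∉ rejSet A.tests f) fun M w hQ => by
      rw [notMem_rejSet]
      rintro h ⟨e, he, rfl⟩
      rw [ip_affThrough, throughIp_block hk hQ (fun _ _ => rfl) he, hk0, zero_mul]
  simp only [not_not] at h1
  omega

open Classical in
lemma exists_aligned_of_heavy (hS : #(rejSet A.tests f) * Fintype.card F ^ 30 ≤
      Fintype.card (Matrix (Fin n) (Fin ℓ) F) * Fintype.card F ^ n)
    (hx : Fintype.card (Matrix (Fin n) (Fin ℓ) F) <
      8 * #{M | affThrough x b M ∈ rejSet A.tests f}) :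
    ∃ κ : F, κ ≠ 0 ∧
      #{M | ¬ A.Aligned f b κ x M} * 16 ≤ Fintype.card (Matrix (Fin n) (Fin ℓ) F) := by
  have hq : 2 ≤ Fintype.card F := Fintype.one_lt_card
  have hm : 0 < Fintype.card (Matrix (Fin n) (Fin ℓ) F) := Fintype.card_pos
  have hcore := core_ne_zero_of_heavy hS hx
  obtain ⟨v, hv⟩ : ∃ v : F, #{M | ¬ throughIp f x b M (A.test 0) = v} * 32 ≤
      Fintype.card (Matrix (Fin n) (Fin ℓ) F) := by
    by_contra! hcon
    have h1 : ∀ v : F, #{M | throughIp f x b M (A.test 0) = v} * (32 * Fintype.card F) ≤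
        Fintype.card (Matrix (Fin n) (Fin ℓ) F) := fun v =>
      (card_class_dichotomy hS v).resolve_right (hcon v).not_ge
    have h2 := card_eq_sum_card_fiberwise (s := univ) (t := univ)
      (f := fun M => throughIp f x b M (A.test 0)) fun _ _ => mem_univ _
    have h3 := sum_le_sum fun v (_ : v ∈ (univ : Finset F)) => h1 v
    rw [← sum_mul, ← h2, sum_const, card_univ, card_univ, smul_eq_mul] at h3
    nlinarith
  have hκ : v / A.core x * A.core x = v := div_mul_cancel₀ v hcore
  have h1 := card_not_aligned_of_class (x := x) (b := b) (κ := v / A.core x) hS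
    (by rw [hκ]; omega)
  refine ⟨v / A.core x, fun h0 => ?_, h1⟩
  rw [h0] at h1
  have h2 : #{M | affThrough x b M ∈ rejSet A.tests f} ≤ #{M | ¬ A.Aligned f b 0 x M} := by
    refine card_le_card fun M hM => ?_
    simp only [mem_filter, mem_univ, true_and] at hM ⊢
    intro hA
    obtain ⟨h, ⟨e, he, rfl⟩, hne⟩ := mem_rejSet.1 hM
    rw [ip_affThrough, hA e he, zero_mul] at hne
    exact hne rfl
  omega

open Classical in
lemma card_not_aligned_of_block (hS : #(rejSet A.tests f) * Fintype.card F ^ 30 ≤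
      Fintype.card (Matrix (Fin n) (Fin ℓ) F) * Fintype.card F ^ n) {k : ℕ} (hk : k ∈ A.blocks)
    (hx' : ∀ i ∉ A.block k, x' i = x i) (hx : A.factor k x ≠ 0)
    (h : #{M | ¬ A.Aligned f b κ x M} * 16 ≤ Fintype.card (Matrix (Fin n) (Fin ℓ) F)) :
    #{M | ¬ A.Aligned f b κ x' M} * 16 ≤ Fintype.card (Matrix (Fin n) (Fin ℓ) F) := by
  have hq : 2 ≤ Fintype.card F := Fintype.one_lt_card
  refine card_not_aligned_of_class hS ?_
  have h1 := not_aligned_class_le (A := A) (f := f) (b := b) κ x'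
  have h2 : #{M | ¬ (A.Aligned f b κ x M → A.Aligned f b κ x' M)} * 512 ≤
      Fintype.card (Matrix (Fin n) (Fin ℓ) F) := by
    convert card_not_mul_le hS (A.spreadOn_tests hk) (A.card_block_le k hk) (x := x) (b := b)
      (R := fun M => A.Aligned f b κ x M → A.Aligned f b κ x' M)
      fun M w hQ hA => hA.of_block hk hQ hx' hx
  have h3 : #{M | ¬ A.Aligned f b κ x' M} ≤ #((univ.filter fun M => ¬ A.Aligned f b κ x M) ∪
      univ.filter fun M => ¬ (A.Aligned f b κ x M → A.Aligned f b κ x' M)) := by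
    refine card_le_card fun M hM => ?_
    simp only [mem_union, mem_filter, mem_univ, true_and] at hM ⊢
    tauto
  have h4 := h3.trans (card_union_le _ _)
  omega

open Classical in
lemma card_not_aligned_of_free (hS : #(rejSet A.tests f) * Fintype.card F ^ 30 ≤
      Fintype.card (Matrix (Fin n) (Fin ℓ) F) * Fintype.card F ^ n)
    (hx' : ∀ k ∈ A.blocks, ∀ i ∈ A.block k, x i = x' i)
    (h : #{M | ¬ A.Aligned f b κ x M} * 16 ≤ Fintype.card (Matrix (Fin n) (Fin ℓ) F)) :
    #{M | ¬ A.Aligned f b κ x' M} * 16 ≤ Fintype.card (Matrix (Fin n) (Fin ℓ) F) := by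
  refine card_not_aligned_of_class hS ?_
  have h1 := not_aligned_class_le (A := A) (f := f) (b := b) κ x
  rw [A.core_congr hx'] at h1
  simp only [throughIp_zero_congr hx']
  omega

open Classical in
/-- Alignment at one point of the support propagates to the whole support. -/
theorem card_not_aligned_le (hS : #(rejSet A.tests f) * Fintype.card F ^ 30 ≤
      Fintype.card (Matrix (Fin n) (Fin ℓ) F) * Fintype.card F ^ n)
    (hx : A.core x ≠ 0)
    (h : #{M | ¬ A.Aligned f b κ x M} * 16 ≤ Fintype.card (Matrix (Fin n) (Fin ℓ) F)) :
    #{M | ¬ A.Aligned f b κ x' M} * 16 ≤ Fintype.card (Matrix (Fin n) (Fin ℓ) F) := by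
  have key : ∀ K ⊆ A.blocks, #{M | ¬ A.Aligned f b κ ((K.biUnion A.block).piecewise x' x) M} * 16 ≤
      Fintype.card (Matrix (Fin n) (Fin ℓ) F) := by
    intro K
    induction K using Finset.induction_on with
    | empty =>
      intro _
      rwa [show ((∅ : Finset ℕ).biUnion A.block).piecewise x' x = x from
        funext fun i => piecewise_eq_of_notMem _ _ _ (by simp)]
    | insert k K hkK ih =>
      intro hK
      have hk := hK (mem_insert_self k K)
      have hdisj : ∀ i ∈ A.block k, i ∉ K.biUnion A.block := by
        intro i hi hiK
        obtain ⟨k', hk', hik'⟩ := mem_biUnion.1 hiK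
        have hne : k ≠ k' := fun h => hkK (h ▸ hk')
        exact disjoint_left.1
          (A.block_disjoint k hk k' (hK (mem_insert_of_mem hk')) hne) hi hik'
      refine card_not_aligned_of_block hS hk (fun i hi => ?_) ?_
        (ih ((subset_insert _ _).trans hK))
      · simp only [Finset.piecewise, biUnion_insert, mem_union, hi, false_or]
      · rw [A.factor_congr k hk _ x fun i hi => piecewise_eq_of_notMem _ _ _ (hdisj i hi)]
        exact prod_ne_zero_iff.1 hx k hk
  refine card_not_aligned_of_free hS (fun k hk i hi => ?_) (key A.blocks subset_rfl)
  exact piecewise_eq_of_mem _ _ _ (mem_biUnion.2 ⟨k, hk, hi⟩)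

end BlockTests

end Transport

section Correction

variable {F : Type} [Field F] [Fintype F] [DecidableEq F] {n ℓ t : ℕ}

open Classical in
lemma card_not_injective_mul_le (hn : ℓ + 110 ≤ n) :
    #{M : Matrix (Fin n) (Fin ℓ) F | ¬ Function.Injective M.mulVec} * 16 ≤
      Fintype.card (Matrix (Fin n) (Fin ℓ) F) := by
  have hq : 2 ≤ Fintype.card F := Fintype.one_lt_card
  set q := Fintype.card F with hqdef
  have h1 : ({M : Matrix (Fin n) (Fin ℓ) F | ¬ Function.Injective M.mulVec} : Finset _) ⊆
      (univ.erase (0 : Fin ℓ → F)).biUnion fun y => {M | M.mulVec y = 0} := by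
    intro M hM
    have hM := (mem_filter.1 hM).2
    simp only [Function.Injective, not_forall] at hM
    obtain ⟨y, y', hy, hne⟩ := hM
    refine mem_biUnion.2 ⟨y - y', mem_erase.2 ⟨sub_ne_zero.2 hne, mem_univ _⟩,
      mem_filter.2 ⟨mem_univ _, ?_⟩⟩
    rw [Matrix.mulVec_sub, hy, sub_self]
  have h2 : #{M : Matrix (Fin n) (Fin ℓ) F | ¬ Function.Injective M.mulVec} * q ^ n ≤
      q ^ ℓ * Fintype.card (Matrix (Fin n) (Fin ℓ) F) := by
    refine (Nat.mul_le_mul_right _ ((card_le_card h1).trans card_biUnion_le)).trans ?_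
    rw [sum_mul]
    have h3 : ∀ y ∈ univ.erase (0 : Fin ℓ → F),
        #{M : Matrix (Fin n) (Fin ℓ) F | M.mulVec y = 0} * q ^ n ≤
          Fintype.card (Matrix (Fin n) (Fin ℓ) F) := fun y hy => by
      have := card_mulVec_eq (κ := Fin n) (ne_of_mem_erase hy) (0 : Fin n → F)
      rw [Fintype.card_fin] at this
      convert this.le
    refine (sum_le_card_nsmul _ _ _ h3).trans ?_
    rw [smul_eq_mul]
    refine Nat.mul_le_mul_right _ ((card_le_univ _).trans ?_)
    rw [Fintype.card_fun, Fintype.card_fin]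
  have h4 : 16 * q ^ ℓ ≤ q ^ n := by
    calc 16 * q ^ ℓ ≤ q ^ 4 * q ^ ℓ :=
          Nat.mul_le_mul_right _ (by simpa using Nat.pow_le_pow_left hq 4)
      _ = q ^ (4 + ℓ) := (pow_add _ _ _).symm
      _ ≤ q ^ n := Nat.pow_le_pow_right (by omega) (by omega)
  have hql : 0 < q ^ ℓ := by positivity
  refine Nat.le_of_mul_le_mul_right ?_ hql
  calc _ = #{M : Matrix (Fin n) (Fin ℓ) F | ¬ Function.Injective M.mulVec} * (16 * q ^ ℓ) := by
        ring
    _ ≤ _ := Nat.mul_le_mul_left _ h4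
    _ ≤ _ := h2
    _ = _ := mul_comm _ _

/-- The function `f` with its value at `b` decreased by `κ`. -/
def decreaseAt (f : (Fin n → F) → F) (b : Fin n → F) (κ : F) : (Fin n → F) → F :=
  fun y => f y - if y = b then κ else 0

lemma ip_decreaseAt (f : (Fin n → F) → F) (b : Fin n → F) (κ : F) (T : Aff F n ℓ)
    (h : (Fin ℓ → F) → F) : ip (fun p => decreaseAt f b κ (affApp T p)) h =
      ip (fun p => f (affApp T p)) h - ∑ p, if affApp T p = b then κ * h p else 0 := by
  simp only [ip, decreaseAt, ← sum_sub_distrib]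
  exact sum_congr rfl fun p _ => by split_ifs <;> ring

lemma affThrough_of_affApp_eq {T : Aff F n ℓ} {x : Fin ℓ → F} {b : Fin n → F}
    (h : affApp T x = b) : affThrough x b T.1 = T :=
  Prod.ext rfl (by simp [affThrough, ← h, affApp])

lemma affApp_affThrough_eq_iff {M : Matrix (Fin n) (Fin ℓ) F} (hM : Function.Injective M.mulVec)
    {x p : Fin ℓ → F} {b : Fin n → F} : affApp (affThrough x b M) p = b ↔ p = x := by
  rw [affApp_affThrough, add_eq_left]
  refine ⟨fun h => ?_, fun h => by simp [h]⟩
  exact sub_eq_zero.1 (hM (h.trans (Matrix.mulVec_zero M).symm))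

namespace BlockTests

variable {A : BlockTests F ℓ t} {f : (Fin n → F) → F} {b : Fin n → F} {κ : F}

lemma ip_decreaseAt_of_aligned {x : Fin ℓ → F} {M : Matrix (Fin n) (Fin ℓ) F}
    (hM : Function.Injective M.mulVec) (hA : A.Aligned f b κ x M) :
    affThrough x b M ∉ rejSet A.tests (decreaseAt f b κ) := by
  rw [notMem_rejSet]
  rintro h ⟨e, he, rfl⟩
  rw [ip_decreaseAt, ip_affThrough, hA e he]
  simp [affApp_affThrough_eq_iff hM]

lemma Aligned.mem_rejSet {x : Fin ℓ → F} {M : Matrix (Fin n) (Fin ℓ) F}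
    (hA : A.Aligned f b κ x M) (hκ : κ ≠ 0) (hx : A.core x ≠ 0) :
    affThrough x b M ∈ rejSet A.tests f := by
  refine _root_.mem_rejSet.2 ⟨_, A.test_mem A.valid_zero, ?_⟩
  rw [ip_affThrough, hA 0 A.valid_zero, test_zero]
  exact mul_ne_zero hκ hx

lemma exists_affThrough_of_mem_of_notMem {T : Aff F n ℓ}
    (hT' : T ∈ rejSet A.tests (decreaseAt f b κ)) (hT : T ∉ rejSet A.tests f) :
    ∃ x, A.core x ≠ 0 ∧ affThrough x b T.1 = T := by
  obtain ⟨h, hh, hne⟩ := _root_.mem_rejSet.1 hT'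
  rw [ip_decreaseAt, notMem_rejSet.1 hT h hh, zero_sub, neg_ne_zero] at hne
  obtain ⟨x, -, hx⟩ := exists_ne_zero_of_sum_ne_zero hne
  have hxb : affApp T x = b := by
    by_contra hcon
    exact hx (if_neg hcon)
  rw [if_pos hxb] at hx
  obtain ⟨e, -, rfl⟩ := hh
  exact ⟨x, left_ne_zero_of_mul (right_ne_zero_of_mul hx), affThrough_of_affApp_eq hxb⟩

open Classical in
theorem exists_correction (hn : ℓ + 110 ≤ n) (hS : (rejSet A.tests f).Nonempty)
    (hsmall : #(rejSet A.tests f) * Fintype.card F ^ 30 ≤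
      Fintype.card (Matrix (Fin n) (Fin ℓ) F) * Fintype.card F ^ n) :
    ∃ (b : Fin n → F) (f' : (Fin n → F) → F), (∀ y, y ≠ b → f' y = f y) ∧
      2 * #(rejSet A.tests f') + #{x | A.core x ≠ 0} * Fintype.card (Matrix (Fin n) (Fin ℓ) F) ≤
        2 * #(rejSet A.tests f) := by
  set m := Fintype.card (Matrix (Fin n) (Fin ℓ) F) with hm
  have hq : 2 ≤ Fintype.card F := Fintype.one_lt_card
  obtain ⟨x₀, b, hx₀⟩ := exists_heavy_point A.tests f hS (by
    rw [card_aff]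
    exact (Nat.mul_le_mul_left _ (Nat.pow_le_pow_right (by omega) (by norm_num))).trans hsmall)
  obtain ⟨κ, hκ, hal⟩ := exists_aligned_of_heavy hsmall (by convert hx₀)
  refine ⟨b, decreaseAt f b κ, fun y hy => by simp [decreaseAt, hy], ?_⟩
  set S := rejSet A.tests f
  set S' := rejSet A.tests (decreaseAt f b κ)
  set X : Finset (Fin ℓ → F) := {x | A.core x ≠ 0} with hX
  let nice : (Fin ℓ → F) → Matrix (Fin n) (Fin ℓ) F → Prop := fun x M =>
    Function.Injective M.mulVec ∧ A.Aligned f b κ x M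
  have hbad : ∀ x, #{M | ¬ nice x M} * 8 ≤ m := by
    intro x
    have h1 := card_not_aligned_le (x' := x) hsmall
      (core_ne_zero_of_heavy hsmall (by convert hx₀)) hal
    have h2 := card_not_injective_mul_le (F := F) hn
    have h3 : #{M | ¬ nice x M} ≤ #((univ.filter fun M => ¬ A.Aligned f b κ x M) ∪
        univ.filter fun M => ¬ Function.Injective M.mulVec) := by
      refine card_le_card fun M hM => ?_
      simp only [mem_union, mem_filter, mem_univ, true_and, nice] at hM ⊢
      tauto
    have h4 := h3.trans (card_union_le _ _)
    omega
  have hgood : ∀ x, 7 * m ≤ #{M | nice x M} * 8 := by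
    intro x
    have h1 := card_filter_add_card_filter_not (s := univ) fun M => nice x M
    have h2 := hbad x
    rw [card_univ] at h1
    omega
  have hnew : #(S' \ S) * 8 ≤ #X * m := by
    have h1 : #(S' \ S) ≤ #(X.sigma fun x => ({M | ¬ nice x M} : Finset _)) := by
      refine card_le_card_of_surjOn (fun u => affThrough u.1 b u.2) fun T hT => ?_
      obtain ⟨hT', hTS⟩ := mem_sdiff.1 (mem_coe.1 hT)
      obtain ⟨x, hx, hxT⟩ := exists_affThrough_of_mem_of_notMem hT' hTS
      refine ⟨⟨x, T.1⟩, mem_coe.2 (mem_sigma.2 ⟨mem_filter.2 ⟨mem_univ _, hx⟩,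
        mem_filter.2 ⟨mem_univ _, fun hnice => ?_⟩⟩), hxT⟩
      have := ip_decreaseAt_of_aligned hnice.1 hnice.2
      rw [hxT] at this
      exact this hT'
    rw [card_sigma] at h1
    calc #(S' \ S) * 8 ≤ (∑ x ∈ X, #{M | ¬ nice x M}) * 8 := Nat.mul_le_mul_right _ h1
      _ = ∑ x ∈ X, #{M | ¬ nice x M} * 8 := sum_mul _ _ _
      _ ≤ #X • m := sum_le_card_nsmul _ _ _ fun x _ => hbad x
      _ = #X * m := smul_eq_mul _ _
  have hold : 7 * (#X * m) ≤ #(S \ S') * 8 := by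
    have h1 : #(X.sigma fun x => ({M | nice x M} : Finset _)) ≤ #(S \ S') := by
      refine card_le_card_of_injOn (fun u => affThrough u.1 b u.2) (fun u hu => ?_) ?_
      · obtain ⟨hux, hu2⟩ := mem_sigma.1 (mem_coe.1 hu)
        have hnice := (mem_filter.1 hu2).2
        exact mem_coe.2 (mem_sdiff.2 ⟨hnice.2.mem_rejSet hκ (mem_filter.1 hux).2,
          ip_decreaseAt_of_aligned hnice.1 hnice.2⟩)
      · rintro ⟨x, M⟩ hu ⟨x', M'⟩ hu' he
        have hnice := (mem_filter.1 (mem_sigma.1 (mem_coe.1 hu)).2).2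
        dsimp only at he hnice
        obtain rfl : M = M' := congrArg Prod.fst he
        have h2 : affApp (affThrough x b M) x' = b := by
          rw [he, affApp_affThrough_eq_iff hnice.1]
        rw [affApp_affThrough_eq_iff hnice.1] at h2
        rw [h2]
    rw [card_sigma] at h1
    calc 7 * (#X * m) = #X • (7 * m) := by rw [smul_eq_mul]; ring
      _ ≤ ∑ x ∈ X, #{M | nice x M} * 8 := card_nsmul_le_sum _ _ _ fun x _ => hgood x
      _ = (∑ x ∈ X, #{M | nice x M}) * 8 := (sum_mul _ _ _).symm
      _ ≤ _ := Nat.mul_le_mul_right _ h1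
  have h1 := card_sdiff_add_card_inter S' S
  have h2 := card_sdiff_add_card_inter S S'
  rw [inter_comm] at h2
  generalize #X * m = K at *
  omega

end BlockTests

end Correction

section HfunTests

variable {F : Type} [Field F] [Fintype F] [DecidableEq F]

/-- The `k`-th block of `p` consecutive coordinates. -/
def consecutiveBlock (p ℓ k : ℕ) : Finset (Fin ℓ) :=
  univ.filter fun i => p * k ≤ i ∧ (i : ℕ) < p * k + p

lemma mem_consecutiveBlock {p ℓ k : ℕ} {i : Fin ℓ} :
    i ∈ consecutiveBlock p ℓ k ↔ p * k ≤ i ∧ (i : ℕ) < p * k + p := by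
  simp [consecutiveBlock]

lemma mul_add_le_of_lt_div {p s k : ℕ} (hk : k < s / p) : p * k + p ≤ s :=
  calc p * k + p = p * (k + 1) := by ring
    _ ≤ p * (s / p) := Nat.mul_le_mul_left _ hk
    _ ≤ s := Nat.mul_div_le s p

lemma card_consecutiveBlock_le (p ℓ k : ℕ) : #(consecutiveBlock p ℓ k) ≤ p := by
  rw [← card_image_of_injective _ Fin.val_injective]
  refine (card_le_card (t := Ico (p * k) (p * k + p)) fun i hi => ?_).trans_eq (by simp)
  obtain ⟨j, hj, rfl⟩ := mem_image.1 hi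
  exact mem_Ico.2 (mem_consecutiveBlock.1 hj)

lemma disjoint_consecutiveBlock {p ℓ k k' : ℕ} (h : k ≠ k') :
    Disjoint (consecutiveBlock p ℓ k) (consecutiveBlock p ℓ k') := by
  refine disjoint_left.2 fun i hi hi' => ?_
  rw [mem_consecutiveBlock] at hi hi'
  rcases Nat.lt_or_gt_of_ne h with h | h
  · have := Nat.mul_le_mul_left p (Nat.succ_le_of_lt h)
    rw [Nat.mul_succ] at this
    omega
  · have := Nat.mul_le_mul_left p (Nat.succ_le_of_lt h)
    rw [Nat.mul_succ] at this
    omega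

/-- The factor of the test function `Hfun` that depends on the `k`-th block. -/
def blockFactor {p ℓ : ℕ} (P : MvPolynomial (Fin p) F) (k : ℕ) (x : Fin ℓ → F) : F :=
  MvPolynomial.eval (fun l : Fin p =>
    if h : p * k + (l : ℕ) < ℓ then x ⟨p * k + (l : ℕ), h⟩ else 0) P

lemma blockFactor_congr {p ℓ : ℕ} (P : MvPolynomial (Fin p) F) (k : ℕ) {x x' : Fin ℓ → F}
    (h : ∀ i ∈ consecutiveBlock p ℓ k, x i = x' i) : blockFactor P k x = blockFactor P k x' := by
  unfold blockFactor
  congr 2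
  funext l
  split_ifs with hl
  · exact h _ (mem_consecutiveBlock.2 ⟨Nat.le_add_right _ _, Nat.add_lt_add_left l.2 _⟩)
  · rfl

lemma natAdd_notMem_consecutiveBlock {p s t k : ℕ} (hk : k < s / p) (j : Fin t) :
    Fin.natAdd s j ∉ consecutiveBlock p (s + t) k := by
  rw [mem_consecutiveBlock, Fin.val_natAdd]
  have := mul_add_le_of_lt_div hk
  omega

/-- The family of test functions `Hfun`. -/
def hfunTests {p q : ℕ} (hp : p.Prime) (hpq : p ≤ q) (hF : Fintype.card F = q)
    {P : MvPolynomial (Fin p) F} (hP : Pdef p q hp.pos P) (s r : ℕ) {t : ℕ} (ht : 0 < t)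
    (htq : t ≤ q ^ 4) : BlockTests F (s + t) t where
  blocks := range (s / p)
  block := consecutiveBlock p (s + t)
  factor := blockFactor P
  free := Fin.natAdd s
  valid := validE q r t
  factor_congr k _ _ _ h := blockFactor_congr P k h
  block_disjoint _ _ _ _ h := disjoint_consecutiveBlock h
  free_notMem _ hk := natAdd_notMem_consecutiveBlock (mem_range.1 hk)
  valid_zero := ⟨fun _ => Nat.zero_le _, by simp⟩
  valid_piecewise e K he := by
    have h : ∀ j, K.piecewise 0 e j ≤ e j := fun j => by
      by_cases hj : j ∈ K <;> simp [hj]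
    exact ⟨fun j => (h j).trans (he.1 j), (sum_le_sum fun j _ => h j).trans he.2⟩
  spread k hk e _ := by
    have hks := mul_add_le_of_lt_div (mem_range.1 hk)
    have hlt : ∀ l : Fin p, p * k + (l : ℕ) < s + t := fun l => by have := l.2; omega
    refine spreadOn_of_factor (P := P) (u := fun l => ⟨p * k + (l : ℕ), hlt l⟩)
      (ρ := fun x => (∏ k' ∈ (range (s / p)).erase k, blockFactor P k' x) *
        ∏ j, x (Fin.natAdd s j) ^ e j)
      (by rw [hF]; exact totalDegree_of_Pdef hp hpq hP)
      (fun l => mem_consecutiveBlock.2 ⟨Nat.le_add_right _ _, Nat.add_lt_add_left l.2 _⟩)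
      fun z x => ?_
    rw [← mul_prod_erase _ _ hk, mul_assoc]
    have h : ∀ i ∉ consecutiveBlock p (s + t) k,
        blockSubst (consecutiveBlock p (s + t) k) z x i = x i := fun i hi => if_neg hi
    congr 1
    · simp only [blockFactor, hlt, dite_true]
    · congr 1
      · refine prod_congr rfl fun k' hk' => blockFactor_congr P k' fun i hi => h i ?_
        exact disjoint_left.1 (disjoint_consecutiveBlock (ne_of_mem_erase hk')) hi
      · refine prod_congr rfl fun j _ => ?_
        rw [h _ (natAdd_notMem_consecutiveBlock (mem_range.1 hk) j)]
  card_block_le k _ := by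
    rw [hF]
    exact ((card_consecutiveBlock_le p _ k).trans hpq).trans (Nat.le_self_pow (by norm_num) q)
  pos := ht
  le := by rwa [hF]

variable {p q : ℕ} {hp : p.Prime} {hpq : p ≤ q} {hF : Fintype.card F = q}
  {P : MvPolynomial (Fin p) F} {hP : Pdef p q hp.pos P} {s r t : ℕ} {ht : 0 < t}
  {htq : t ≤ q ^ 4}

lemma hfunTests_test (e : Fin t → ℕ) :
    (hfunTests hp hpq hF hP s r ht htq).test e = Hfun P s t e := rfl

lemma mu_rejects_eq {n : ℕ} (f : (Fin n → F) → F) :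
    mu {T : Aff F n (s + t) | rejects P q s r t n f T} =
      (#(rejSet (hfunTests hp hpq hF hP s r ht htq).tests f) : ℝ) /
        (Fintype.card (Matrix (Fin n) (Fin (s + t)) F) * (q : ℝ) ^ n) := by
  have h : {T : Aff F n (s + t) | rejects P q s r t n f T} =
      (rejSet (hfunTests hp hpq hF hP s r ht htq).tests f : Set (Aff F n (s + t))) := by
    ext T
    simp only [Set.mem_ofPred_eq, mem_coe, mem_rejSet]
    constructor
    · rintro ⟨e, he, h⟩
      exact ⟨_, ⟨e, he, rfl⟩, h⟩
    · rintro ⟨_, ⟨e, he, rfl⟩, h⟩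
      exact ⟨e, he, h⟩
  rw [mu, h, Nat.card_eq_fintype_card, Nat.card_eq_fintype_card, card_aff, hF]
  simp

lemma ncard_suppH_eq : (suppH P q s t).ncard =
    #{x | (hfunTests hp hpq hF hP s r ht htq).core x ≠ 0} := by
  rw [← Set.ncard_coe_finset]
  congr 1
  ext x
  simp only [suppH, Set.mem_ofPred_eq, coe_filter, mem_univ, true_and]
  constructor
  · rintro ⟨e, -, h⟩
    exact left_ne_zero_of_mul h
  · intro h
    rw [← BlockTests.test_zero, hfunTests_test] at h
    exact ⟨0, fun _ => Nat.zero_le _, h⟩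

end HfunTests

/-- There are absolute constants `M₀` and `C₀ > 0` such that: if
`0 < rej_{s+t}(f) < q^{-M₀}`, then there is a point `b` and a function `f'` agreeing with `f`
away from `b` with `rej_{s+t}(f') ≤ rej_{s+t}(f) - |supp(H)|/(C₀·q·q^n)`. -/
theorem correction_step :
    ∃ M₀ C₀ : ℝ, 0 < C₀ ∧
    ∀ (p k : ℕ) (hp : p.Prime), 1 ≤ k →
    ∀ (F : Type) [Field F] [Fintype F],
    ∀ q : ℕ, q = p ^ k → Fintype.card F = q →
    ∀ d s r : ℕ, p ∣ s → 0 < r → r ≤ p * (q - q / p) → d + 1 = s * (q - q / p) + r →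
    ∀ t : ℕ, t = max (p + 2) 10 →
    ∀ P : MvPolynomial (Fin p) F, Pdef p q hp.pos P →
    ∀ n : ℕ, s + t + 110 ≤ n →
    ∀ f : (Fin n → F) → F,
      0 < mu {T : Aff F n (s + t) | rejects P q s r t n f T} →
      mu {T : Aff F n (s + t) | rejects P q s r t n f T} < (q : ℝ) ^ (-M₀) →
    ∃ (b : Fin n → F) (f' : (Fin n → F) → F),
      (∀ y : Fin n → F, y ≠ b → f' y = f y) ∧
      mu {T : Aff F n (s + t) | rejects P q s r t n f' T} ≤
        mu {T : Aff F n (s + t) | rejects P q s r t n f T} -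
          ((suppH P q s t).ncard : ℝ) / (C₀ * (q : ℝ) * (q : ℝ) ^ n) := by
  refine ⟨30, 2, two_pos, ?_⟩
  intro p k hp hk F _ _ q hq hF d s r _ _ _ _ t ht P hP n hn f hpos hlt
  classical
  have hp2 := hp.two_le
  have hpq : p ≤ q := hq ▸ Nat.le_self_pow (by omega) p
  have htq : t ≤ q ^ 4 := by
    have h8 : 2 ^ 3 ≤ q ^ 3 := Nat.pow_le_pow_left (hp2.trans hpq) 3
    have : q ^ 4 = q ^ 3 * q := pow_succ q 3
    rw [ht, max_le_iff]
    constructor <;> nlinarith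
  have ht0 : 0 < t := by omega
  set A := hfunTests hp hpq hF hP s r ht0 htq with hA
  simp only [mu_rejects_eq (hp := hp) (hpq := hpq) (hF := hF) (hP := hP) (ht := ht0)
    (htq := htq), ← hA] at hpos hlt ⊢
  rw [ncard_suppH_eq (hp := hp) (hpq := hpq) (hF := hF) (hP := hP) (ht := ht0)
    (htq := htq) (r := r), ← hA]
  have hq1 : (1 : ℝ) ≤ q := by exact_mod_cast hp.one_le.trans hpq
  set m := Fintype.card (Matrix (Fin n) (Fin (s + t)) F) with hm
  have hm0 : (0 : ℝ) < m := by exact_mod_cast Fintype.card_pos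
  have hqn : (0 : ℝ) < (q : ℝ) ^ n := by positivity
  have hq30 : (0 : ℝ) < (q : ℝ) ^ 30 := by positivity
  have hS : (rejSet A.tests f).Nonempty := by
    refine card_pos.1 (Nat.pos_of_ne_zero fun h0 => ?_)
    rw [h0] at hpos
    simp at hpos
  have hsmall : #(rejSet A.tests f) * Fintype.card F ^ 30 ≤ m * Fintype.card F ^ n := by
    rw [Real.rpow_neg (by positivity), show (30 : ℝ) = (30 : ℕ) by norm_num, Real.rpow_natCast,
      div_lt_iff₀ (by positivity), inv_mul_eq_div, lt_div_iff₀ hq30] at hlt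
    rw [hF]
    exact_mod_cast hlt.le
  obtain ⟨b, f', hf', hcard⟩ := A.exists_correction hn hS hsmall
  refine ⟨b, f', hf', ?_⟩
  have h1 : 2 * (#(rejSet A.tests f') : ℝ) + #{x | A.core x ≠ 0} * (m : ℝ) ≤
      2 * #(rejSet A.tests f) := by exact_mod_cast hcard
  have h2 : (#{x | A.core x ≠ 0} : ℝ) / (2 * q * q ^ n) ≤
      (#{x | A.core x ≠ 0} : ℝ) * m / (2 * (m * q ^ n)) := by
    rw [div_le_div_iff₀ (by positivity) (by positivity)]
    have : (0 : ℝ) ≤ #{x | A.core x ≠ 0} * (2 * (m * q ^ n)) := by positivity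
    nlinarith
  have h3 : (#(rejSet A.tests f') : ℝ) / (m * q ^ n) +
      (#{x | A.core x ≠ 0} : ℝ) * m / (2 * (m * q ^ n)) ≤
      (#(rejSet A.tests f) : ℝ) / (m * q ^ n) := by
    rw [div_add_div _ _ (by positivity) (by positivity),
      div_le_div_iff₀ (by positivity) (by positivity)]
    have : (0 : ℝ) < (m * q ^ n) * (m * q ^ n) := by positivity
    nlinarith
  linarith

end
end

section
/- Let n ≥ 2 and let F be an F_q-linear subspace of the space of functions F_q^n → F_q that is affine-invariant, i.e., g ∈ F implies g∘T ∈ F for every affine map T : F_q^n → F_q^n. Let e ∈ {0,…,q−1}^n and let m ∈ ℕ satisfy m ≤_p e_2 (every base-p digit of m is at most the corresponding base-p digit of e_2) and e_1 + m ≤ q−1. If the monomial function x ↦ Π_{i=1}^{n} x_i^{e_i} belongs to F, then the monomial function x ↦ x_1^{e_1+m}·x_2^{e_2−m}·Π_{i=3}^{n} x_i^{e_i} also belongs to F. -/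
noncomputable section

open Finset

/-- Lucas: `n.choose m` is prime to `p` when the base-`p` digits of `m` are at most those of `n`. -/
theorem not_dvd_choose_of_digit_le {p : ℕ} (hp : p.Prime) (n m : ℕ)
    (h : ∀ j : ℕ, m / p ^ j % p ≤ n / p ^ j % p) : ¬ p ∣ n.choose m := by
  have := Fact.mk hp
  induction n using Nat.strong_induction_on generalizing m with
  | _ n ih =>
    rcases Nat.eq_zero_or_pos m with rfl | hm
    · simpa using hp.one_lt.ne'
    have hn : 0 < n := by
      by_contra hn
      obtain rfl : n = 0 := by omega
      have hdigits : ∀ j, m / p ^ j % p = 0 := fun j => by simpa using h j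
      have hdvd : ∀ j, p ^ j ∣ m := by
        intro j
        induction j with
        | zero => simp
        | succ j hj =>
          obtain ⟨c, rfl⟩ := hj
          have hc := hdigits j
          rw [Nat.mul_div_cancel_left _ (pow_pos hp.pos j)] at hc
          rw [pow_succ]
          exact Nat.mul_dvd_mul_left _ (Nat.dvd_of_mod_eq_zero hc)
      exact (Nat.lt_pow_self hp.one_lt).not_ge (Nat.le_of_dvd hm (hdvd m))
    rw [(Choose.choose_modEq_choose_mod_mul_choose_div_nat (n := n) (k := m) (p := p)).dvd_iff
      dvd_rfl, hp.dvd_mul, not_or]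
    constructor
    · intro hdvd
      have hle : m % p ≤ n % p := by simpa using h 0
      have hfact := (hp.dvd_factorial (n := n % p)).1
        (hdvd.trans (Dvd.intro _ (by
          rw [← mul_assoc]
          exact Nat.choose_mul_factorial_mul_factorial hle)))
      exact hfact.not_gt (Nat.mod_lt _ hp.pos)
    · refine ih (n / p) (Nat.div_lt_self hn hp.one_lt) (m / p) fun j => ?_
      simpa [Nat.div_div_eq_div_mul, ← pow_succ'] using h (j + 1)

/-- Coefficient extraction: if a vector-valued polynomial of degree less than `|F|` takes all its
values in a subspace, then its coefficients lie in that subspace. -/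
theorem Submodule.mem_of_forall_sum_pow_smul_mem {F M : Type*} [Field F] [Fintype F]
    [AddCommGroup M] [Module F M] (V : Submodule F M) {N : ℕ} (hN : N ≤ Fintype.card F)
    (h : ℕ → M) (hV : ∀ a : F, ∑ j ∈ range N, a ^ j • h j ∈ V) {j : ℕ} (hj : j < N) :
    h j ∈ V := by
  by_contra hnot
  obtain ⟨φ, hφ, hle⟩ := Submodule.exists_le_ker_of_notMem hnot
  let P : Polynomial F := ∑ i ∈ range N, Polynomial.monomial i (φ (h i))
  have hdeg : P.degree < N := by
    refine (Polynomial.degree_sum_le _ _).trans_lt ?_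
    refine (Finset.sup_lt_iff (WithBot.bot_lt_coe N)).2 fun i hi => ?_
    exact (Polynomial.degree_monomial_le _ _).trans_lt (WithBot.coe_lt_coe.2 (mem_range.1 hi))
  have hP : P = 0 := by
    refine Polynomial.eq_zero_of_degree_lt_of_eval_finset_eq_zero univ
      (hdeg.trans_le (by exact_mod_cast hN)) fun a _ => ?_
    have ha : φ (∑ j ∈ range N, a ^ j • h j) = 0 := hle (hV a)
    simpa [P, Polynomial.eval_finsetSum, mul_comm] using ha
  have hcoeff : P.coeff j = φ (h j) := by
    simp [P, Polynomial.finsetSum_coeff, Polynomial.coeff_monomial, hj]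
  exact hφ (by rw [← hcoeff, hP, Polynomial.coeff_zero])

/-- Monomial shift within an affine-invariant linear family: if
`x^e ∈ F`, `m ≤_p e_2` (digitwise in base `p`) and `e_1 + m ≤ q - 1`, then the monomial
`x_1^{e_1+m} x_2^{e_2-m} ∏_{i≥3} x_i^{e_i}` is also in `F`. -/
theorem monomial_shift
    (p k : ℕ) (hp : p.Prime) (hk : 1 ≤ k)
    (F : Type) [Field F] [Fintype F]
    (q : ℕ) (hq : q = p ^ k) (hcard : Fintype.card F = q)
    (n : ℕ) (hn : 2 ≤ n)
    (V : Submodule F ((Fin n → F) → F))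
    (hinv : ∀ g ∈ V, ∀ T : Aff F n n, (fun x => g (affApp T x)) ∈ V)
    (e : Fin n → ℕ) (he : ∀ i, e i ≤ q - 1)
    (m : ℕ)
    (hm : ∀ j : ℕ, m / p ^ j % p ≤ e ⟨1, by omega⟩ / p ^ j % p)
    (hsum : e ⟨0, by omega⟩ + m ≤ q - 1)
    (hmem : (fun x : Fin n → F => ∏ i, x i ^ e i) ∈ V) :
    (fun x : Fin n → F =>
        x ⟨0, by omega⟩ ^ (e ⟨0, by omega⟩ + m) * x ⟨1, by omega⟩ ^ (e ⟨1, by omega⟩ - m) *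
        ∏ i ∈ (Finset.univ.erase (⟨0, by omega⟩ : Fin n)).erase ⟨1, by omega⟩, x i ^ e i) ∈ V := by
  have := Fact.mk hp
  have : CharP F p := charP_of_card_eq_prime_pow (hcard.trans hq)
  have hq0 : 0 < q := hcard ▸ Fintype.card_pos
  set i₀ : Fin n := ⟨0, by omega⟩ with hi₀
  set i₁ : Fin n := ⟨1, by omega⟩ with hi₁
  have hne : i₁ ≠ i₀ := by simp [hi₀, hi₁]
  have hchoose : ¬ p ∣ (e i₁).choose m := not_dvd_choose_of_digit_le hp _ _ hm
  have hme : m ≤ e i₁ := by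
    by_contra hlt
    exact hchoose (by simp [Nat.choose_eq_zero_of_lt (not_le.1 hlt)])
  have hsplit : ∀ y : Fin n → F,
      ∏ i, y i ^ e i = y i₀ ^ e i₀ * (y i₁ ^ e i₁ *
        ∏ i ∈ (univ.erase i₀).erase i₁, y i ^ e i) := fun y => by
    rw [mul_prod_erase _ (fun i => y i ^ e i) (mem_erase.2 ⟨hne, mem_univ _⟩),
      mul_prod_erase _ (fun i => y i ^ e i) (mem_univ _)]
  let mono : ℕ → (Fin n → F) → F := fun j x =>
    x i₀ ^ (e i₀ + j) * x i₁ ^ (e i₁ - j) * ∏ i ∈ (univ.erase i₀).erase i₁, x i ^ e i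
  have hbound : e i₁ + 1 ≤ Fintype.card F := by
    have := he i₁
    omega
  have hmono : ((e i₁).choose m : F) • mono m ∈ V := by
    refine V.mem_of_forall_sum_pow_smul_mem hbound
      (fun j => ((e i₁).choose j : F) • mono j) (fun a => ?_) (Nat.lt_succ_of_le hme)
    convert hinv _ hmem (1 + Matrix.single i₁ i₀ a, 0) using 1
    funext x
    have happ : ∀ i, affApp (1 + Matrix.single i₁ i₀ a, 0) x i =
        x i + if i = i₁ then a * x i₀ else 0 := fun i => by
      simp [affApp, Matrix.add_mulVec, Matrix.single_mulVec, Function.update_apply]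
    have hrest : ∏ i ∈ (univ.erase i₀).erase i₁,
        affApp (1 + Matrix.single i₁ i₀ a, 0) x i ^ e i =
        ∏ i ∈ (univ.erase i₀).erase i₁, x i ^ e i :=
      prod_congr rfl fun i hi => by simp [happ, (mem_erase.1 hi).1]
    rw [hsplit, hrest, happ, happ, if_neg hne.symm, if_pos rfl, add_zero, add_comm (x i₁), add_pow,
      sum_mul, mul_sum, Finset.sum_apply]
    refine sum_congr rfl fun j _ => ?_
    simp only [mono, Pi.smul_apply, smul_eq_mul]
    ring
  exact (V.smul_mem_iff (by rwa [Ne, CharP.cast_eq_zero_iff F p])).1 hmono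

end
end
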